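/- Let (u_p)_{p>1} be a family of low energy nodal solutions of (P_p). For any δ ∈ (0,1) there exist p_δ > p₀, R_δ > 1 and C_δ > 0 such that for i = 1,2, v_{i,p}(z) ≤ (4 − δ) log(1/|z|) + C_δ whenever R_δ ≤ |z| ≤ ϱ₀/ε_{i,p} and p > p_δ. -/

import Mathlib

open Real MeasureTheory Metric Filter Topology Bornology

noncomputable section

abbrev E2 : Type := EuclideanSpace ℝ (Fin 2)

/-- Laplacian of `u : ℝ² → ℝ` via coordinate second derivatives. -/
def lap (u : E2 → ℝ) (x : E2) : ℝ :=
  ∑ i : Fin 2,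
    fderiv ℝ (fun y => fderiv ℝ u y (EuclideanSpace.single i 1)) x (EuclideanSpace.single i 1)

/-- `u` is a (classical) solution of the Lane–Emden problem `(P_p)` on `Ω`. -/
def IsSolution (Ω : Set E2) (p : ℝ) (u : E2 → ℝ) : Prop :=
  ContDiffOn ℝ 2 u Ω ∧ ContinuousOn u (closure Ω) ∧
    (∀ x ∈ Ω, -lap u x = |u x| ^ (p - 1) * u x) ∧
    (∀ x ∈ frontier Ω, u x = 0)

/-- `u` is a nodal (sign-changing) function on `Ω`. -/
def IsNodal (Ω : Set E2) (u : E2 → ℝ) : Prop :=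
  (∃ x ∈ Ω, 0 < u x) ∧ (∃ x ∈ Ω, u x < 0)

/-- The Green function of `-Δ` on `Ω` with Dirichlet boundary conditions, together with
its regular part `H`, so that `G(x,y) = -(1/2π) log|x-y| + H(x,y)`. -/
structure GreenData (Ω : Set E2) where
  G : E2 → E2 → ℝ
  H : E2 → E2 → ℝ
  decomp : ∀ x y, G x y = -(1 / (2 * π)) * Real.log ‖x - y‖ + H x y
  bdry : ∀ x ∈ Ω, ∀ y ∈ frontier Ω, G x y = 0
  symm : ∀ x y, G x y = G y x
  smoothH : ContDiffOn ℝ (⊤ : ℕ∞) (fun q : E2 × E2 => H q.1 q.2) (Ω ×ˢ Ω)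
  contH : ∀ x ∈ Ω, ContinuousOn (H x) (closure Ω)
  harmH : ∀ x ∈ Ω, ∀ y ∈ Ω, lap (H x) y = 0

/-- The Kirchhoff–Routh type function `Ψ(a₁,a₂) = 2G(a₁,a₂) − R(a₁) − R(a₂)`. -/
def KR {Ω : Set E2} (gd : GreenData Ω) (q : E2 × E2) : ℝ :=
  2 * gd.G q.1 q.2 - gd.H q.1 q.1 - gd.H q.2 q.2

/-- `q` is a non-degenerate critical point of `F`. -/
def NondegCrit (F : E2 × E2 → ℝ) (q : E2 × E2) : Prop :=
  fderiv ℝ F q = 0 ∧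
    ∀ v : E2 × E2, (∀ w : E2 × E2, fderiv ℝ (fun r => fderiv ℝ F r) q v w = 0) → v = 0

/-- Convergence in `C²_loc(S)`: uniform convergence of all derivatives of order `≤ 2`
on compact subsets of `S`. -/
def TendstoC2LocOn (S : Set E2) (F : ℕ → E2 → ℝ) (g : E2 → ℝ) : Prop :=
  ∀ K : Set E2, K ⊆ S → IsCompact K → ∀ k : ℕ, k ≤ 2 →
    TendstoUniformlyOn (fun n x => iteratedFDeriv ℝ k (F n) x)
      (fun x => iteratedFDeriv ℝ k g x) atTop K

/-- `‖u⁺‖_∞` on `closure Ω`. -/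
def supPos (Ω : Set E2) (u : E2 → ℝ) : ℝ := sSup ((fun x => max (u x) 0) '' closure Ω)

/-- `‖u⁻‖_∞` on `closure Ω`. -/
def supNeg (Ω : Set E2) (u : E2 → ℝ) : ℝ := sSup ((fun x => max (-u x) 0) '' closure Ω)

/-- The energy functional `J_p`. -/
def energy (Ω : Set E2) (p : ℝ) (u : E2 → ℝ) : ℝ :=
  (1 / 2) * (∫ x in Ω, ‖fderiv ℝ u x‖ ^ 2) - (1 / (p + 1)) * ∫ x in Ω, |u x| ^ (p + 1)

/-- The standard bubble `U(z) = −2 log(1 + |z|²/8)`. -/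
def Ustd (z : E2) : ℝ := -2 * Real.log (1 + ‖z‖ ^ 2 / 8)

/-- Unit vector at angle `θ`. -/
def circDir (θ : ℝ) : E2 :=
  EuclideanSpace.single 0 (Real.cos θ) + EuclideanSpace.single 1 (Real.sin θ)

/-- Surface integral over the circle `∂B_r(c)`; the integrand may depend on the
outer unit normal (first argument) and on the point (second argument). -/
def surfInt (c : E2) (r : ℝ) (F : E2 → E2 → ℝ) : ℝ :=
  ∫ θ in (0:ℝ)..(2 * π), r * F (circDir θ) (c + r • circDir θ)

/-- Inner product of gradients `⟨∇f, ∇g⟩`. -/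
def gradInner (f g : E2 → ℝ) (x : E2) : ℝ :=
  ∑ j : Fin 2, fderiv ℝ f x (EuclideanSpace.single j 1) *
    fderiv ℝ g x (EuclideanSpace.single j 1)

/-- The quadratic form `P_i` (centred at `c`, radius `r`). -/
def Pform (c : E2) (r : ℝ) (f g : E2 → ℝ) : ℝ :=
  -2 * r * surfInt c r (fun ν x => fderiv ℝ f x ν * fderiv ℝ g x ν) +
    r * surfInt c r (fun _ x => gradInner f g x)

/-- The quadratic form `Q_{ij}` (centred at `c`, radius `r`). -/
def Qform (c : E2) (r : ℝ) (j : Fin 2) (f g : E2 → ℝ) : ℝ :=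
  surfInt c r (fun ν x =>
    -(fderiv ℝ f x (EuclideanSpace.single j 1)) * fderiv ℝ g x ν -
      fderiv ℝ f x ν * fderiv ℝ g x (EuclideanSpace.single j 1) +
      gradInner f g x * ν j)


lemma circDir_zero_coord (θ : ℝ) : circDir θ 0 = Real.cos θ := by simp [circDir]
lemma circDir_one_coord (θ : ℝ) : circDir θ 1 = Real.sin θ := by simp [circDir]

lemma norm_circDir (θ : ℝ) : ‖circDir θ‖ = 1 := by
  rw [EuclideanSpace.norm_eq]
  simp [Fin.sum_univ_two, circDir_zero_coord, circDir_one_coord]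

lemma continuous_circDir : Continuous circDir := by
  have h : circDir = fun θ => Real.cos θ • EuclideanSpace.single (0 : Fin 2) (1:ℝ)
      + Real.sin θ • EuclideanSpace.single (1 : Fin 2) (1:ℝ) := by
    funext θ
    ext i
    fin_cases i <;> simp [circDir]
  rw [h]
  fun_prop

lemma circDir_eq (θ : ℝ) : circDir θ = Real.cos θ • EuclideanSpace.single (0 : Fin 2) (1:ℝ)
      + Real.sin θ • EuclideanSpace.single (1 : Fin 2) (1:ℝ) := by
  ext i
  fin_cases i <;> simp [circDir]

/-- whole-plane polar coordinates on `E2` -/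
lemma polar_full (f : E2 → ℝ) (a : E2) :
    ∫ y, f y = ∫ q in Set.Ioi (0:ℝ) ×ˢ Set.Ioo (-π) π, q.1 * f (a + q.1 • circDir q.2) := by
  have h1 : ∫ y, f y = ∫ y, f (a + y) := (integral_add_left_eq_self f a).symm
  have hmp : MeasurePreserving (fun x : ℝ × ℝ => (WithLp.toLp 2 ![x.1, x.2] : E2)) := by
    have := (PiLp.volume_preserving_toLp (Fin 2)).comp ((volume_preserving_finTwoArrow ℝ).symm)
    exact this
  have hemb : MeasurableEmbedding (fun x : ℝ × ℝ => (WithLp.toLp 2 ![x.1, x.2] : E2)) := by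
    have := ((MeasurableEquiv.toLp 2 (Fin 2 → ℝ)).measurableEmbedding).comp
      ((MeasurableEquiv.finTwoArrow (α := ℝ)).symm.measurableEmbedding)
    exact this
  rw [h1, ← hmp.integral_comp hemb (fun y => f (a + y)), ← integral_comp_polarCoord_symm]
  rw [polarCoord_target]
  refine setIntegral_congr_fun (measurableSet_Ioi.prod measurableSet_Ioo) ?_
  intro q _
  simp only [polarCoord_symm_apply, smul_eq_mul]
  congr 3
  ext i
  fin_cases i <;> simp [circDir]

lemma polar_ball (f : E2 → ℝ) (a : E2) (R : ℝ)
    (hIntg : IntegrableOn (fun q : ℝ × ℝ => q.1 * f (a + q.1 • circDir q.2))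
      (Set.Ioo (0:ℝ) R ×ˢ Set.Ioo (-π) π)) (hR : 0 ≤ R) :
    ∫ y in ball a R, f y = ∫ r in (0:ℝ)..R, r * ∫ θ in (-π)..π, f (a + r • circDir θ) := by
  rw [← integral_indicator measurableSet_ball, polar_full _ a]
  have : ∀ q ∈ Set.Ioi (0:ℝ) ×ˢ Set.Ioo (-π) π, q.1 * (ball a R).indicator f (a + q.1 • circDir q.2)
      = (Set.Ioo (0:ℝ) R ×ˢ Set.Ioo (-π) π).indicator
        (fun q : ℝ × ℝ => q.1 * f (a + q.1 • circDir q.2)) q := by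
    rintro ⟨r, θ⟩ ⟨hr, hθ⟩
    simp only [Set.mem_Ioi] at hr
    by_cases h : r < R
    · rw [Set.indicator_of_mem, Set.indicator_of_mem]
      · exact ⟨⟨hr, h⟩, hθ⟩
      · simp [norm_smul, norm_circDir, abs_of_pos hr, h]
    · rw [Set.indicator_of_notMem, Set.indicator_of_notMem]
      · simp
      · exact fun h' => h h'.1.2
      · simp [norm_smul, norm_circDir, abs_of_pos hr, not_lt.1 h]
  rw [setIntegral_congr_fun (measurableSet_Ioi.prod measurableSet_Ioo) this,
    setIntegral_indicator (measurableSet_Ioo.prod measurableSet_Ioo)]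
  have h2 : (Set.Ioi (0:ℝ) ×ˢ Set.Ioo (-π) π) ∩ (Set.Ioo (0:ℝ) R ×ˢ Set.Ioo (-π) π)
      = Set.Ioo (0:ℝ) R ×ˢ Set.Ioo (-π) π := by
    apply Set.inter_eq_right.2
    exact Set.prod_mono (fun x hx => hx.1) subset_rfl
  rw [h2, Measure.volume_eq_prod, setIntegral_prod _ hIntg, intervalIntegral.integral_of_le hR,
    integral_Ioc_eq_integral_Ioo]
  refine setIntegral_congr_fun measurableSet_Ioo ?_
  intro r _
  simp only
  rw [integral_const_mul, intervalIntegral.integral_of_le (by linarith [pi_pos]),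
    integral_Ioc_eq_integral_Ioo]

lemma polar_ball_radial_mul (k : ℝ → ℝ) (g : E2 → ℝ) (a : E2) (R : ℝ) (hR : 0 ≤ R)
    (hk : ContinuousOn (fun r => r * k r) (Set.Icc 0 R)) (hg : ContinuousOn g (closedBall a R)) :
    ∫ y in ball a R, k ‖y - a‖ * g y
      = ∫ r in (0:ℝ)..R, (r * k r) * ∫ θ in (-π)..π, g (a + r • circDir θ) := by
  rw [polar_ball _ a R _ hR]
  · refine intervalIntegral.integral_congr ?_
    intro r hr
    rw [Set.uIcc_of_le hR] at hr
    have : ∀ θ, ‖a + r • circDir θ - a‖ = r := by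
      intro θ; simp [norm_smul, norm_circDir, abs_of_nonneg hr.1]
    simp only [this, intervalIntegral.integral_const_mul]
    ring
  · have hc : ContinuousOn (fun q : ℝ × ℝ => (q.1 * k q.1) * g (a + q.1 • circDir q.2))
        (Set.Icc (0:ℝ) R ×ˢ Set.Icc (-π) π) := by
      refine ContinuousOn.mul (hk.comp continuousOn_fst (fun q hq => hq.1)) ?_
      refine hg.comp ?_ ?_
      · have := continuous_circDir
        fun_prop
      · intro q hq
        simp [norm_smul, norm_circDir, abs_of_nonneg hq.1.1, hq.1.2]
    have hi := hc.integrableOn_compact (μ := volume) (isCompact_Icc.prod isCompact_Icc)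
    have hi2 := hi.mono_set (Set.prod_mono (Set.Ioo_subset_Icc_self (a := (0:ℝ)) (b := R))
      (Set.Ioo_subset_Icc_self (a := -π) (b := π)))
    refine hi2.congr_fun ?_ (measurableSet_Ioo.prod measurableSet_Ioo)
    rintro ⟨r, θ⟩ ⟨hr, hθ⟩
    simp only at hr
    simp [norm_smul, norm_circDir, abs_of_pos hr.1]
    ring

lemma continuous_mul_log_div (R : ℝ) (hR : 0 < R) : Continuous (fun r => r * Real.log (R / r)) := by
  have h : (fun r => r * Real.log (R / r)) = fun r => r * Real.log R - r * Real.log r := by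
    funext r
    rcases eq_or_ne r 0 with rfl | h
    · simp
    · rw [Real.log_div hR.ne' h]; ring
  rw [h]
  exact (continuous_id.mul continuous_const).sub Real.continuous_mul_log

lemma hasDerivAt_log_div (R r : ℝ) (hR : 0 < R) (hr : 0 < r) :
    HasDerivAt (fun r => Real.log (R / r)) (-(1 / r)) r := by
  have h : HasDerivAt (fun r => Real.log R - Real.log r) (0 - r⁻¹) r :=
    (hasDerivAt_const r _).sub (Real.hasDerivAt_log hr.ne')
  have h2 : HasDerivAt (fun r => Real.log R - Real.log r) (-(1 / r)) r := by
    convert h using 1; simp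
  refine h2.congr_of_eventuallyEq ?_
  filter_upwards [eventually_gt_nhds hr] with x hx
  rw [Real.log_div hR.ne' hx.ne']

lemma integral_log_ball (a : E2) (R : ℝ) (hR : 0 < R) :
    ∫ y in ball a R, Real.log (R / ‖y - a‖) = π * R ^ 2 / 2 := by
  have h := polar_ball_radial_mul (fun r => Real.log (R / r)) (fun _ => 1) a R hR.le
    (continuous_mul_log_div R hR).continuousOn continuousOn_const
  simp only [mul_one] at h
  rw [h]
  simp only [intervalIntegral.integral_const, intervalIntegral.integral_mul_const]
  have h2 : ∫ r in (0:ℝ)..R, r * Real.log (R / r) = R ^ 2 / 4 := by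
    rw [intervalIntegral.integral_eq_sub_of_hasDerivAt_of_le hR.le
      (f := fun r => (r * (r * Real.log (R / r)) ) / 2 + r ^ 2 / 4)]
    · simp [hR.ne']
    · have := continuous_mul_log_div R hR
      fun_prop
    · intro r hr
      have h1 := hasDerivAt_log_div R r hR hr.1
      have := (((hasDerivAt_id r).mul ((hasDerivAt_id r).mul h1)).div_const 2).add
        (((hasDerivAt_id r).pow 2).div_const 4)
      have h0 := hr.1.ne'
      refine (this.congr_deriv ?_).congr_of_eventuallyEq ?_
      · simp
        field_simp
        ring
      · refine Eventually.of_forall fun x => ?_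
        simp
    · exact (continuous_mul_log_div R hR).intervalIntegrable _ _
  rw [h2]
  simp
  ring

lemma integrableOn_log_ball (a : E2) (R : ℝ) (hR : 0 < R) :
    IntegrableOn (fun y => Real.log (R / ‖y - a‖)) (ball a R) := by
  have h := integral_log_ball a R hR
  by_contra hc
  rw [integral_undef hc] at h
  have : 0 < π * R ^ 2 / 2 := by positivity
  linarith

lemma hasDerivAt_param (F F' : ℝ → ℝ → ℝ) (hF : Continuous (Function.uncurry F))
    (hF' : Continuous (Function.uncurry F')) (h : ∀ r θ, HasDerivAt (fun r => F r θ) (F' r θ) r)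
    (a b r : ℝ) :
    HasDerivAt (fun r => ∫ θ in a..b, F r θ) (∫ θ in a..b, F' r θ) r := by
  obtain ⟨C, hC⟩ := ((isCompact_closedBall r 1).prod (isCompact_uIcc (a := a) (b := b))).exists_bound_of_continuousOn
    hF'.continuousOn
  have hc : ∀ r, Continuous (F r) := fun r => hF.comp (Continuous.prodMk_right r)
  have hc' : ∀ r, Continuous (F' r) := fun r => hF'.comp (Continuous.prodMk_right r)
  refine (intervalIntegral.hasDerivAt_integral_of_dominated_loc_of_deriv_le (bound := fun _ => C)
    (closedBall_mem_nhds r one_pos) ?_ ?_ ?_ ?_ ?_ ?_).2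
  · exact Eventually.of_forall fun x => (hc x).aestronglyMeasurable
  · exact (hc r).intervalIntegrable _ _
  · exact (hc' r).aestronglyMeasurable
  · refine Eventually.of_forall fun θ hθ x hx => ?_
    exact hC (x, θ) ⟨hx, Set.uIoc_subset_uIcc hθ⟩
  · exact intervalIntegrable_const
  · exact Eventually.of_forall fun θ hθ x hx => h x θ

/-- circle average -/
def cavg (f : E2 → ℝ) (a : E2) (r : ℝ) : ℝ :=
  (2 * π)⁻¹ * ∫ θ in (-π)..π, f (a + r • circDir θ)

lemma hasDerivAt_circDir (θ : ℝ) : HasDerivAt circDir (circDir (θ + π / 2)) θ := by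
  have h : circDir = fun θ => Real.cos θ • EuclideanSpace.single (0 : Fin 2) (1:ℝ)
      + Real.sin θ • EuclideanSpace.single (1 : Fin 2) (1:ℝ) := by
    funext θ; exact circDir_eq θ
  have h2 := ((Real.hasDerivAt_cos θ).smul_const (EuclideanSpace.single (0 : Fin 2) (1:ℝ))).add
    ((Real.hasDerivAt_sin θ).smul_const (EuclideanSpace.single (1 : Fin 2) (1:ℝ)))
  rw [circDir_eq, Real.cos_add_pi_div_two, Real.sin_add_pi_div_two, h]
  exact h2

lemma circDir_add_pi (θ : ℝ) : circDir (θ + π) = - circDir θ := by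
  rw [circDir_eq, circDir_eq, Real.cos_add_pi, Real.sin_add_pi]
  module

lemma lap_polar (W : E2 → ℝ) (hW : ContDiff ℝ 2 W) (x : E2) (θ : ℝ) :
    lap W x = fderiv ℝ (fderiv ℝ W) x (circDir θ) (circDir θ)
      + fderiv ℝ (fderiv ℝ W) x (circDir (θ + π / 2)) (circDir (θ + π / 2)) := by
  have hd : DifferentiableAt ℝ (fderiv ℝ W) x :=
    ((hW.fderiv_right (m := 1) (by norm_num)).differentiable (by norm_num)) x
  have h1 : ∀ i : Fin 2, fderiv ℝ (fun y => fderiv ℝ W y (EuclideanSpace.single i 1)) x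
      (EuclideanSpace.single i 1) = fderiv ℝ (fderiv ℝ W) x (EuclideanSpace.single i 1)
      (EuclideanSpace.single i 1) := by
    intro i
    rw [fderiv_clm_apply hd (by fun_prop)]
    simp
  unfold lap
  rw [Fin.sum_univ_two, h1, h1]
  rw [circDir_eq, circDir_eq, Real.cos_add_pi_div_two, Real.sin_add_pi_div_two]
  simp only [map_add, map_smul, add_apply, smul_apply, smul_eq_mul]
  have := Real.sin_sq_add_cos_sq θ
  linear_combination (-(fderiv ℝ (fderiv ℝ W) x (EuclideanSpace.single 0 1)
      (EuclideanSpace.single 0 1) + fderiv ℝ (fderiv ℝ W) x (EuclideanSpace.single 1 1)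
      (EuclideanSpace.single 1 1))) * this

lemma lap_continuous (W : E2 → ℝ) (hW : ContDiff ℝ 2 W) : Continuous (lap W) := by
  have h : lap W = fun x => fderiv ℝ (fderiv ℝ W) x (circDir 0) (circDir 0)
      + fderiv ℝ (fderiv ℝ W) x (circDir (0 + π / 2)) (circDir (0 + π / 2)) := by
    funext x; exact lap_polar W hW x 0
  have h2 : Continuous (fderiv ℝ (fderiv ℝ W)) :=
    (hW.fderiv_right (m := 1) (by norm_num)).continuous_fderiv (by norm_num)
  rw [h]
  fun_prop

lemma hasDerivAt_clm_comp (T : E2 → (E2 →L[ℝ] ℝ)) (γ w : ℝ → E2) (γ' w' : E2) (t : ℝ)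
    (T' : E2 →L[ℝ] (E2 →L[ℝ] ℝ))
    (hT : HasFDerivAt T T' (γ t)) (hγ : HasDerivAt γ γ' t) (hw : HasDerivAt w w' t) :
    HasDerivAt (fun t => T (γ t) (w t)) (T' γ' (w t) + T (γ t) w') t := by
  have h1 : HasDerivAt (fun t => T (γ t)) (T' γ') t := hT.comp_hasDerivAt t hγ
  exact h1.clm_apply hw

set_option maxHeartbeats 1000000 in
lemma rep_global (W : E2 → ℝ) (hW : ContDiff ℝ 2 W) (a : E2) (R : ℝ) (hR : 0 < R) :
    W a = cavg W a R + (2 * π)⁻¹ * ∫ y in ball a R, Real.log (R / ‖y - a‖) * (-lap W y) := by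
  have hD1 : ContDiff ℝ 1 (fderiv ℝ W) := hW.fderiv_right (m := 1) (by norm_num)
  have hc1 : Continuous (fderiv ℝ W) := hD1.continuous
  have hc2 : Continuous (fderiv ℝ (fderiv ℝ W)) := hD1.continuous_fderiv (by norm_num)
  have hcW : Continuous W := hW.continuous
  have hcD := continuous_circDir
  have hdW : Differentiable ℝ W := hW.differentiable (by norm_num)
  have hdD : Differentiable ℝ (fderiv ℝ W) := hD1.differentiable (by norm_num)
  set φ : ℝ → ℝ := fun r => ∫ θ in (-π)..π, W (a + r • circDir θ) with hφ
  set φ1 : ℝ → ℝ := fun r => ∫ θ in (-π)..π, fderiv ℝ W (a + r • circDir θ) (circDir θ) with hφ1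
  set φ2 : ℝ → ℝ := fun r => ∫ θ in (-π)..π,
    fderiv ℝ (fderiv ℝ W) (a + r • circDir θ) (circDir θ) (circDir θ) with hφ2
  have hline : ∀ r θ : ℝ, HasDerivAt (fun r : ℝ => a + r • circDir θ) (circDir θ) r := by
    intro r θ
    have := ((hasDerivAt_id r).smul_const (circDir θ)).const_add a
    simpa using this
  have hd1 : ∀ r, HasDerivAt φ (φ1 r) r := by
    intro r
    refine hasDerivAt_param (fun r θ => W (a + r • circDir θ))
      (fun r θ => fderiv ℝ W (a + r • circDir θ) (circDir θ)) ?_ ?_ ?_ _ _ r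
    · unfold Function.uncurry; fun_prop
    · unfold Function.uncurry; fun_prop
    · intro r θ
      exact (hdW _).hasFDerivAt.comp_hasDerivAt r (hline r θ)
  have hd2 : ∀ r, HasDerivAt φ1 (φ2 r) r := by
    intro r
    refine hasDerivAt_param (fun r θ => fderiv ℝ W (a + r • circDir θ) (circDir θ))
      (fun r θ => fderiv ℝ (fderiv ℝ W) (a + r • circDir θ) (circDir θ) (circDir θ)) ?_ ?_ ?_ _ _ r
    · unfold Function.uncurry; fun_prop
    · unfold Function.uncurry; fun_prop
    · intro r θ
      have := hasDerivAt_clm_comp (fderiv ℝ W) (fun r => a + r • circDir θ) (fun _ => circDir θ)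
        (circDir θ) 0 r _ (hdD (a + r • circDir θ)).hasFDerivAt (hline r θ)
        (hasDerivAt_const r (circDir θ))
      rw [map_zero, add_zero] at this
      exact this
  -- angular integration
  have hang : ∀ r, r ^ 2 * ∫ θ in (-π)..π, fderiv ℝ (fderiv ℝ W) (a + r • circDir θ)
      (circDir (θ + π / 2)) (circDir (θ + π / 2)) = r * φ1 r := by
    intro r
    have hder : ∀ θ : ℝ, HasDerivAt
        (fun θ => fderiv ℝ W (a + r • circDir θ) (r • circDir (θ + π / 2)))
        (r ^ 2 * fderiv ℝ (fderiv ℝ W) (a + r • circDir θ) (circDir (θ + π / 2)) (circDir (θ + π / 2))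
          - r * fderiv ℝ W (a + r • circDir θ) (circDir θ)) θ := by
      intro θ
      have hl : HasDerivAt (fun θ : ℝ => a + r • circDir θ) (r • circDir (θ + π / 2)) θ :=
        ((hasDerivAt_circDir θ).const_smul r).const_add a
      have hl2 : HasDerivAt (fun θ : ℝ => r • circDir (θ + π / 2)) (r • circDir (θ + π / 2 + π / 2)) θ :=
        ((hasDerivAt_circDir (θ + π / 2)).comp_add_const θ (π / 2)).const_smul r
      have := hasDerivAt_clm_comp (fderiv ℝ W) (fun θ => a + r • circDir θ)
        (fun θ => r • circDir (θ + π / 2)) _ _ θ _ (hdD (a + r • circDir θ)).hasFDerivAt hl hl2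
      have h3 : θ + π / 2 + π / 2 = θ + π := by ring
      rw [h3, circDir_add_pi] at this
      refine this.congr_deriv ?_
      simp only [map_smul, map_neg, smul_apply, smul_eq_mul, smul_neg]
      ring
    have hI := intervalIntegral.integral_eq_sub_of_hasDerivAt (a := -π) (b := π)
      (fun θ _ => hder θ) (by
        apply Continuous.intervalIntegrable; fun_prop)
    rw [intervalIntegral.integral_sub (by apply Continuous.intervalIntegrable; fun_prop)
      (by apply Continuous.intervalIntegrable; fun_prop), intervalIntegral.integral_const_mul,
      intervalIntegral.integral_const_mul] at hI
    have e1 : circDir (-π) = circDir π := by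
      rw [circDir_eq, circDir_eq]; simp
    have e2 : circDir (-π + π / 2) = circDir (π + π / 2) := by
      have : π + π / 2 = (-π + π / 2) + π + π := by ring
      rw [this, circDir_add_pi, circDir_add_pi, neg_neg]
    rw [e1, e2, sub_self] at hI
    simp only [hφ1]
    linarith
  have hlap : ∀ r, r ≠ 0 → r * φ2 r + φ1 r = r * ∫ θ in (-π)..π, lap W (a + r • circDir θ) := by
    intro r hr
    have : (fun θ => lap W (a + r • circDir θ)) = fun θ =>
      fderiv ℝ (fderiv ℝ W) (a + r • circDir θ) (circDir θ) (circDir θ) +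
      fderiv ℝ (fderiv ℝ W) (a + r • circDir θ) (circDir (θ + π / 2)) (circDir (θ + π / 2)) := by
      funext θ; exact lap_polar W hW _ θ
    rw [this, intervalIntegral.integral_add (by apply Continuous.intervalIntegrable; fun_prop)
      (by apply Continuous.intervalIntegrable; fun_prop)]
    have h3 := hang r
    have h4 : φ1 r = r * ∫ θ in (-π)..π, fderiv ℝ (fderiv ℝ W) (a + r • circDir θ)
      (circDir (θ + π / 2)) (circDir (θ + π / 2)) := by
      apply mul_left_cancel₀ hr
      rw [← h3]; ring
    rw [h4]
    ring
  have hφ1c : Continuous φ1 := continuous_iff_continuousAt.2 fun r => (hd2 r).continuousAt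
  have hφc : Continuous φ := continuous_iff_continuousAt.2 fun r => (hd1 r).continuousAt
  have hlc := lap_continuous W hW
  have hIc : Continuous (fun r : ℝ => ∫ θ in (-π)..π, lap W (a + r • circDir θ)) := by
    refine intervalIntegral.continuous_parametric_intervalIntegral_of_continuous' (μ := volume) ?_ _ _
    unfold Function.uncurry; fun_prop
  have hmain : ∫ r in (0:ℝ)..R, (r * Real.log (R / r)) * ∫ θ in (-π)..π, lap W (a + r • circDir θ)
      = φ R - φ 0 := by
    have hlogc := continuous_mul_log_div R hR
    rw [intervalIntegral.integral_eq_sub_of_hasDerivAt_of_le hR.le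
      (f := fun r => (r * Real.log (R / r)) * φ1 r + φ r)]
    · simp [hR.ne']
    · fun_prop
    · intro r hr
      have h1 := hasDerivAt_log_div R r hR hr.1
      have := ((((hasDerivAt_id r).mul h1)).mul (hd2 r)).add (hd1 r)
      have h0 := hr.1.ne'
      refine (this.congr_deriv ?_).congr_of_eventuallyEq ?_
      · have h5 := hlap r h0
        have h6 : r * -(1 / r) = -1 := by field_simp
        simp only [id, Pi.mul_apply, one_mul]
        rw [h6]
        linear_combination (Real.log (R / r)) * h5
      · exact Eventually.of_forall fun x => by simp
    · apply Continuous.intervalIntegrable; fun_prop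
  have hp := polar_ball_radial_mul (fun r => Real.log (R / r)) (lap W) a R hR.le
    (continuous_mul_log_div R hR).continuousOn hlc.continuousOn
  have hφ0 : φ 0 = 2 * π * W a := by
    simp only [hφ, zero_smul, add_zero, intervalIntegral.integral_const, smul_eq_mul]; ring
  simp only [mul_neg, integral_neg]
  rw [hp, hmain, hφ0]
  unfold cavg
  have : (2 * π) ≠ 0 := by positivity
  field_simp
  ring

lemma lap_congr_of_eventuallyEq {u w : E2 → ℝ} {x : E2} (h : u =ᶠ[𝓝 x] w) : lap u x = lap w x := by
  unfold lap
  refine Finset.sum_congr rfl fun i _ => ?_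
  have h1 : (fun y => fderiv ℝ u y (EuclideanSpace.single i 1)) =ᶠ[𝓝 x]
      fun y => fderiv ℝ w y (EuclideanSpace.single i 1) := by
    filter_upwards [h.fderiv (𝕜 := ℝ)] with y hy
    rw [hy]
  rw [h1.fderiv_eq]

lemma exists_global_ext (W : E2 → ℝ) (O : Set E2) (hO : IsOpen O) (hW : ContDiffOn ℝ 2 W O)
    (a : E2) (R : ℝ) (hR : 0 < R) (hsub : closedBall a R ⊆ O) :
    ∃ V : E2 → ℝ, ContDiff ℝ 2 V ∧ ∀ x ∈ closedBall a R, V =ᶠ[𝓝 x] W := by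
  obtain ⟨δ, hδ, hd⟩ := (isCompact_closedBall a R).exists_cthickening_subset_open hO hsub
  rw [cthickening_closedBall hδ.le hR.le] at hd
  let χ : ContDiffBump a := ⟨R + δ / 2, R + δ, by positivity, by linarith⟩
  refine ⟨fun x => χ x * W x, ?_, ?_⟩
  · rw [contDiff_iff_contDiffAt]
    intro x
    by_cases hx : x ∈ O
    · exact (χ.contDiff (n := 2)).contDiffAt.mul (hW.contDiffAt (hO.mem_nhds hx))
    · have h1 : x ∉ tsupport χ := by
        rw [χ.tsupport_eq]
        intro h
        apply hx
        apply hd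
        rw [add_comm]; exact h
      have h2 : (fun x => χ x * W x) =ᶠ[𝓝 x] fun _ => 0 := by
        have := notMem_tsupport_iff_eventuallyEq.1 h1
        filter_upwards [this] with y hy
        rw [hy]; simp
      exact contDiffAt_const.congr_of_eventuallyEq h2
  · intro x hx
    have : ball a (R + δ / 2) ∈ 𝓝 x := isOpen_ball.mem_nhds (by
      rw [mem_ball]; rw [mem_closedBall] at hx; linarith)
    filter_upwards [this] with y hy
    have : χ y = 1 := χ.one_of_mem_closedBall (ball_subset_closedBall hy)
    rw [this, one_mul]

lemma rep_local (W : E2 → ℝ) (O : Set E2) (hO : IsOpen O) (hW : ContDiffOn ℝ 2 W O)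
    (a : E2) (R : ℝ) (hR : 0 < R) (hsub : closedBall a R ⊆ O) :
    W a = cavg W a R + (2 * π)⁻¹ * ∫ y in ball a R, Real.log (R / ‖y - a‖) * (-lap W y) := by
  obtain ⟨V, hV, hVW⟩ := exists_global_ext W O hO hW a R hR hsub
  have h := rep_global V hV a R hR
  have h1 : V a = W a := (hVW a (mem_closedBall_self hR.le)).eq_of_nhds
  have h2 : cavg V a R = cavg W a R := by
    unfold cavg
    congr 1
    refine intervalIntegral.integral_congr fun θ _ => ?_
    refine (hVW _ ?_).eq_of_nhds
    simp [norm_smul, norm_circDir, abs_of_pos hR]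
  have h3 : ∫ y in ball a R, Real.log (R / ‖y - a‖) * (-lap V y)
      = ∫ y in ball a R, Real.log (R / ‖y - a‖) * (-lap W y) := by
    refine setIntegral_congr_fun measurableSet_ball fun y hy => ?_
    rw [lap_congr_of_eventuallyEq (hVW y (ball_subset_closedBall hy))]
  rw [h1, h2, h3] at h
  exact h

/-- truncated log kernel -/
def kern (z : E2) (r : ℝ) (y : E2) : ℝ := max (Real.log (r / ‖y - z‖)) 0

lemma kern_nonneg (z : E2) (r : ℝ) (y : E2) : 0 ≤ kern z r y := le_max_right _ _

lemma kern_of_mem (z : E2) (r : ℝ) (y : E2) (h : y ∈ ball z r) : kern z r y = Real.log (r / ‖y - z‖) := by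
  rw [mem_ball, dist_eq_norm] at h
  apply max_eq_left
  rcases (norm_nonneg (y - z)).eq_or_lt with h0 | h0
  · rw [← h0]; simp
  · apply Real.log_nonneg
    rw [le_div_iff₀ h0]; linarith

lemma kern_of_notMem (z : E2) (r : ℝ) (hr : 0 < r) (y : E2) (h : y ∉ ball z r) : kern z r y = 0 := by
  rw [mem_ball, dist_eq_norm, not_lt] at h
  apply max_eq_right
  apply Real.log_nonpos
  · positivity
  · rw [div_le_one (by linarith)]; exact h

lemma kern_eq_indicator (z : E2) (r : ℝ) (hr : 0 < r) :
    kern z r = (ball z r).indicator (fun y => Real.log (r / ‖y - z‖)) := by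
  funext y
  by_cases h : y ∈ ball z r
  · rw [Set.indicator_of_mem h, kern_of_mem z r y h]
  · rw [Set.indicator_of_notMem h, kern_of_notMem z r hr y h]

lemma kern_integrable (z : E2) (r : ℝ) (hr : 0 < r) : Integrable (kern z r) := by
  rw [kern_eq_indicator z r hr]
  exact (integrableOn_log_ball z r hr).integrable_indicator measurableSet_ball

lemma kern_integral (z : E2) (r : ℝ) (hr : 0 < r) : ∫ y, kern z r y = π * r ^ 2 / 2 := by
  rw [kern_eq_indicator z r hr, integral_indicator measurableSet_ball]
  exact integral_log_ball z r hr

lemma kern_measurable (z : E2) (r : ℝ) : Measurable (kern z r) := by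
  unfold kern
  fun_prop

lemma setIntegral_kern_mul (z : E2) (r : ℝ) (hr : 0 < r) (G : Set E2) (hG : MeasurableSet G)
    (hsub : ball z r ⊆ G) (f : E2 → ℝ) :
    ∫ y in ball z r, Real.log (r / ‖y - z‖) * f y = ∫ y in G, kern z r y * f y := by
  rw [← integral_indicator measurableSet_ball, ← integral_indicator hG]
  congr 1
  funext y
  by_cases h : y ∈ ball z r
  · rw [Set.indicator_of_mem h, Set.indicator_of_mem (hsub h), kern_of_mem z r y h]
  · rw [Set.indicator_of_notMem h]
    by_cases h2 : y ∈ G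
    · rw [Set.indicator_of_mem h2, kern_of_notMem z r hr y h, zero_mul]
    · rw [Set.indicator_of_notMem h2]

lemma ae_ne_restrict (z : E2) (G : Set E2) : ∀ᵐ y ∂(volume.restrict G), y ≠ z :=
  ae_restrict_of_ae (by
    rw [ae_iff]; simp)

lemma lap_comp (H : ℝ → ℝ) (hH : ContDiff ℝ 2 H) (u : E2 → ℝ) (x : E2) (hu : ContDiffAt ℝ 2 u x) :
    lap (fun y => H (u y)) x = deriv H (u x) * lap u x + deriv (deriv H) (u x) *
      ∑ i : Fin 2, (fderiv ℝ u x (EuclideanSpace.single i 1)) ^ 2 := by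
  unfold lap
  rw [Finset.mul_sum, Finset.mul_sum, ← Finset.sum_add_distrib]
  refine Finset.sum_congr rfl fun i _ => ?_
  have hHd : Differentiable ℝ H := hH.differentiable (by norm_num)
  have hH1 : ContDiff ℝ 1 (deriv H) := by
    have : ContDiff ℝ (1 + 1) H := by simpa [one_add_one_eq_two] using hH
    exact (contDiff_succ_iff_deriv.1 this).2.2
  have hH1d : Differentiable ℝ (deriv H) := hH1.differentiable (by norm_num)
  have h1 : (fun y => fderiv ℝ (fun y => H (u y)) y (EuclideanSpace.single i 1)) =ᶠ[𝓝 x]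
      fun y => deriv H (u y) * fderiv ℝ u y (EuclideanSpace.single i 1) := by
    filter_upwards [hu.eventually (by norm_num)] with y hy
    have hd : DifferentiableAt ℝ u y := hy.differentiableAt (by norm_num)
    have := ((hHd (u y)).hasDerivAt.comp_hasFDerivAt y hd.hasFDerivAt).fderiv
    have h2 : fderiv ℝ (fun y => H (u y)) y = deriv H (u y) • fderiv ℝ u y := this
    rw [h2]; rfl
  rw [h1.fderiv_eq]
  have hd : DifferentiableAt ℝ u x := hu.differentiableAt (by norm_num)
  have hdd : DifferentiableAt ℝ (fun y => fderiv ℝ u y (EuclideanSpace.single i 1)) x := by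
    have : DifferentiableAt ℝ (fderiv ℝ u) x :=
      (hu.fderiv_right (m := 1) (by norm_num)).differentiableAt (by norm_num)
    exact this.clm_apply (by fun_prop)
  have hA : HasFDerivAt (fun y => deriv H (u y)) (deriv (deriv H) (u x) • fderiv ℝ u x) x :=
    (hH1d (u x)).hasDerivAt.comp_hasFDerivAt x hd.hasFDerivAt
  have hM : HasFDerivAt (fun y => deriv H (u y) * fderiv ℝ u y (EuclideanSpace.single i 1)) _ x :=
    hA.mul hdd.hasFDerivAt
  rw [hM.fderiv]
  simp only [add_apply, smul_apply, smul_eq_mul]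
  ring

/-- smooth convex approximation of the positive part -/
def Hs (s : ℝ) : ℝ := ∫ t in (0:ℝ)..s, Real.smoothTransition t

lemma Hs_hasDerivAt (s : ℝ) : HasDerivAt Hs (Real.smoothTransition s) s :=
  intervalIntegral.integral_hasDerivAt_right
    (Real.smoothTransition.continuous.intervalIntegrable _ _)
    (Real.smoothTransition.continuous.stronglyMeasurableAtFilter _ _)
    Real.smoothTransition.continuous.continuousAt

lemma Hs_deriv : deriv Hs = Real.smoothTransition := funext fun s => (Hs_hasDerivAt s).deriv

lemma Hs_contDiff : ContDiff ℝ 2 Hs := by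
  have : ContDiff ℝ (1 + 1) Hs := by
    rw [contDiff_succ_iff_deriv]
    refine ⟨fun s => (Hs_hasDerivAt s).differentiableAt, by simp, ?_⟩
    rw [Hs_deriv]
    exact Real.smoothTransition.contDiff
  simpa [one_add_one_eq_two] using this

lemma Hs_zero (s : ℝ) (hs : s ≤ 0) : Hs s = 0 := by
  unfold Hs
  rw [intervalIntegral.integral_congr (g := fun _ => (0:ℝ))]
  · simp
  · intro t ht
    rw [Set.uIcc_of_ge hs] at ht
    exact Real.smoothTransition.zero_of_nonpos ht.2

lemma Hs_nonneg (s : ℝ) : 0 ≤ Hs s := by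
  rcases le_total s 0 with h | h
  · rw [Hs_zero s h]
  · exact intervalIntegral.integral_nonneg h fun t _ => Real.smoothTransition.nonneg t

lemma Hs_ge (s : ℝ) : s - 1 ≤ Hs s := by
  rcases le_total s 1 with h | h
  · linarith [Hs_nonneg s]
  · have h1 : Hs s = Hs 1 + ∫ t in (1:ℝ)..s, Real.smoothTransition t := by
      unfold Hs
      rw [intervalIntegral.integral_add_adjacent_intervals] <;>
      exact (Real.smoothTransition.continuous.intervalIntegrable _ _)
    have h2 : ∫ t in (1:ℝ)..s, Real.smoothTransition t = s - 1 := by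
      rw [intervalIntegral.integral_congr (g := fun _ => (1:ℝ))]
      · simp
      · intro t ht
        rw [Set.uIcc_of_le h] at ht
        exact Real.smoothTransition.one_of_one_le ht.1
    linarith [Hs_nonneg 1]

lemma smoothTransition_mono : Monotone Real.smoothTransition := by
  exact Real.smoothTransition.monotone

lemma kern_mul_integrableOn (z : E2) (r : ℝ) (hr : 0 < r) (G : Set E2) (hG : MeasurableSet G) (f : E2 → ℝ)
    (hf : AEStronglyMeasurable f (volume.restrict G)) (B : ℝ) (hB : ∀ y ∈ G, |f y| ≤ B) :
    IntegrableOn (fun y => kern z r y * f y) G :=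
  (kern_integrable z r hr).integrableOn.mul_bdd hf
    ((ae_restrict_iff' hG).2 (Eventually.of_forall fun y hy => hB y hy))

lemma kern_sub_bounds (z : E2) (r D : ℝ) (hr : 0 < r) (hrD : r ≤ D) (y : E2) (hy : y ≠ z) :
    0 ≤ kern z D y - kern z r y ∧ kern z D y - kern z r y ≤ Real.log (D / r) := by
  have h0 : 0 < ‖y - z‖ := norm_pos_iff.2 (sub_ne_zero.2 hy)
  have hc : 0 ≤ Real.log (D / r) := Real.log_nonneg (by rw [le_div_iff₀ hr]; linarith)
  have h1 : Real.log (D / ‖y - z‖) = Real.log (r / ‖y - z‖) + Real.log (D / r) := by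
    rw [← Real.log_mul (by positivity) (by have : 0 < D := by linarith
                                           positivity)]
    congr 1; field_simp
  unfold kern
  rw [h1]
  constructor
  · have : max (Real.log (r / ‖y - z‖)) 0 ≤ max (Real.log (r / ‖y - z‖) + Real.log (D / r)) 0 :=
      max_le_max (by linarith) le_rfl
    linarith
  · have : max (Real.log (r / ‖y - z‖) + Real.log (D / r)) 0 ≤ max (Real.log (r / ‖y - z‖)) 0 + Real.log (D / r) := by
      apply max_le
      · linarith [le_max_left (Real.log (r / ‖y - z‖)) 0]
      · linarith [le_max_right (Real.log (r / ‖y - z‖)) 0]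
    linarith

lemma cavg_mono (f g : E2 → ℝ) (z : E2) (r : ℝ) (hr : 0 ≤ r) (hf : ContinuousOn f (closedBall z r))
    (hg : ContinuousOn g (closedBall z r)) (h : ∀ y ∈ closedBall z r, f y ≤ g y) :
    cavg f z r ≤ cavg g z r := by
  have hm : ∀ θ, z + r • circDir θ ∈ closedBall z r := fun θ => by
    simp [norm_smul, norm_circDir, abs_of_nonneg hr]
  have hc : Continuous fun θ => z + r • circDir θ := by
    have := continuous_circDir
    fun_prop
  unfold cavg
  refine mul_le_mul_of_nonneg_left ?_ (by positivity)
  refine intervalIntegral.integral_mono_on (by linarith [pi_pos]) ?_ ?_ fun θ _ => h _ (hm θ)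
  · exact (hf.comp_continuous hc hm).intervalIntegrable _ _
  · exact (hg.comp_continuous hc hm).intervalIntegrable _ _

lemma cavg_affine (f : E2 → ℝ) (z : E2) (r k c : ℝ) (hr : 0 ≤ r) (hf : ContinuousOn f (closedBall z r)) :
    cavg (fun y => k * f y + c) z r = k * cavg f z r + c := by
  have hm : ∀ θ, z + r • circDir θ ∈ closedBall z r := fun θ => by
    simp [norm_smul, norm_circDir, abs_of_nonneg hr]
  have hc : Continuous fun θ => z + r • circDir θ := by
    have := continuous_circDir
    fun_prop
  unfold cavg
  rw [intervalIntegral.integral_add, intervalIntegral.integral_const_mul]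
  · simp
    field_simp
    ring
  · exact (((hf.comp_continuous hc hm).intervalIntegrable _ _).const_mul k)
  · simp

lemma sol_bdd (Ω : Set E2) (hΩb : IsBounded Ω) (p : ℝ) (u : E2 → ℝ) (hs : IsSolution Ω p u) :
    ∃ B, ∀ x ∈ closure Ω, |u x| ≤ B :=
  (hΩb.isCompact_closure).exists_bound_of_continuousOn hs.2.1

lemma posPart_pow_integrableOn (Ω : Set E2) (hΩo : IsOpen Ω) (hΩb : IsBounded Ω) (p : ℝ) (hp : 0 < p)
    (u : E2 → ℝ) (hs : IsSolution Ω p u) : IntegrableOn (fun y => (max (u y) 0) ^ p) Ω := by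
  have hc : ContinuousOn (fun y => (max (u y) 0) ^ p) (closure Ω) :=
    (ContinuousOn.sup hs.2.1 continuousOn_const).rpow_const fun x _ => Or.inr hp.le
  exact (hc.integrableOn_compact hΩb.isCompact_closure).mono_set subset_closure

/-- truncated solution -/
def wtr (Ω : Set E2) (u : E2 → ℝ) (k : ℝ) (x : E2) : ℝ := by
  classical exact if x ∈ Ω then Hs (k⁻¹ * u x - 1) else 0

lemma wtr_eq_near (Ω : Set E2) (hΩo : IsOpen Ω) (u : E2 → ℝ) (k : ℝ) (x : E2) (hx : x ∈ Ω) :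
    wtr Ω u k =ᶠ[𝓝 x] fun y => Hs (k⁻¹ * u y - 1) := by
  filter_upwards [hΩo.mem_nhds hx] with y hy
  simp [wtr, hy]

lemma wtr_zero_near (Ω : Set E2) (hΩo : IsOpen Ω) (p : ℝ) (u : E2 → ℝ) (hs : IsSolution Ω p u)
    (k : ℝ) (hk : 0 < k) (x : E2) (hx : x ∉ Ω) :
    wtr Ω u k =ᶠ[𝓝 x] fun _ => 0 := by
  have h : ∀ᶠ y in 𝓝 x, y ∈ closure Ω → u y < k := by
    by_cases hxc : x ∈ closure Ω
    · have h0 : u x = 0 := hs.2.2.2 x ⟨hxc, by rwa [hΩo.interior_eq]⟩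
      have := (hs.2.1 x hxc).eventually_lt_const (u := k) (by rw [h0]; exact hk)
      exact eventually_nhdsWithin_iff.1 this
    · filter_upwards [isClosed_closure.isOpen_compl.mem_nhds hxc] with y hy hy2
      exact absurd hy2 hy
  filter_upwards [h] with y hy
  by_cases hy2 : y ∈ Ω
  · simp only [wtr, hy2, if_true]
    apply Hs_zero
    have := hy (subset_closure hy2)
    have : k⁻¹ * u y ≤ k⁻¹ * k := mul_le_mul_of_nonneg_left this.le (by positivity)
    rw [inv_mul_cancel₀ hk.ne'] at this
    linarith
  · simp [wtr, hy2]

lemma Hk_contDiff (k : ℝ) : ContDiff ℝ 2 fun s => Hs (k⁻¹ * s - 1) :=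
  Hs_contDiff.comp (by fun_prop)

lemma Hk_deriv (k : ℝ) : deriv (fun s => Hs (k⁻¹ * s - 1)) = fun s => Real.smoothTransition (k⁻¹ * s - 1) * k⁻¹ := by
  funext s
  have h1 : HasDerivAt (fun s : ℝ => k⁻¹ * s - 1) k⁻¹ s := by
    simpa using ((hasDerivAt_id s).const_mul k⁻¹).sub_const 1
  exact ((Hs_hasDerivAt _).comp s h1).deriv

lemma wtr_contDiff (Ω : Set E2) (hΩo : IsOpen Ω) (p : ℝ) (u : E2 → ℝ) (hs : IsSolution Ω p u)
    (k : ℝ) (hk : 0 < k) : ContDiff ℝ 2 (wtr Ω u k) := by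
  rw [contDiff_iff_contDiffAt]
  intro x
  by_cases hx : x ∈ Ω
  · refine ContDiffAt.congr_of_eventuallyEq ?_ (wtr_eq_near Ω hΩo u k x hx)
    exact (Hk_contDiff k).contDiffAt.comp x (hs.1.contDiffAt (hΩo.mem_nhds hx))
  · exact contDiffAt_const.congr_of_eventuallyEq (wtr_zero_near Ω hΩo p u hs k hk x hx)

lemma lap_zero_fun (x : E2) : lap (fun _ => (0:ℝ)) x = 0 := by
  simp [lap]

lemma wtr_lap (Ω : Set E2) (hΩo : IsOpen Ω) (p : ℝ) (hp : 0 < p) (u : E2 → ℝ) (hs : IsSolution Ω p u)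
    (k : ℝ) (hk : 0 < k) (x : E2) :
    -lap (wtr Ω u k) x ≤ Ω.indicator (fun y => k⁻¹ * (max (u y) 0) ^ p) x := by
  have hk' : 0 < k⁻¹ := by positivity
  by_cases hx : x ∈ Ω
  · rw [Set.indicator_of_mem hx, lap_congr_of_eventuallyEq (wtr_eq_near Ω hΩo u k x hx),
      lap_comp _ (Hk_contDiff k) u x (hs.1.contDiffAt (hΩo.mem_nhds hx))]
    have h2 : 0 ≤ deriv (deriv fun s => Hs (k⁻¹ * s - 1)) (u x) := by
      rw [Hk_deriv]
      apply Monotone.deriv_nonneg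
      intro a b hab
      refine mul_le_mul_of_nonneg_right (smoothTransition_mono ?_) hk'.le
      have := mul_le_mul_of_nonneg_left hab hk'.le
      linarith
    have h3 : 0 ≤ ∑ i : Fin 2, (fderiv ℝ u x (EuclideanSpace.single i 1)) ^ 2 :=
      Finset.sum_nonneg fun i _ => sq_nonneg _
    have h4 := mul_nonneg h2 h3
    have h5 : deriv (fun s => Hs (k⁻¹ * s - 1)) (u x) * (-lap u x) ≤ k⁻¹ * (max (u x) 0) ^ p := by
      rw [hs.2.2.1 x hx, Hk_deriv]
      rcases le_or_gt (u x) 0 with h | h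
      · simp only []
        rw [Real.smoothTransition.zero_of_nonpos]
        · rw [zero_mul, zero_mul]; positivity
        · have := mul_nonpos_of_nonneg_of_nonpos hk'.le h
          linarith
      · have h6 : |u x| ^ (p - 1) * u x = u x ^ p := by
          rw [abs_of_pos h, Real.rpow_sub_one h.ne']; field_simp
        rw [h6, max_eq_left h.le]
        have h7 := Real.smoothTransition.le_one (k⁻¹ * u x - 1)
        have h8 : 0 ≤ u x ^ p := by positivity
        refine mul_le_mul_of_nonneg_right ?_ h8
        nlinarith
    nlinarith
  · rw [Set.indicator_of_notMem hx, lap_congr_of_eventuallyEq (wtr_zero_near Ω hΩo p u hs k hk x hx),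
      lap_zero_fun]
    simp

lemma cavg_wtr_le (Ω : Set E2) (hΩo : IsOpen Ω) (hΩb : IsBounded Ω) (p : ℝ) (hp : 0 < p)
    (u : E2 → ℝ) (hs : IsSolution Ω p u) (z : E2) (r D : ℝ) (hr : 0 < r) (hrD : r ≤ D)
    (hD : Ω ⊆ ball z D) (k : ℝ) (hk : 0 < k) :
    cavg (wtr Ω u k) z r ≤ (2 * π)⁻¹ * (Real.log (D / r) * (k⁻¹ * ∫ y in Ω, (max (u y) 0) ^ p)) := by
  have hD0 : 0 < D := by linarith
  have hw := wtr_contDiff Ω hΩo p u hs k hk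
  have h1 := rep_global _ hw z D hD0
  have h2 := rep_global _ hw z r hr
  have h3 : cavg (wtr Ω u k) z D = 0 := by
    unfold cavg
    rw [intervalIntegral.integral_congr (g := fun _ => (0:ℝ))]
    · simp
    · intro θ _
      have : z + D • circDir θ ∉ Ω := fun h => by
        have := hD h
        simp [norm_smul, norm_circDir, abs_of_pos hD0] at this
      simp [wtr, this]
  have hc := lap_continuous _ hw
  obtain ⟨B, hB⟩ := (isCompact_closedBall z D).exists_bound_of_continuousOn hc.continuousOn
  have hi : ∀ t, 0 < t → IntegrableOn (fun y => kern z t y * (-lap (wtr Ω u k) y)) (ball z D) := fun t ht =>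
    kern_mul_integrableOn z t ht _ measurableSet_ball _ hc.neg.aestronglyMeasurable B
      (fun y hy => by rw [abs_neg]; exact hB y (ball_subset_closedBall hy))
  rw [setIntegral_kern_mul z D hD0 (ball z D) measurableSet_ball subset_rfl] at h1
  rw [setIntegral_kern_mul z r hr (ball z D) measurableSet_ball (ball_subset_ball hrD)] at h2
  have h4 : cavg (wtr Ω u k) z r = (2 * π)⁻¹ * ∫ y in ball z D, (kern z D y * (-lap (wtr Ω u k) y) - kern z r y * (-lap (wtr Ω u k) y)) := by
    rw [integral_sub (hi D hD0) (hi r hr), mul_sub]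
    linarith
  rw [h4]
  refine mul_le_mul_of_nonneg_left ?_ (by positivity)
  have hIntg := posPart_pow_integrableOn Ω hΩo hΩb p hp u hs
  have h5 : Real.log (D / r) * (k⁻¹ * ∫ y in Ω, (max (u y) 0) ^ p) =
      ∫ y in ball z D, Real.log (D / r) * Ω.indicator (fun y => k⁻¹ * (max (u y) 0) ^ p) y := by
    rw [integral_const_mul, setIntegral_indicator hΩo.measurableSet, Set.inter_eq_self_of_subset_right hD,
      integral_const_mul]
  rw [h5]
  refine integral_mono_ae ((hi D hD0).sub (hi r hr)) ?_ ?_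
  · refine Integrable.const_mul ?_ _
    exact (IntegrableOn.integrable_indicator (hIntg.const_mul k⁻¹) hΩo.measurableSet).integrableOn
  · filter_upwards [ae_ne_restrict z (ball z D)] with y hy
    obtain ⟨ha, hb⟩ := kern_sub_bounds z r D hr hrD y hy
    have hl := wtr_lap Ω hΩo p hp u hs k hk y
    have hn : 0 ≤ Ω.indicator (fun y => k⁻¹ * (max (u y) 0) ^ p) y :=
      Set.indicator_nonneg (fun y _ => by positivity) y
    calc kern z D y * (-lap (wtr Ω u k) y) - kern z r y * (-lap (wtr Ω u k) y)
        = (kern z D y - kern z r y) * (-lap (wtr Ω u k) y) := by ring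
      _ ≤ (kern z D y - kern z r y) * Ω.indicator (fun y => k⁻¹ * (max (u y) 0) ^ p) y :=
        mul_le_mul_of_nonneg_left hl ha
      _ ≤ _ := mul_le_mul_of_nonneg_right hb hn

lemma cavg_sol_le (Ω : Set E2) (hΩo : IsOpen Ω) (hΩb : IsBounded Ω) (p : ℝ) (hp : 0 < p)
    (u : E2 → ℝ) (hs : IsSolution Ω p u) (z : E2) (r D : ℝ) (hr : 0 < r) (hrD : r ≤ D)
    (hD : Ω ⊆ ball z D) (hsub : closedBall z r ⊆ Ω) :
    cavg u z r ≤ (2 * π)⁻¹ * (Real.log (D / r) * ∫ y in Ω, (max (u y) 0) ^ p) := by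
  refine le_of_forall_pos_le_add fun e he => ?_
  set k := e / 2 with hkdef
  have hk : 0 < k := by positivity
  have h1 := cavg_wtr_le Ω hΩo hΩb p hp u hs z r D hr hrD hD k hk
  have hwc := (wtr_contDiff Ω hΩo p u hs k hk).continuous
  have h2 : cavg u z r ≤ cavg (fun y => k * wtr Ω u k y + 2 * k) z r := by
    refine cavg_mono _ _ z r hr.le (hs.1.continuousOn.mono hsub) (by fun_prop) fun y hy => ?_
    simp only [wtr, hsub hy, if_true]
    have := mul_le_mul_of_nonneg_left (Hs_ge (k⁻¹ * u y - 1)) hk.le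
    have h3 : k * (k⁻¹ * u y - 1 - 1) = u y - 2 * k := by field_simp; ring
    linarith
  rw [cavg_affine _ z r _ _ hr.le hwc.continuousOn] at h2
  have h4 := mul_le_mul_of_nonneg_left h1 hk.le
  have h5 : k * ((2 * π)⁻¹ * (Real.log (D / r) * (k⁻¹ * ∫ y in Ω, (max (u y) 0) ^ p))) =
    (2 * π)⁻¹ * (Real.log (D / r) * ∫ y in Ω, (max (u y) 0) ^ p) := by
    field_simp
  linarith

/-- the local situation near a concentration point -/
structure Bub (u : E2 → ℝ) (p : ℝ) (a : E2) (ρ ε C0 : ℝ) : Prop where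
  hρ : 0 < ρ
  hε : 0 < ε
  hp : 2 ≤ p
  smooth : ContDiffOn ℝ 2 u (ball a (7 / 4 * ρ))
  pos : ∀ y ∈ ball a (7 / 4 * ρ), 0 < u y
  eqn : ∀ y ∈ ball a (7 / 4 * ρ), -lap u y = u y ^ p
  le : ∀ y ∈ ball a (7 / 4 * ρ), u y ≤ u a
  mass : p * ∫ y in ball a (7 / 4 * ρ), u y ^ p ≤ C0
  avg : ∀ z r, ρ / 8 ≤ r → closedBall z r ⊆ ball a (7 / 4 * ρ) → p * cavg u z r ≤ C0
  half : 1 / 2 ≤ u a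
  scale : ε ^ 2 * (p * u a ^ (p - 1)) = 1
  small : ε ^ 2 * p ≤ C0

namespace Bub

variable {u : E2 → ℝ} {p : ℝ} {a : E2} {ρ ε C0 : ℝ}

lemma M_pos (h : Bub u p a ρ ε C0) : 0 < u a := by linarith [h.half]
lemma p_pos (h : Bub u p a ρ ε C0) : 0 < p := by linarith [h.hp]

lemma Mpow (h : Bub u p a ρ ε C0) : u a ^ p = u a / (p * ε ^ 2) := by
  have h1 := h.scale
  have hp := h.p_pos
  have hM := h.M_pos
  have hε := h.hε
  rw [Real.rpow_sub_one hM.ne'] at h1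
  field_simp at h1 ⊢
  linarith

lemma cont (h : Bub u p a ρ ε C0) : ContinuousOn u (ball a (7 / 4 * ρ)) := h.smooth.continuousOn

lemma meas_pow (h : Bub u p a ρ ε C0) (q : ℝ) (hq : 0 ≤ q) :
    AEStronglyMeasurable (fun y => u y ^ q) (volume.restrict (ball a (7 / 4 * ρ))) :=
  (h.cont.rpow_const fun _ _ => Or.inr hq).aestronglyMeasurable measurableSet_ball

lemma pow_bound (h : Bub u p a ρ ε C0) (q : ℝ) (hq : 0 ≤ q) (y : E2) (hy : y ∈ ball a (7 / 4 * ρ)) :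
    |u y ^ q| ≤ u a ^ q := by
  have := h.pos y hy
  rw [abs_of_nonneg (by positivity)]
  exact Real.rpow_le_rpow this.le (h.le y hy) hq

lemma int_pow (h : Bub u p a ρ ε C0) (q : ℝ) (hq : 0 ≤ q) :
    IntegrableOn (fun y => u y ^ q) (ball a (7 / 4 * ρ)) := by
  refine ⟨h.meas_pow q hq, ?_⟩
  refine HasFiniteIntegral.restrict_of_bounded (u a ^ q) measure_ball_lt_top ?_
  exact (ae_restrict_iff' measurableSet_ball).2 (Eventually.of_forall fun y hy => h.pow_bound q hq y hy)

lemma int_kern (h : Bub u p a ρ ε C0) (z : E2) (r : ℝ) (hr : 0 < r) :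
    IntegrableOn (fun y => kern z r y * u y ^ p) (ball a (7 / 4 * ρ)) :=
  kern_mul_integrableOn z r hr _ measurableSet_ball _ (h.meas_pow p h.p_pos.le) _
    (fun y hy => h.pow_bound p h.p_pos.le y hy)

lemma rep (h : Bub u p a ρ ε C0) (z : E2) (r : ℝ) (hr : 0 < r) (hs : closedBall z r ⊆ ball a (7 / 4 * ρ)) :
    u z = cavg u z r + (2 * π)⁻¹ * ∫ y in ball a (7 / 4 * ρ), kern z r y * u y ^ p := by
  rw [rep_local u _ isOpen_ball h.smooth z r hr hs]
  congr 2
  rw [setIntegral_kern_mul z r hr _ measurableSet_ball (ball_subset_closedBall.trans hs)]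
  refine setIntegral_congr_fun measurableSet_ball fun y hy => ?_
  simp only [h.eqn y hy]

lemma cavg_nonneg (h : Bub u p a ρ ε C0) (z : E2) (r : ℝ) (hr : 0 < r) (hs : closedBall z r ⊆ ball a (7 / 4 * ρ)) :
    0 ≤ cavg u z r := by
  unfold cavg
  refine mul_nonneg (by positivity) ?_
  refine intervalIntegral.integral_nonneg (by linarith [pi_pos]) fun θ _ => ?_
  refine (h.pos _ (hs ?_)).le
  simp [norm_smul, norm_circDir, abs_of_pos hr]

lemma rep_lower (h : Bub u p a ρ ε C0) (z : E2) (r : ℝ) (hr : 0 < r) (hs : closedBall z r ⊆ ball a (7 / 4 * ρ)) :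
    (2 * π)⁻¹ * ∫ y in ball a (7 / 4 * ρ), kern z r y * u y ^ p ≤ u z := by
  rw [h.rep z r hr hs]
  linarith [h.cavg_nonneg z r hr hs]

lemma rep_upper (h : Bub u p a ρ ε C0) (z : E2) (r : ℝ) (hr : ρ / 8 ≤ r) (hs : closedBall z r ⊆ ball a (7 / 4 * ρ)) :
    u z ≤ C0 / p + (2 * π)⁻¹ * ∫ y in ball a (7 / 4 * ρ), kern z r y * u y ^ p := by
  rw [h.rep z r (by linarith [h.hρ]) hs]
  have := h.avg z r hr hs
  have h2 : cavg u z r ≤ C0 / p := by rw [le_div_iff₀ h.p_pos]; linarith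
  linarith

lemma mass_le (h : Bub u p a ρ ε C0) : ∫ y in ball a (7 / 4 * ρ), u y ^ p ≤ C0 / p := by
  rw [le_div_iff₀ h.p_pos]; linarith [h.mass]

lemma mass_nonneg (h : Bub u p a ρ ε C0) (S : Set E2) (hS : MeasurableSet S) (hs : S ⊆ ball a (7 / 4 * ρ)) (q : ℝ) :
    0 ≤ ∫ y in S, u y ^ q :=
  setIntegral_nonneg hS fun y hy => by have := h.pos y (hs hy); positivity

lemma C0_nonneg (h : Bub u p a ρ ε C0) : 0 ≤ C0 :=
  le_trans (mul_nonneg h.p_pos.le (h.mass_nonneg _ measurableSet_ball subset_rfl p)) h.mass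

lemma int_kern_eps_le (h : Bub u p a ρ ε C0) :
    ∫ y in ball a (7 / 4 * ρ), kern a ε y * u y ^ p ≤ π * u a / (2 * p) := by
  have hp := h.p_pos
  calc ∫ y in ball a (7 / 4 * ρ), kern a ε y * u y ^ p
      ≤ ∫ y in ball a (7 / 4 * ρ), kern a ε y * u a ^ p := by
        refine setIntegral_mono_on (h.int_kern a ε h.hε)
          ((kern_integrable a ε h.hε).integrableOn.mul_const _) measurableSet_ball fun y hy => ?_
        refine mul_le_mul_of_nonneg_left ?_ (kern_nonneg _ _ _)
        exact Real.rpow_le_rpow (h.pos y hy).le (h.le y hy) hp.le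
    _ ≤ ∫ y, kern a ε y * u a ^ p := by
        refine setIntegral_le_integral ((kern_integrable a ε h.hε).mul_const _)
          (Eventually.of_forall fun y => mul_nonneg (kern_nonneg _ _ _) ?_)
        have := h.M_pos; positivity
    _ = π * u a / (2 * p) := by
        rw [integral_mul_const, kern_integral a ε h.hε, h.Mpow]
        have := h.hε
        field_simp

end Bub

/-- truncated barrier -/
def bt (a : E2) (s ε : ℝ) (y : E2) : ℝ := kern a s y - kern a ε y

lemma kern_self (a : E2) (s : ℝ) : kern a s a = 0 := by simp [kern]

lemma bt_bounds (a : E2) (s ε : ℝ) (hε : 0 < ε) (hs : ε ≤ s) (y : E2) :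
    0 ≤ bt a s ε y ∧ bt a s ε y ≤ Real.log (s / ε) := by
  by_cases h : y = a
  · subst h
    simp only [bt, kern_self, sub_zero, le_refl, true_and]
    exact Real.log_nonneg (by rw [le_div_iff₀ hε]; linarith)
  · exact kern_sub_bounds a ε s hε hs y h

lemma bt_le_kern (a : E2) (s ε : ℝ) (y : E2) : bt a s ε y ≤ kern a s y := by
  unfold bt; linarith [kern_nonneg a ε y]

lemma bt_zero (a : E2) (s ε : ℝ) (hε : 0 < ε) (hs : ε ≤ s) (y : E2) (hy : y ∉ ball a s) : bt a s ε y = 0 := by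
  unfold bt
  rw [kern_of_notMem a s (by linarith) y hy, kern_of_notMem a ε hε y (fun h => hy (ball_subset_ball hs h)), sub_zero]

lemma kern_barrier (a x y : E2) (s ε : ℝ) (hε : 0 < ε) (hs : ε ≤ s) (hx : x ∈ ball a s) (hya : y ≠ a) (hyx : y ≠ x) :
    min (bt a s ε x) (bt a s ε y) - Real.log 16 ≤ kern x (s / 8) y := by
  have hs0 : 0 < s := by linarith
  have hl16 : 0 < Real.log 16 := Real.log_pos (by norm_num)
  have hk := kern_nonneg x (s / 8) y
  by_cases hy : y ∈ ball a s
  swap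
  · rw [bt_zero a s ε hε hs y hy]
    have := min_le_right (bt a s ε x) 0
    linarith
  by_cases hxa : x = a
  · subst hxa
    have : bt x s ε x = 0 := by simp [bt, kern_self]
    rw [this]
    have := min_le_left 0 (bt x s ε y)
    linarith
  have h1 := bt_le_kern a s ε x
  have h2 := bt_le_kern a s ε y
  rw [kern_of_mem a s x hx] at h1
  rw [kern_of_mem a s y hy] at h2
  have hx0 : 0 < ‖x - a‖ := norm_pos_iff.2 (sub_ne_zero.2 hxa)
  have hy0 : 0 < ‖y - a‖ := norm_pos_iff.2 (sub_ne_zero.2 hya)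
  have hyx0 : 0 < ‖y - x‖ := norm_pos_iff.2 (sub_ne_zero.2 hyx)
  have htri : ‖y - x‖ ≤ ‖y - a‖ + ‖x - a‖ := by
    have : y - x = (y - a) - (x - a) := by abel
    rw [this]; exact norm_sub_le _ _
  have hk2 : Real.log (s / 8 / ‖y - x‖) ≤ kern x (s / 8) y := le_max_left _ _
  refine le_trans ?_ hk2
  have key : ∀ t, 0 < t → ‖y - x‖ ≤ 2 * t → Real.log (s / t) - Real.log 16 ≤ Real.log (s / 8 / ‖y - x‖) := by
    intro t ht htt
    rw [← Real.log_div (by positivity) (by norm_num)]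
    apply Real.log_le_log (by positivity)
    rw [div_div, div_div]
    apply div_le_div_of_nonneg_left hs0.le (by positivity)
    linarith
  rcases le_total ‖x - a‖ ‖y - a‖ with hle | hle
  · have := key _ hy0 (by linarith)
    linarith [min_le_right (bt a s ε x) (bt a s ε y)]
  · have := key _ hx0 (by linarith)
    linarith [min_le_left (bt a s ε x) (bt a s ε y)]

lemma min_ge_mul_div (x y L : ℝ) (hx : 0 ≤ x) (hxL : x ≤ L) (hy : 0 ≤ y) (hyL : y ≤ L) (hL : 0 < L) :
    x * y / L ≤ min x y := by
  rw [div_le_iff₀ hL]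
  rcases le_total x y with h | h
  · rw [min_eq_left h]; nlinarith
  · rw [min_eq_right h]; nlinarith

lemma closedBall_sub (a z : E2) (ρ r d : ℝ) (hd : ‖z - a‖ ≤ d) (h : d + r < 7 / 4 * ρ) :
    closedBall z r ⊆ ball a (7 / 4 * ρ) := by
  intro y hy
  rw [mem_closedBall, dist_eq_norm] at hy
  rw [mem_ball, dist_eq_norm]
  have : y - a = (y - z) + (z - a) := by abel
  rw [this]
  linarith [norm_add_le (y - z) (z - a)]

lemma log16_lt : Real.log 16 < 2 * π := by
  have : Real.log 16 = 4 * Real.log 2 := by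
    rw [show (16:ℝ) = 2 ^ 4 by norm_num, Real.log_pow]; norm_num
  linarith [Real.log_two_lt_d9, Real.pi_gt_three]

namespace Bub

variable {u : E2 → ℝ} {p : ℝ} {a : E2} {ρ ε C0 : ℝ}

lemma int_bt (h : Bub u p a ρ ε C0) (s : ℝ) (hs : 0 < s) :
    IntegrableOn (fun y => bt a s ε y * u y ^ p) (ball a (7 / 4 * ρ)) := by
  have := (h.int_kern a s hs).sub (h.int_kern a ε h.hε)
  refine this.congr (Eventually.of_forall fun y => ?_)
  simp only [Pi.sub_apply, bt]; ring

lemma bt_lower (h : Bub u p a ρ ε C0) (s : ℝ) (hs1 : ρ ≤ s) (hs2 : s ≤ 3 / 2 * ρ) :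
    u a - C0 / p - u a / (4 * p) ≤ (2 * π)⁻¹ * ∫ y in ball a (7 / 4 * ρ), bt a s ε y * u y ^ p := by
  have hρ := h.hρ
  have h1 := h.rep_upper a s (by linarith) (closedBall_sub a a ρ s 0 (by simp) (by linarith))
  have h2 := h.int_kern_eps_le
  have h3 : ∫ y in ball a (7 / 4 * ρ), bt a s ε y * u y ^ p =
    (∫ y in ball a (7 / 4 * ρ), kern a s y * u y ^ p) - ∫ y in ball a (7 / 4 * ρ), kern a ε y * u y ^ p := by
    rw [← integral_sub (h.int_kern a s (by linarith)) (h.int_kern a ε h.hε)]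
    congr 1; funext y; simp only [bt]; ring
  rw [h3, mul_sub]
  have h4 : (2 * π)⁻¹ * ∫ y in ball a (7 / 4 * ρ), kern a ε y * u y ^ p ≤ (2 * π)⁻¹ * (π * u a / (2 * p)) :=
    mul_le_mul_of_nonneg_left h2 (by positivity)
  have h5 : (2 * π)⁻¹ * (π * u a / (2 * p)) = u a / (4 * p) := by
    have := h.p_pos
    field_simp; ring
  linarith

lemma barrier (h : Bub u p a ρ ε C0) (s : ℝ) (hs1 : ρ ≤ s) (hs2 : s ≤ 3 / 2 * ρ) (hεs : ε < s)
    (x : E2) (hx : x ∈ ball a s) :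
    0 ≤ u x / u a - bt a s ε x / Real.log (s / ε) + (4 * C0 + 1) / p := by
  have hρ := h.hρ
  have hp := h.p_pos
  have hM := h.M_pos
  have hC := h.C0_nonneg
  have hL : 0 < Real.log (s / ε) := Real.log_pos (by rw [lt_div_iff₀ h.hε]; linarith)
  set L := Real.log (s / ε) with hLdef
  have hxd : ‖x - a‖ ≤ s := by rw [mem_ball, dist_eq_norm] at hx; exact hx.le
  have h1 := h.rep_lower x (s / 8) (by linarith) (closedBall_sub a x ρ (s / 8) s hxd (by linarith))
  obtain ⟨hb0, hb1⟩ := bt_bounds a s ε h.hε hεs.le x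
  have h2 : ∫ y in ball a (7 / 4 * ρ), (bt a s ε x / L * (bt a s ε y * u y ^ p) - Real.log 16 * u y ^ p) ≤
      ∫ y in ball a (7 / 4 * ρ), kern x (s / 8) y * u y ^ p := by
    refine integral_mono_ae (((h.int_bt s (by linarith)).const_mul _).sub ((h.int_pow p hp.le).const_mul _))
      (h.int_kern x (s / 8) (by linarith)) ?_
    filter_upwards [ae_ne_restrict a (ball a (7 / 4 * ρ)), ae_ne_restrict x (ball a (7 / 4 * ρ)),
      ae_restrict_mem measurableSet_ball] with y hya hyx hy
    have h3 := kern_barrier a x y s ε h.hε hεs.le hx hya hyx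
    obtain ⟨hc0, hc1⟩ := bt_bounds a s ε h.hε hεs.le y
    have h4 := min_ge_mul_div _ _ L hb0 hb1 hc0 hc1 hL
    have hu : 0 ≤ u y ^ p := by have := h.pos y hy; positivity
    have h5 : bt a s ε x / L * (bt a s ε y * u y ^ p) - Real.log 16 * u y ^ p =
      (bt a s ε x * bt a s ε y / L - Real.log 16) * u y ^ p := by ring
    rw [h5]
    exact mul_le_mul_of_nonneg_right (by linarith) hu
  rw [integral_sub ((h.int_bt s (by linarith)).const_mul _) ((h.int_pow p hp.le).const_mul _),
    integral_const_mul, integral_const_mul] at h2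
  have h3 := h.bt_lower s hs1 hs2
  have h4 := h.mass_le
  have h5 := h.mass_nonneg _ measurableSet_ball subset_rfl p
  set I := ∫ y in ball a (7 / 4 * ρ), bt a s ε y * u y ^ p
  set J := ∫ y in ball a (7 / 4 * ρ), u y ^ p
  set K := ∫ y in ball a (7 / 4 * ρ), kern x (s / 8) y * u y ^ p
  set β := bt a s ε x / L with hβ
  have hβ0 : 0 ≤ β := by positivity
  have hβ1 : β ≤ 1 := by rw [hβ, div_le_one hL]; exact hb1
  have hlog : Real.log 16 * J ≤ 2 * π * (C0 / p) := by
    have := log16_lt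
    have h16 : 0 < Real.log 16 := Real.log_pos (by norm_num)
    nlinarith
  have hpi := pi_pos
  have h6 : β * ((2 * π)⁻¹ * I) - C0 / p ≤ u x := by
    have : (2 * π)⁻¹ * (β * I - Real.log 16 * J) ≤ (2 * π)⁻¹ * K := mul_le_mul_of_nonneg_left h2 (by positivity)
    have h7 : (2 * π)⁻¹ * (β * I - Real.log 16 * J) = β * ((2 * π)⁻¹ * I) - (2 * π)⁻¹ * (Real.log 16 * J) := by ring
    have h8 : (2 * π)⁻¹ * (Real.log 16 * J) ≤ (2 * π)⁻¹ * (2 * π * (C0 / p)) := mul_le_mul_of_nonneg_left hlog (by positivity)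
    have h9 : (2 * π)⁻¹ * (2 * π * (C0 / p)) = C0 / p := by field_simp
    linarith
  have h7 : β * (u a - C0 / p - u a / (4 * p)) ≤ β * ((2 * π)⁻¹ * I) := mul_le_mul_of_nonneg_left h3 hβ0
  have hA : 0 ≤ C0 / p := by positivity
  have hB : 0 ≤ u a / (4 * p) := by positivity
  have h8 : β * u a - C0 / p - u a / (4 * p) - C0 / p ≤ u x := by nlinarith
  have h9 : u x / u a - β + (4 * C0 + 1) / p = (u x - β * u a + u a * ((4 * C0 + 1) / p)) / u a := by
    field_simp
  rw [h9]
  apply div_nonneg _ hM.le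
  have h10 : u a * ((4 * C0 + 1) / p) = 4 * u a * (C0 / p) + 4 * (u a / (4 * p)) := by
    field_simp
  rw [h10]
  have := h.half
  nlinarith

/-- the deficit -/
def Def (u : E2 → ℝ) (p : ℝ) (a : E2) (ε C0 s : ℝ) : ℝ :=
  p * ∫ x in ball a s, (u x / u a - bt a s ε x / Real.log (s / ε) + (4 * C0 + 1) / p) * u x ^ p

lemma ball_sub (h : Bub u p a ρ ε C0) (s : ℝ) (hs2 : s ≤ 3 / 2 * ρ) : ball a s ⊆ ball a (7 / 4 * ρ) :=
  ball_subset_ball (by linarith [h.hρ])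

lemma Def_int (h : Bub u p a ρ ε C0) (s : ℝ) (hs1 : ρ ≤ s) (hs2 : s ≤ 3 / 2 * ρ) : IntegrableOn
    (fun x => (u x / u a - bt a s ε x / Real.log (s / ε) + (4 * C0 + 1) / p) * u x ^ p) (ball a s) := by
  have hρ := h.hρ
  have hp := h.p_pos
  have h1 := ((h.int_pow (p + 1) (by linarith)).mono_set (h.ball_sub s hs2)).const_mul (u a)⁻¹
  have h2 := ((h.int_bt s (by linarith)).mono_set (h.ball_sub s hs2)).const_mul (Real.log (s / ε))⁻¹
  have h3 := ((h.int_pow p hp.le).mono_set (h.ball_sub s hs2)).const_mul ((4 * C0 + 1) / p)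
  refine ((h1.sub h2).add h3).congr ?_
  filter_upwards [ae_restrict_mem measurableSet_ball] with y hy
  have := h.pos y (h.ball_sub s hs2 hy)
  simp only [Pi.sub_apply, Pi.add_apply]
  rw [Real.rpow_add_one this.ne']
  ring

lemma energy_lower (h : Bub u p a ρ ε C0) (s : ℝ) (hs1 : ρ ≤ s) (hs2 : s ≤ 3 / 2 * ρ) (hεs : ε < s) :
    u a * Def u p a ε C0 s + 2 * π * p / Real.log (s / ε) * (u a) ^ 2 * (1 - (2 * C0 + 1) / p)
      - u a * ((4 * C0 + 1) * C0 / p) ≤ p * ∫ x in ball a s, u x ^ (p + 1) := by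
  have hρ := h.hρ
  have hp := h.p_pos
  have hM := h.M_pos
  have hC := h.C0_nonneg
  have hL : 0 < Real.log (s / ε) := Real.log_pos (by rw [lt_div_iff₀ h.hε]; linarith)
  set L := Real.log (s / ε) with hLdef
  have hi1 := ((h.int_pow (p + 1) (by linarith)).mono_set (h.ball_sub s hs2))
  have hi2 := ((h.int_bt s (by linarith)).mono_set (h.ball_sub s hs2))
  have hi3 := ((h.int_pow p hp.le).mono_set (h.ball_sub s hs2))
  have h1 : Def u p a ε C0 s = p * ((u a)⁻¹ * (∫ x in ball a s, u x ^ (p + 1)) -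
      L⁻¹ * (∫ x in ball a s, bt a s ε x * u x ^ p) + (4 * C0 + 1) / p * ∫ x in ball a s, u x ^ p) := by
    unfold Def
    congr 1
    rw [← integral_const_mul, ← integral_const_mul, ← integral_const_mul, ← integral_sub (hi1.const_mul _) (hi2.const_mul _),
      ← integral_add (f := fun x => (u a)⁻¹ * u x ^ (p + 1) - L⁻¹ * (bt a s ε x * u x ^ p))
        ((hi1.const_mul _).sub (hi2.const_mul _)) (hi3.const_mul _)]
    refine setIntegral_congr_fun measurableSet_ball fun y hy => ?_
    have := h.pos y (h.ball_sub s hs2 hy)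
    rw [Real.rpow_add_one this.ne']
    ring
  have h2 : ∫ x in ball a s, bt a s ε x * u x ^ p = ∫ x in ball a (7 / 4 * ρ), bt a s ε x * u x ^ p := by
    symm
    apply setIntegral_eq_of_subset_of_forall_sdiff_eq_zero measurableSet_ball (h.ball_sub s hs2)
    intro y hy
    rw [bt_zero a s ε h.hε hεs.le y hy.2, zero_mul]
  have h3 : ∫ x in ball a s, u x ^ p ≤ C0 / p := by
    refine le_trans (setIntegral_mono_set (h.int_pow p hp.le) ?_ (h.ball_sub s hs2).eventuallyLE) h.mass_le
    filter_upwards [ae_restrict_mem measurableSet_ball] with y hy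
    have := h.pos y hy
    simp only [Pi.zero_apply]; positivity
  have h4 := h.bt_lower s hs1 hs2
  rw [h2] at h1
  set I := ∫ x in ball a (7 / 4 * ρ), bt a s ε x * u x ^ p
  set E := ∫ x in ball a s, u x ^ (p + 1)
  set J := ∫ x in ball a s, u x ^ p
  have hpi := pi_pos
  have h5 : u a * Def u p a ε C0 s = p * E - u a * p / L * I + u a * (4 * C0 + 1) * J := by
    rw [h1]; field_simp
  rw [h5]
  have h6 : u a * (1 - (2 * C0 + 1) / p) ≤ u a - C0 / p - u a / (4 * p) := by
    have e1 : u a * (1 - (2 * C0 + 1) / p) = u a - 2 * u a * (C0 / p) - 4 * (u a / (4 * p)) := by field_simp; ring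
    have hA : 0 ≤ C0 / p := by positivity
    have hB : 0 ≤ u a / (4 * p) := by positivity
    rw [e1]; nlinarith [h.half]
  have h7 : 2 * π * (u a * (1 - (2 * C0 + 1) / p)) ≤ I := by
    have : 2 * π * ((2 * π)⁻¹ * I) = I := by field_simp
    rw [← this]
    exact mul_le_mul_of_nonneg_left (h6.trans h4) (by positivity)
  have h8 : u a * p / L * (2 * π * (u a * (1 - (2 * C0 + 1) / p))) ≤ u a * p / L * I :=
    mul_le_mul_of_nonneg_left h7 (by positivity)
  have h9 : u a * (4 * C0 + 1) * J ≤ u a * (4 * C0 + 1) * (C0 / p) := mul_le_mul_of_nonneg_left h3 (by positivity)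
  have e2 : u a * p / L * (2 * π * (u a * (1 - (2 * C0 + 1) / p))) =
    2 * π * p / L * (u a) ^ 2 * (1 - (2 * C0 + 1) / p) := by ring
  have e3 : u a * (4 * C0 + 1) * (C0 / p) = u a * ((4 * C0 + 1) * C0 / p) := by ring
  linarith

lemma Def_nonneg (h : Bub u p a ρ ε C0) (s : ℝ) (hs1 : ρ ≤ s) (hs2 : s ≤ 3 / 2 * ρ) (hεs : ε < s) :
    0 ≤ Def u p a ε C0 s := by
  unfold Def
  refine mul_nonneg h.p_pos.le (setIntegral_nonneg measurableSet_ball fun y hy => ?_)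
  refine mul_nonneg (h.barrier s hs1 hs2 hεs y hy) ?_
  have := h.pos y (h.ball_sub s hs2 hy)
  positivity

end Bub

lemma tendsto_const_div (A : ℝ) : Tendsto (fun p : ℝ => A / p) atTop (𝓝 0) := tendsto_const_nhds.div_atTop tendsto_id

lemma tendsto_log_div : Tendsto (fun p : ℝ => Real.log p / p) atTop (𝓝 0) := by
  have := Real.isLittleO_log_id_atTop.tendsto_div_nhds_zero
  simpa using this

set_option maxHeartbeats 800000 in
lemma real_asym (A B K E0 η : ℝ) (hA : 0 ≤ A) (hB : 0 ≤ B) (hη : 0 < η) :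
    ∀ᶠ p : ℝ in atTop, ∀ M L l E Df : ℝ, 1 / 2 ≤ M → 0 < L → |l| ≤ K →
      (p - 1) * Real.log M = 2 * L - 2 * l - Real.log p → 0 ≤ Df →
      M * Df + 2 * π * p / L * M ^ 2 * (1 - A / p) - M * (B / p) ≤ E → E ≤ E0 →
      M ≤ E0 ∧ |2 * Real.log M - 4 * (L / p)| ≤ η ∧
      M * Df + 8 * π * (Real.exp (4 * (L / p)) / (4 * (L / p))) - η ≤ E := by
  have t0 : Tendsto (fun p : ℝ => (8 * E0 + 8 * K) / p + 4 * (Real.log p / p)) atTop (𝓝 0) := by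
    simpa using (tendsto_const_div (8 * E0 + 8 * K)).add (tendsto_log_div.const_mul 4)
  have t1 : Tendsto (fun p : ℝ => 3 * E0 * (Real.exp ((8 * E0 + 8 * K) / p + 4 * (Real.log p / p)) - 1) +
      (3 * E0 * (A / p) + E0 * (B / p))) atTop (𝓝 0) := by
    have h1 := (((Real.continuous_exp.tendsto 0).comp t0).sub_const 1).const_mul (3 * E0)
    have h2 := ((tendsto_const_div A).const_mul (3 * E0)).add ((tendsto_const_div B).const_mul E0)
    simpa using h1.add h2
  have t2 : Tendsto (fun p : ℝ => K / p + 2⁻¹ * (Real.log p / p)) atTop (𝓝 0) := by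
    simpa using (tendsto_const_div K).add (tendsto_log_div.const_mul 2⁻¹)
  filter_upwards [eventually_ge_atTop 2, (tendsto_const_div A).eventually_lt_const (show (0:ℝ) < 1 / 4 by norm_num),
    (tendsto_const_div B).eventually_lt_const (show (0:ℝ) < 1 by norm_num), t0.eventually_lt_const hη,
    t1.eventually_lt_const hη, t2.eventually_lt_const (show (0:ℝ) < 1 / 4 by norm_num)] with
    p hp hAp hBp hD hErr hK M L l E Df hM hL hl hrel hDf hE hE0
  have hp0 : 0 < p := by linarith
  have hM0 : 0 < M := by linarith
  have hpi : 3 < π := Real.pi_gt_three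
  obtain ⟨hl1, hl2⟩ := abs_le.1 hl
  set x := L / p with hx
  have hx0 : 0 < x := by positivity
  have hlogp : 0 ≤ Real.log p := Real.log_nonneg (by linarith)
  have hLx : L = x * p := by rw [hx]; field_simp
  have hAp0 : 0 ≤ A / p := by positivity
  have hBp0 : 0 ≤ B / p := by positivity
  -- x ≤ M
  have hxM : x ≤ M := by
    have h1 : Real.log M ≤ M := (Real.log_le_sub_one_of_pos hM0).trans (by linarith)
    have h2 : 2 * (x * p) ≤ (p - 1) * M + 2 * K + Real.log p := by
      rw [← hLx]; nlinarith
    have h3 : K + 2⁻¹ * Real.log p < 1 / 4 * p := by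
      have : K / p + 2⁻¹ * (Real.log p / p) = (K + 2⁻¹ * Real.log p) / p := by ring
      rw [this, div_lt_iff₀ hp0] at hK
      exact hK
    have h4 : 2 * x * p ≤ 2 * M * p := by nlinarith
    nlinarith [le_of_mul_le_mul_right h4 hp0]
  have e1 : 2 * π * p / L * M ^ 2 = 2 * π * M ^ 2 / x := by rw [hLx]; field_simp
  rw [e1] at hE
  set Q := 2 * π * M ^ 2 / x with hQ
  have hQM : 2 * π * M ≤ Q := by
    rw [hQ, le_div_iff₀ hx0]
    have : 0 < π * M := by positivity
    nlinarith
  have hMDf : 0 ≤ M * Df := by positivity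
  have hQ0 : 0 < Q := by positivity
  have hME : M ≤ E0 := by nlinarith
  have hQE : Q ≤ 3 * E0 := by nlinarith
  have hE0p : 0 < E0 := by linarith
  set D := (8 * E0 + 8 * K) / p + 4 * (Real.log p / p) with hDdef
  have hw : |2 * Real.log M - 4 * x| ≤ D := by
    have h1 : (p - 1) * (2 * Real.log M - 4 * x) = 4 * x - 4 * l - 2 * Real.log p := by
      have : (p - 1) * (2 * Real.log M - 4 * x) = 2 * ((p - 1) * Real.log M) - 4 * (p - 1) * x := by ring
      rw [this, hrel, hLx]; ring
    have h2 : D * p = 8 * E0 + 8 * K + 4 * Real.log p := by rw [hDdef]; field_simp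
    have hp1 : 0 < p - 1 := by linarith
    have hK0 : 0 ≤ K := le_trans (abs_nonneg _) hl
    have hD0 : 0 ≤ D := by positivity
    have h3 : 4 * E0 + 4 * K + 2 * Real.log p ≤ (p - 1) * D := by
      have : D * p ≤ D * (2 * (p - 1)) := mul_le_mul_of_nonneg_left (by linarith) hD0
      linarith
    rw [abs_le]
    constructor
    · refine le_of_mul_le_mul_left (a := p - 1) ?_ hp1
      rw [h1, mul_neg]; linarith
    · refine le_of_mul_le_mul_left (a := p - 1) ?_ hp1
      rw [h1]; linarith
  refine ⟨hME, hw.trans hD.le, ?_⟩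
  set w := 2 * Real.log M - 4 * x with hwdef
  have h1 : 8 * π * (Real.exp (4 * x) / (4 * x)) = Q * Real.exp (-w) := by
    have : M ^ 2 = Real.exp (4 * x + w) := by
      rw [hwdef, show 4 * x + (2 * Real.log M - 4 * x) = Real.log M + Real.log M by ring, Real.exp_add, Real.exp_log hM0]
      ring
    rw [hQ, this, Real.exp_add, Real.exp_neg]
    have := Real.exp_pos w
    field_simp
    ring
  rw [h1]
  have h2 : Real.exp (-w) ≤ Real.exp D := Real.exp_le_exp.2 (by linarith [(abs_le.1 hw).1])
  have h3 : 0 ≤ Real.exp D - 1 := by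
    have : 0 ≤ D := (abs_nonneg _).trans hw
    linarith [Real.one_le_exp this]
  have h4 : Q * (Real.exp (-w) - 1) ≤ 3 * E0 * (Real.exp D - 1) := by
    calc Q * (Real.exp (-w) - 1) ≤ Q * (Real.exp D - 1) := mul_le_mul_of_nonneg_left (by linarith) hQ0.le
      _ ≤ _ := mul_le_mul_of_nonneg_right hQE h3
  have h5 : Q * (A / p) ≤ 3 * E0 * (A / p) := mul_le_mul_of_nonneg_right hQE hAp0
  have h6 : M * (B / p) ≤ E0 * (B / p) := mul_le_mul_of_nonneg_right hME hBp0
  nlinarith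

lemma Bub.asym (ρ C0 E0 η : ℝ) (hρ : 0 < ρ) (hη : 0 < η) :
    ∀ᶠ p : ℝ in atTop, ∀ u a ε, Bub u p a ρ ε C0 → ∀ s, ρ ≤ s → s ≤ 3 / 2 * ρ →
      p * (∫ x in ball a s, u x ^ (p + 1)) ≤ E0 →
      ε < η ∧ ε < s ∧ u a ≤ E0 ∧ |2 * Real.log (u a) - 4 * (Real.log (s / ε) / p)| ≤ η ∧
      u a * Bub.Def u p a ε C0 s + 8 * π * (Real.exp (4 * (Real.log (s / ε) / p)) / (4 * (Real.log (s / ε) / p))) - η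
        ≤ p * ∫ x in ball a s, u x ^ (p + 1) := by
  by_cases hC : 0 ≤ C0
  swap
  · refine Eventually.of_forall fun p u a ε h => absurd h.C0_nonneg hC
  have hm : 0 < min η ρ := lt_min hη hρ
  filter_upwards [real_asym (2 * C0 + 1) ((4 * C0 + 1) * C0) (|Real.log ρ| + |Real.log (3 / 2 * ρ)|) E0 η (by positivity) (by positivity) hη,
    (tendsto_const_div C0).eventually_lt_const (show (0:ℝ) < min η ρ ^ 2 by positivity)] with p hr hsm u a ε h s hs1 hs2 hE
  have hp := h.p_pos
  have hεm : ε < min η ρ := by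
    have h1 : ε ^ 2 ≤ C0 / p := by rw [le_div_iff₀ hp]; exact h.small
    exact lt_of_pow_lt_pow_left₀ 2 hm.le (by linarith)
  have hε1 : ε < η := hεm.trans_le (min_le_left _ _)
  have hε2 : ε < s := (hεm.trans_le (min_le_right _ _)).trans_le hs1
  have hL : 0 < Real.log (s / ε) := Real.log_pos (by rw [lt_div_iff₀ h.hε]; linarith)
  have hs0 : 0 < s := by linarith
  have hlog : |Real.log s| ≤ |Real.log ρ| + |Real.log (3 / 2 * ρ)| := by
    have h1 := Real.log_le_log hρ hs1
    have h2 := Real.log_le_log hs0 hs2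
    rw [abs_le]
    constructor
    · linarith [neg_abs_le (Real.log ρ), abs_nonneg (Real.log (3 / 2 * ρ))]
    · linarith [le_abs_self (Real.log (3 / 2 * ρ)), abs_nonneg (Real.log ρ)]
  have hrel : (p - 1) * Real.log (u a) = 2 * Real.log (s / ε) - 2 * Real.log s - Real.log p := by
    have h1 := congrArg Real.log h.scale
    have hM := h.M_pos
    have hε := h.hε
    rw [Real.log_mul (by positivity) (by positivity), Real.log_mul (by positivity) (by positivity), Real.log_pow,
      Real.log_rpow hM, Real.log_one] at h1
    rw [Real.log_div hs0.ne' hε.ne']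
    push_cast at h1
    linarith
  have := hr (u a) (Real.log (s / ε)) (Real.log s) _ _ h.half hL hlog hrel (h.Def_nonneg s hs1 hs2 hε2)
    (h.energy_lower s hs1 hs2 hε2) hE
  exact ⟨hε1, hε2, this.1, this.2.1, this.2.2⟩

lemma exp_div_ge (x : ℝ) (hx : 0 < x) : Real.exp 1 * (1 + (x - 1) ^ 2 / (4 * x)) ≤ Real.exp x / x := by
  have h1 : Real.exp x = Real.exp 1 * (Real.exp ((x - 1) / 2)) ^ 2 := by
    rw [← Real.exp_nat_mul, ← Real.exp_add]; congr 1; push_cast; ring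
  have h2 : 1 + (x - 1) / 2 ≤ Real.exp ((x - 1) / 2) := by linarith [Real.add_one_le_exp ((x - 1) / 2)]
  have h3 : (1 + (x - 1) / 2) ^ 2 ≤ Real.exp ((x - 1) / 2) ^ 2 := pow_le_pow_left₀ (by linarith) h2 2
  rw [le_div_iff₀ hx, h1, mul_assoc]
  refine mul_le_mul_of_nonneg_left ?_ (Real.exp_pos _).le
  refine le_trans (le_of_eq ?_) h3
  field_simp; ring

lemma exp_div_ge' (x : ℝ) (hx : 0 < x) : Real.exp 1 ≤ Real.exp x / x := by
  refine le_trans ?_ (exp_div_ge x hx)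
  have : 0 ≤ (x - 1) ^ 2 / (4 * x) := by positivity
  nlinarith [Real.exp_pos 1]

lemma exp_div_close (κ : ℝ) (hκ : 0 < κ) : ∃ τ > 0, ∀ x > 0, Real.exp x / x ≤ Real.exp 1 + τ → |x - 1| ≤ κ := by
  refine ⟨κ ^ 2 / (2 * (1 + κ)), by positivity, fun x hx h => ?_⟩
  set τ := κ ^ 2 / (2 * (1 + κ)) with hτ
  have hτ' : 2 * τ * (1 + κ) = κ ^ 2 := by rw [hτ]; field_simp
  have hτ0 : 0 < τ := by positivity
  have h1 := exp_div_ge x hx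
  have he : 2 ≤ Real.exp 1 := by linarith [Real.add_one_le_exp 1]
  have h2 : Real.exp 1 * ((x - 1) ^ 2 / (4 * x)) ≤ τ := by linarith
  have h3 : 2 * ((x - 1) ^ 2 / (4 * x)) ≤ τ := by
    have : 0 ≤ (x - 1) ^ 2 / (4 * x) := by positivity
    nlinarith
  have h4 : (x - 1) ^ 2 ≤ 2 * τ * x := by
    have : 2 * ((x - 1) ^ 2 / (4 * x)) = (x - 1) ^ 2 / (2 * x) := by field_simp; ring
    rw [this, div_le_iff₀ (by positivity)] at h3
    linarith
  by_contra hc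
  push Not at hc
  have h5 : x ≤ 1 + |x - 1| := by linarith [le_abs_self (x - 1)]
  rw [← sq_abs] at h4
  set y := |x - 1|
  have h6 : y ^ 2 ≤ 2 * τ * (1 + y) := by nlinarith
  have h7 : κ * y ^ 2 ≤ 2 * τ * y * (1 + κ) := by nlinarith
  have h8 : 2 * τ * y * (1 + κ) = κ ^ 2 * y := by rw [← hτ']; ring
  rw [h8] at h7
  have hy : 0 < y := lt_trans hκ hc
  have : 0 < κ * y := by positivity
  nlinarith

lemma Bub.lower (ρ C0 E0 η : ℝ) (hρ : 0 < ρ) (hη : 0 < η) :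
    ∀ᶠ p : ℝ in atTop, ∀ u a ε, Bub u p a ρ ε C0 → ∀ s, ρ ≤ s → s ≤ 3 / 2 * ρ →
      p * (∫ x in ball a s, u x ^ (p + 1)) ≤ E0 →
      8 * π * Real.exp 1 - η ≤ p * ∫ x in ball a s, u x ^ (p + 1) := by
  filter_upwards [Bub.asym ρ C0 E0 η hρ hη] with p hp u a ε h s hs1 hs2 hE
  obtain ⟨h1, h2, h3, h4, h5⟩ := hp u a ε h s hs1 hs2 hE
  have hL : 0 < Real.log (s / ε) := Real.log_pos (by rw [lt_div_iff₀ h.hε]; linarith)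
  have hpp := h.p_pos
  have h6 := exp_div_ge' (4 * (Real.log (s / ε) / p)) (by positivity)
  have h7 := mul_nonneg h.M_pos.le (h.Def_nonneg s hs1 hs2 h2)
  have := mul_le_mul_of_nonneg_left h6 (show 0 ≤ 8 * π by positivity)
  linarith

lemma Bub.good (ρ C0 κ : ℝ) (hρ : 0 < ρ) (hκ : 0 < κ) : ∃ η > 0,
    ∀ᶠ p : ℝ in atTop, ∀ u a ε, Bub u p a ρ ε C0 →
      p * (∫ x in ball a (3 / 2 * ρ), u x ^ (p + 1)) ≤ 8 * π * Real.exp 1 + η →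
      ε < κ ∧ ε < ρ ∧ |2 * Real.log (u a) - 1| ≤ κ ∧ |Real.log (3 / 2 * ρ / ε) / p - 1 / 4| ≤ κ ∧
      Bub.Def u p a ε C0 (3 / 2 * ρ) ≤ κ ∧
      8 * π * Real.exp 1 - κ ≤ p * ∫ x in ball a ρ, u x ^ (p + 1) := by
  obtain ⟨τ, hτ, hτx⟩ := exp_div_close (κ / 2) (by positivity)
  set η := min (min (κ / 4) (ρ / 2)) (min τ 1) with hηd
  have hη : 0 < η := by positivity
  have hη1 : η ≤ κ / 4 := (min_le_left _ _).trans (min_le_left _ _)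
  have hη2 : η ≤ ρ / 2 := (min_le_left _ _).trans (min_le_right _ _)
  have hη3 : η ≤ τ := (min_le_right _ _).trans (min_le_left _ _)
  have hη4 : η ≤ 1 := (min_le_right _ _).trans (min_le_right _ _)
  have hpi := Real.pi_gt_three
  refine ⟨η, hη, ?_⟩
  filter_upwards [Bub.asym ρ C0 (8 * π * Real.exp 1 + 1) η hρ hη, Bub.lower ρ C0 (8 * π * Real.exp 1 + 1) κ hρ hκ] with
    p hp hp2 u a ε h hE
  obtain ⟨h1, h2, h3, h4, h5⟩ := hp u a ε h (3 / 2 * ρ) (by linarith) le_rfl (by linarith)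
  have hL : 0 < Real.log (3 / 2 * ρ / ε) := Real.log_pos (by rw [lt_div_iff₀ h.hε]; linarith)
  have hpp := h.p_pos
  set x := 4 * (Real.log (3 / 2 * ρ / ε) / p) with hx
  have hx0 : 0 < x := by positivity
  have h6 := exp_div_ge' x hx0
  have h7 := h.Def_nonneg (3 / 2 * ρ) (by linarith) le_rfl h2
  have hMD : 1 / 2 * Bub.Def u p a ε C0 (3 / 2 * ρ) ≤ u a * Bub.Def u p a ε C0 (3 / 2 * ρ) :=
    mul_le_mul_of_nonneg_right h.half h7
  have h8 : Real.exp x / x ≤ Real.exp 1 + τ := by nlinarith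
  have h9 := hτx x hx0 h8
  refine ⟨by linarith, by linarith, ?_, ?_, ?_, ?_⟩
  · rw [abs_le] at h9 h4 ⊢
    constructor <;> linarith [h9.1, h9.2, h4.1, h4.2]
  · rw [abs_le] at h9 ⊢
    constructor <;> linarith [h9.1, h9.2]
  · have := mul_le_mul_of_nonneg_left h6 (show 0 ≤ 8 * π by positivity)
    linarith
  · refine hp2 u a ε h ρ le_rfl (by linarith) ?_
    refine le_trans (mul_le_mul_of_nonneg_left ?_ hpp.le) (hE.trans (by linarith))
    refine setIntegral_mono_set ((h.int_pow (p + 1) (by linarith)).mono_set (h.ball_sub _ le_rfl)) ?_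
      (ball_subset_ball (by linarith)).eventuallyLE
    filter_upwards [ae_restrict_mem measurableSet_ball] with y hy
    have := h.pos y (h.ball_sub _ le_rfl hy)
    simp only [Pi.zero_apply]; positivity

/-! ### bubble mass lemma -/

lemma one_sub_pow_ge (A p : ℝ) (hA : 0 ≤ A) (hp : 0 < p) (h1 : 2 * A ≤ p) (h2 : 4 * A ^ 2 ≤ p) :
    Real.exp (-A) / 2 ≤ (1 - A / p) ^ p := by
  have ht : A / p ≤ 1 / 2 := by rw [div_le_iff₀ hp]; linarith
  have ht0 : 0 ≤ A / p := by positivity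
  set t := A / p with htd
  have hpos : 0 < 1 - t := by linarith
  rw [Real.rpow_def_of_pos hpos]
  have h3 : -t - 2 * t ^ 2 ≤ Real.log (1 - t) := by
    refine le_trans ?_ (Real.one_sub_inv_le_log_of_pos hpos)
    have : (1 - t)⁻¹ ≤ 1 + t + 2 * t ^ 2 := by
      rw [inv_le_comm₀ hpos (by positivity), inv_le_iff_one_le_mul₀ (by positivity)]
      nlinarith [mul_nonneg ht0 (mul_nonneg ht0 (show 0 ≤ 1 - 2 * t by linarith))]
    linarith
  have h4 : -A - 1 / 2 ≤ Real.log (1 - t) * p := by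
    have : (-t - 2 * t ^ 2) * p ≤ Real.log (1 - t) * p := mul_le_mul_of_nonneg_right h3 hp.le
    have e : (-t - 2 * t ^ 2) * p = -A - 2 * A ^ 2 / p := by rw [htd]; field_simp
    have : 2 * A ^ 2 / p ≤ 1 / 2 := by rw [div_le_iff₀ hp]; linarith
    linarith
  have h5 : Real.exp (-A) / 2 ≤ Real.exp (-A - 1 / 2) := by
    rw [sub_eq_add_neg, Real.exp_add, div_eq_mul_inv]
    refine mul_le_mul_of_nonneg_left ?_ (Real.exp_pos _).le
    have : 1 / 2 ≤ Real.exp (-(1 / 2)) := by linarith [Real.add_one_le_exp (-(1/2) : ℝ)]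
    linarith
  exact h5.trans (Real.exp_le_exp.2 h4)

lemma mass_lower (g : E2 → ℝ) (hg : Continuous g) (hg0 : ∀ y, 0 ≤ g y) (a : E2) (σ R k : ℝ) (hσ : 0 < σ) (hσR : σ ≤ R)
    (h : ∀ r ∈ Set.Icc σ R, k * (σ / r) ^ 2 ≤ cavg g a r) :
    2 * π * k * σ ^ 2 * Real.log (R / σ) ≤ ∫ y in ball a R, g y := by
  have hR : 0 < R := by linarith
  have hpol := polar_ball_radial_mul (fun _ => 1) g a R hR.le (by fun_prop) hg.continuousOn
  simp only [one_mul, mul_one] at hpol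
  rw [hpol]
  have hc : Continuous fun r : ℝ => r * ∫ θ in (-π)..π, g (a + r • circDir θ) := by
    refine continuous_id.mul ?_
    refine intervalIntegral.continuous_parametric_intervalIntegral_of_continuous' ?_ _ _
    have := continuous_circDir
    simp only [Function.uncurry_def]
    fun_prop
  have hn : ∀ r, 0 ≤ r → 0 ≤ r * ∫ θ in (-π)..π, g (a + r • circDir θ) := fun r hr =>
    mul_nonneg hr (intervalIntegral.integral_nonneg (by linarith [pi_pos]) fun θ _ => hg0 _)
  rw [← intervalIntegral.integral_add_adjacent_intervals (hc.intervalIntegrable 0 σ) (hc.intervalIntegrable σ R)]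
  have h1 : 0 ≤ ∫ r in (0:ℝ)..σ, r * ∫ θ in (-π)..π, g (a + r • circDir θ) :=
    intervalIntegral.integral_nonneg hσ.le fun r hr => hn r hr.1
  have h2 : ∫ r in σ..R, (2 * π * k * σ ^ 2) * (1 / r) ≤ ∫ r in σ..R, r * ∫ θ in (-π)..π, g (a + r • circDir θ) := by
    refine intervalIntegral.integral_mono_on hσR ?_ (hc.intervalIntegrable σ R) fun r hr => ?_
    · refine ContinuousOn.intervalIntegrable ?_
      rw [Set.uIcc_of_le hσR]
      refine continuousOn_const.mul (continuousOn_const.div continuousOn_id fun x hx => ?_)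
      have := hx.1
      exact (show (0:ℝ) < x by linarith).ne'
    · have hr0 : 0 < r := by linarith [hr.1]
      have h3 := h r hr
      unfold cavg at h3
      have h4 : 2 * π * r * (k * (σ / r) ^ 2) ≤ 2 * π * r * ((2 * π)⁻¹ * ∫ θ in (-π)..π, g (a + r • circDir θ)) :=
        mul_le_mul_of_nonneg_left h3 (by positivity)
      have e1 : 2 * π * r * (k * (σ / r) ^ 2) = (2 * π * k * σ ^ 2) * (1 / r) := by field_simp
      have e2 : 2 * π * r * ((2 * π)⁻¹ * ∫ θ in (-π)..π, g (a + r • circDir θ)) = r * ∫ θ in (-π)..π, g (a + r • circDir θ) := by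
        field_simp
      linarith
  rw [intervalIntegral.integral_const_mul, integral_one_div_of_pos hσ hR] at h2
  linarith

lemma rpow_tangent (x m p : ℝ) (hx : 0 < x) (hm : 0 < m) (hp : 1 ≤ p) :
    p * m ^ (p - 1) * x + (m ^ p - p * m ^ p) ≤ x ^ p := by
  have h := one_add_mul_self_le_rpow_one_add (s := x / m - 1) (by have : 0 < x / m := by positivity
                                                                  linarith) hp
  have e : (1 + (x / m - 1)) = x / m := by ring
  rw [e, Real.div_rpow hx.le hm.le] at h
  have hmp : 0 < m ^ p := by positivity
  rw [le_div_iff₀ hmp] at h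
  have e2 : m ^ (p - 1) = m ^ p / m := Real.rpow_sub_one hm.ne' p
  rw [e2]
  refine le_trans (le_of_eq ?_) h
  field_simp
  ring

lemma le_four_mul (x K p : ℝ) (hx : 0 < x) (hK : 0 < K) (hp : 2 ≤ p) (h : x ^ (p - 1) ≤ 4 * K ^ (p - 1)) :
    x ^ p ≤ 16 * K ^ p := by
  have h1 : x ≤ 4 * K := by
    by_contra hc
    push Not at hc
    have h2 : (4 * K) ^ (p - 1) < x ^ (p - 1) := Real.rpow_lt_rpow (by positivity) hc (by linarith)
    rw [Real.mul_rpow (by norm_num) hK.le] at h2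
    have h3 : (4:ℝ) ^ (1:ℝ) ≤ 4 ^ (p - 1) := Real.rpow_le_rpow_of_exponent_le (by norm_num) (by linarith)
    rw [Real.rpow_one] at h3
    have : 0 < K ^ (p - 1) := by positivity
    nlinarith
  have e1 : x ^ p = x ^ (p - 1) * x := by rw [Real.rpow_sub_one hx.ne']; field_simp
  have e2 : K ^ p = K ^ (p - 1) * K := by rw [Real.rpow_sub_one hK.ne']; field_simp
  rw [e1, e2]
  calc x ^ (p - 1) * x ≤ (4 * K ^ (p - 1)) * (4 * K) := mul_le_mul h h1 hx.le (by positivity)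
    _ = _ := by ring

lemma bubble_cavg (p : ℝ) (hp : 2 ≤ p) (u : E2 → ℝ) (O : Set E2) (y1 : E2) (σ R : ℝ) (hO : IsOpen O) (hu : ContDiffOn ℝ 2 u O)
    (hsub : closedBall y1 R ⊆ O) (hσ : 0 < σ)
    (hpos : ∀ y ∈ closedBall y1 R, 0 < u y) (heq : ∀ y ∈ closedBall y1 R, -lap u y = u y ^ p)
    (h4 : ∀ y ∈ closedBall y1 R, u y ^ (p - 1) ≤ 4 * u y1 ^ (p - 1))
    (hsc : σ ^ 2 * (p * u y1 ^ (p - 1)) = 1) (r : ℝ) (hr1 : σ ≤ r) (hr2 : r ≤ R) :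
    u y1 * (1 - (4 + (p / u y1 * ∫ y in ball y1 R, u y ^ p) / (2 * π) * Real.log (r / σ)) / p) ≤ cavg u y1 r := by
  have hp0 : 0 < p := by linarith
  have hr0 : 0 < r := by linarith
  have hK : 0 < u y1 := hpos y1 (mem_closedBall_self (by linarith))
  have hpi := pi_pos
  have h1 := rep_local u O hO hu y1 r hr0 ((closedBall_subset_closedBall hr2).trans hsub)
  rw [setIntegral_kern_mul y1 r hr0 (ball y1 R) measurableSet_ball (ball_subset_ball hr2)] at h1
  have hcont : ContinuousOn u (closedBall y1 R) := hu.continuousOn.mono hsub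
  have hcp : ContinuousOn (fun y => u y ^ p) (closedBall y1 R) := hcont.rpow_const fun _ _ => Or.inr hp0.le
  have hip : IntegrableOn (fun y => u y ^ p) (ball y1 R) :=
    (hcp.integrableOn_compact (isCompact_closedBall _ _)).mono_set ball_subset_closedBall
  have hb : ∀ y ∈ closedBall y1 R, u y ^ p ≤ 16 * u y1 ^ p := fun y hy =>
    le_four_mul _ _ p (hpos y hy) hK hp (h4 y hy)
  have h2 : ∫ y in ball y1 R, kern y1 r y * -lap u y = ∫ y in ball y1 R, kern y1 r y * u y ^ p :=
    setIntegral_congr_fun measurableSet_ball fun y hy => by simp only [heq y (ball_subset_closedBall hy)]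
  have h3 : ∫ y in ball y1 R, kern y1 r y * u y ^ p ≤
      ∫ y in ball y1 R, (Real.log (r / σ) * u y ^ p + kern y1 σ y * (16 * u y1 ^ p)) := by
    refine integral_mono_ae ?_ ((hip.const_mul _).add ((kern_integrable y1 σ hσ).integrableOn.mul_const _)) ?_
    · refine kern_mul_integrableOn y1 r hr0 _ measurableSet_ball _ hip.aestronglyMeasurable (16 * u y1 ^ p) fun y hy => ?_
      have := hpos y (ball_subset_closedBall hy)
      rw [abs_of_nonneg (by positivity)]
      exact hb y (ball_subset_closedBall hy)
    · filter_upwards [ae_ne_restrict y1 (ball y1 R), ae_restrict_mem measurableSet_ball] with y hy hyB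
      have h5 := (kern_sub_bounds y1 σ r hσ hr1 y hy).2
      have h6 := hb y (ball_subset_closedBall hyB)
      have h7 := hpos y (ball_subset_closedBall hyB)
      have h8 : 0 ≤ u y ^ p := by positivity
      have h9 := kern_nonneg y1 σ y
      nlinarith [mul_le_mul_of_nonneg_right h5 h8, mul_le_mul_of_nonneg_left h6 h9]
  rw [integral_add (hip.const_mul _) ((kern_integrable y1 σ hσ).integrableOn.mul_const _), integral_const_mul] at h3
  have h5 : ∫ y in ball y1 R, kern y1 σ y * (16 * u y1 ^ p) ≤ 8 * π * u y1 / p := by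
    calc ∫ y in ball y1 R, kern y1 σ y * (16 * u y1 ^ p) ≤ ∫ y, kern y1 σ y * (16 * u y1 ^ p) :=
          setIntegral_le_integral ((kern_integrable y1 σ hσ).mul_const _)
            (Eventually.of_forall fun y => mul_nonneg (kern_nonneg _ _ _) (by positivity))
      _ = 8 * π * u y1 / p := by
          rw [integral_mul_const, kern_integral y1 σ hσ]
          have e2 : u y1 ^ p = u y1 ^ (p - 1) * u y1 := by rw [Real.rpow_sub_one hK.ne']; field_simp
          rw [e2]
          have e3 : π * σ ^ 2 / 2 * (16 * (u y1 ^ (p - 1) * u y1)) = 8 * π * u y1 / p * (σ ^ 2 * (p * u y1 ^ (p - 1))) := by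
            field_simp; norm_num
          rw [e3, hsc, mul_one]
  set J := ∫ y in ball y1 R, u y ^ p
  set t := Real.log (r / σ)
  rw [h2] at h1
  have h6 : (2 * π)⁻¹ * ∫ y in ball y1 R, kern y1 r y * u y ^ p ≤ (2 * π)⁻¹ * (t * J + 8 * π * u y1 / p) :=
    mul_le_mul_of_nonneg_left (by linarith) (by positivity)
  have e : u y1 * (1 - (4 + (p / u y1 * J) / (2 * π) * t) / p) = u y1 - (2 * π)⁻¹ * (t * J + 8 * π * u y1 / p) := by
    field_simp; ring
  rw [e]; linarith

lemma bubble_mass : ∃ c > 0, ∃ R0 : ℝ, 1 ≤ R0 ∧ ∃ P0 : ℝ, 2 ≤ P0 ∧ ∀ p ≥ P0, ∀ (u : E2 → ℝ) (O : Set E2) (y1 : E2) (σ : ℝ),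
    IsOpen O → ContDiffOn ℝ 2 u O → closedBall y1 (R0 * σ) ⊆ O → 0 < σ →
    (∀ y ∈ closedBall y1 (R0 * σ), 0 < u y) → (∀ y ∈ closedBall y1 (R0 * σ), -lap u y = u y ^ p) →
    (∀ y ∈ closedBall y1 (R0 * σ), u y ^ (p - 1) ≤ 4 * u y1 ^ (p - 1)) →
    σ ^ 2 * (p * u y1 ^ (p - 1)) = 1 →
    4 * π + c ≤ p / u y1 * ∫ y in ball y1 (R0 * σ), u y ^ p := by
  set Λ : ℝ := 5 * Real.exp 5 with hΛ
  have hΛ5 : 5 ≤ Λ := by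
    have : 1 ≤ Real.exp 5 := Real.one_le_exp (by norm_num)
    linarith
  have hpi := pi_pos
  have hR0 : 1 ≤ Real.exp Λ := Real.one_le_exp (by linarith)
  refine ⟨2 * π / Λ, by positivity, Real.exp Λ, hR0, 2 * (2 * Λ + 5) + 4 * (2 * Λ + 5) ^ 2 + 2, ?_, ?_⟩
  · nlinarith [sq_nonneg (2 * Λ + 5)]
  intro p hp u O y1 σ hO hu hsub hσ hpos heq h4 hsc
  have hp2 : 2 ≤ p := by nlinarith [sq_nonneg (2 * Λ + 5)]
  have hp0 : 0 < p := by linarith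
  by_contra hcon
  push Not at hcon
  set R := Real.exp Λ * σ with hR
  have hσR : σ ≤ R := by rw [hR]; nlinarith
  have hK : 0 < u y1 := hpos y1 (mem_closedBall_self (by linarith))
  obtain ⟨V, hV, hVu⟩ := exists_global_ext u O hO hu y1 R (by linarith) hsub
  have hVe : ∀ y ∈ closedBall y1 R, V y = u y := fun y hy => (hVu y hy).eq_of_nhds
  have hgc : Continuous fun y => (max (V y) 0) ^ p :=
    (hV.continuous.max continuous_const).rpow_const fun _ => Or.inr hp0.le
  have hge : ∀ y ∈ closedBall y1 R, (max (V y) 0) ^ p = u y ^ p := fun y hy => by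
    rw [hVe y hy, max_eq_left (hpos y hy).le]
  have hcont : ContinuousOn u (closedBall y1 R) := hu.continuousOn.mono hsub
  have key := mass_lower (fun y => (max (V y) 0) ^ p) hgc (fun y => by positivity) y1 σ R (u y1 ^ p * Real.exp (-5) / 2) hσ hσR ?_
  · rw [setIntegral_congr_fun measurableSet_ball (fun y hy => hge y (ball_subset_closedBall hy))] at key
    have e1 : Real.log (R / σ) = Λ := by
      rw [hR, mul_div_assoc, div_self hσ.ne', mul_one, Real.log_exp]
    have e2 : u y1 ^ p = u y1 ^ (p - 1) * u y1 := by rw [Real.rpow_sub_one hK.ne']; field_simp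
    rw [e1, hΛ, e2] at key
    have e3 : 2 * π * (u y1 ^ (p - 1) * u y1 * Real.exp (-5) / 2) * σ ^ 2 * (5 * Real.exp 5) = 5 * π * u y1 / p := by
      have h5 : Real.exp (-5) * Real.exp 5 = 1 := by rw [← Real.exp_add]; simp
      calc _ = 5 * π * u y1 / p * (σ ^ 2 * (p * u y1 ^ (p - 1))) * (Real.exp (-5) * Real.exp 5) := by field_simp
        _ = _ := by rw [hsc, h5]; ring
    rw [e3] at key
    have h6 : 5 * π ≤ p / u y1 * ∫ y in ball y1 R, u y ^ p := by
      have := mul_le_mul_of_nonneg_left key (show 0 ≤ p / u y1 by positivity)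
      have e4 : p / u y1 * (5 * π * u y1 / p) = 5 * π := by field_simp
      linarith
    have h7 : 2 * π / Λ ≤ π := by rw [div_le_iff₀ (by linarith)]; nlinarith
    linarith
  · intro r hr
    have hr0 : 0 < r := by linarith [hr.1]
    have h1 := bubble_cavg p hp2 u O y1 σ R hO hu hsub hσ hpos heq h4 hsc r hr.1 hr.2
    set m := p / u y1 * ∫ y in ball y1 R, u y ^ p
    set t := Real.log (r / σ) with ht
    have ht0 : 0 ≤ t := Real.log_nonneg (by rw [le_div_iff₀ hσ]; linarith [hr.1])
    have htΛ : t ≤ Λ := by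
      rw [ht, ← Real.log_exp Λ]
      refine Real.log_le_log (by positivity) ?_
      rw [div_le_iff₀ hσ]; exact hr.2
    set A := 4 + (2 + 1 / Λ) * t with hA
    have htL : 1 / Λ * t ≤ 1 := by
      rw [one_div, inv_mul_le_iff₀ (by linarith)]; linarith
    have hA0 : 0 ≤ A := by positivity
    have hA1 : A ≤ 2 * Λ + 5 := by rw [hA]; linarith
    have hmA : 4 + m / (2 * π) * t ≤ A := by
      have : m / (2 * π) ≤ 2 + 1 / Λ := by
        rw [div_le_iff₀ (by positivity)]
        have e : (2 + 1 / Λ) * (2 * π) = 4 * π + 2 * π / Λ := by ring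
        rw [e]; exact hcon.le
      have := mul_le_mul_of_nonneg_right this ht0
      linarith
    have hA2 : A ^ 2 ≤ (2 * Λ + 5) ^ 2 := pow_le_pow_left₀ hA0 hA1 2
    have h2 := one_sub_pow_ge A p hA0 hp0 (by nlinarith [sq_nonneg (2 * Λ + 5)]) (by nlinarith)
    have hAp : A / p < 1 := by
      rw [div_lt_one hp0]; nlinarith [sq_nonneg (2 * Λ + 5)]
    set m0 := u y1 * (1 - A / p) with hm0
    have hm0p : 0 < m0 := mul_pos hK (by linarith)
    have hm0c : m0 ≤ cavg u y1 r := by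
      refine le_trans ?_ h1
      refine mul_le_mul_of_nonneg_left ?_ hK.le
      have := div_le_div_of_nonneg_right hmA hp0.le
      linarith
    have hrs : closedBall y1 r ⊆ closedBall y1 R := closedBall_subset_closedBall hr.2
    have h3 : cavg (fun y => p * m0 ^ (p - 1) * u y + (m0 ^ p - p * m0 ^ p)) y1 r ≤ cavg (fun y => (max (V y) 0) ^ p) y1 r := by
      refine cavg_mono _ _ y1 r hr0.le ((continuousOn_const.mul (hcont.mono hrs)).add continuousOn_const) hgc.continuousOn fun y hy => ?_
      rw [hge y (hrs hy)]
      exact rpow_tangent _ _ p (hpos y (hrs hy)) hm0p (by linarith)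
    rw [cavg_affine u y1 r _ _ hr0.le (hcont.mono hrs)] at h3
    have h5 : m0 ^ p ≤ cavg (fun y => (max (V y) 0) ^ p) y1 r := by
      refine le_trans ?_ h3
      have h6 : p * m0 ^ (p - 1) * m0 ≤ p * m0 ^ (p - 1) * cavg u y1 r := mul_le_mul_of_nonneg_left hm0c (by positivity)
      have e2 : m0 ^ p = m0 ^ (p - 1) * m0 := by rw [Real.rpow_sub_one hm0p.ne']; field_simp
      nlinarith
    refine le_trans ?_ h5
    rw [hm0, Real.mul_rpow hK.le (by linarith)]
    have h6 : Real.exp (-5) * (σ / r) ^ 2 ≤ Real.exp (-A) := by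
      have e1 : (σ / r) ^ 2 = Real.exp (-2 * t) := by
        have : σ / r = Real.exp (-t) := by
          rw [ht, Real.exp_neg, Real.exp_log (by positivity), inv_div]
        rw [this, ← Real.exp_nat_mul]; congr 1; push_cast; ring
      rw [e1, ← Real.exp_add]
      apply Real.exp_le_exp.2
      rw [hA]; linarith
    have hKp : 0 < u y1 ^ p := by positivity
    calc u y1 ^ p * Real.exp (-5) / 2 * (σ / r) ^ 2 = u y1 ^ p * ((Real.exp (-5) * (σ / r) ^ 2) / 2) := by ring
      _ ≤ u y1 ^ p * (Real.exp (-A) / 2) := mul_le_mul_of_nonneg_left (by linarith) hKp.le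
      _ ≤ _ := mul_le_mul_of_nonneg_left h2 hKp.le

/-- property provided by `bubble_mass` -/
def BM (c R0 P0 : ℝ) : Prop := 0 < c ∧ 1 ≤ R0 ∧ 2 ≤ P0 ∧ ∀ p ≥ P0, ∀ (u : E2 → ℝ) (O : Set E2) (y1 : E2) (σ : ℝ),
    IsOpen O → ContDiffOn ℝ 2 u O → closedBall y1 (R0 * σ) ⊆ O → 0 < σ →
    (∀ y ∈ closedBall y1 (R0 * σ), 0 < u y) → (∀ y ∈ closedBall y1 (R0 * σ), -lap u y = u y ^ p) →
    (∀ y ∈ closedBall y1 (R0 * σ), u y ^ (p - 1) ≤ 4 * u y1 ^ (p - 1)) →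
    σ ^ 2 * (p * u y1 ^ (p - 1)) = 1 →
    4 * π + c ≤ p / u y1 * ∫ y in ball y1 (R0 * σ), u y ^ p

lemma exists_BM : ∃ c R0 P0, BM c R0 P0 := by
  obtain ⟨c, hc, R0, hR, P0, hP, h⟩ := bubble_mass
  exact ⟨c, R0, P0, hc, hR, hP, h⟩

lemma vol_ball (z : E2) (r : ℝ) (hr : 0 ≤ r) : (volume (ball z r)).toReal = π * r ^ 2 := by
  rw [EuclideanSpace.volume_ball_fin_two]
  rw [ENNReal.toReal_mul, ENNReal.toReal_pow, ENNReal.toReal_ofReal hr]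
  simp [mul_comm]
  exact Or.inl pi_pos.le

lemma excess (u : E2 → ℝ) (y1 : E2) (R0 σ p c η : ℝ) (hσ : 0 < σ) (hR0 : 1 ≤ R0) (hp : 0 < p)
    (hi : IntegrableOn (fun y => u y ^ p) (ball y1 (R0 * σ))) (hK : 0 < u y1)
    (hm : 4 * π + c ≤ p / u y1 * ∫ y in ball y1 (R0 * σ), u y ^ p)
    (hsc : σ ^ 2 * (p * u y1 ^ (p - 1)) = 1) (hη : η ≤ 1) (hsm : π * R0 ^ 2 * (1 - η) ^ p ≤ c / 2) :
    u y1 * (4 * π + c / 2) ≤ p * ∫ y in ball y1 (R0 * σ), (u y ^ p - (u y1 * (1 - η)) ^ p) := by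
  have hv : ∫ _ in ball y1 (R0 * σ), (u y1 * (1 - η)) ^ p = π * (R0 * σ) ^ 2 * (u y1 * (1 - η)) ^ p := by
    rw [setIntegral_const, smul_eq_mul, Measure.real, vol_ball _ _ (by positivity)]
  rw [integral_sub hi (integrableOn_const measure_ball_lt_top.ne), hv, Real.mul_rpow hK.le (by linarith)]
  have e2 : u y1 ^ p = u y1 ^ (p - 1) * u y1 := by rw [Real.rpow_sub_one hK.ne']; field_simp
  have e3 : p * (π * (R0 * σ) ^ 2 * (u y1 ^ p * (1 - η) ^ p)) = u y1 * (π * R0 ^ 2 * (1 - η) ^ p) := by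
    rw [e2]
    calc _ = u y1 * (π * R0 ^ 2 * (1 - η) ^ p) * (σ ^ 2 * (p * u y1 ^ (p - 1))) := by ring
      _ = _ := by rw [hsc, mul_one]
  rw [mul_sub, e3]
  have h1 : u y1 * (4 * π + c) ≤ p * ∫ y in ball y1 (R0 * σ), u y ^ p := by
    have := mul_le_mul_of_nonneg_left hm hK.le
    have e4 : u y1 * (p / u y1 * ∫ y in ball y1 (R0 * σ), u y ^ p) = p * ∫ y in ball y1 (R0 * σ), u y ^ p := by field_simp
    linarith
  have h2 := mul_le_mul_of_nonneg_left hsm hK.le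
  nlinarith

namespace Bub
variable {u : E2 → ℝ} {p : ℝ} {a : E2} {ρ ε C0 : ℝ}

lemma select (h : Bub u p a ρ ε C0) (R0 K0 : ℝ) (hR0 : 1 ≤ R0) (hK0 : 16 * R0 ≤ K0) (y : E2)
    (hy : ‖y - a‖ ≤ 5 / 4 * ρ) (hbig : K0 ^ 2 < p * u y ^ (p - 1) * ‖y - a‖ ^ 2) :
    ∃ y1 σ, 0 < σ ∧ σ ^ 2 * (p * u y1 ^ (p - 1)) = 1 ∧ closedBall y1 (R0 * σ) ⊆ closedBall y (‖y - a‖ / 8) ∧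
      (∀ z ∈ closedBall y1 (R0 * σ), u z ^ (p - 1) ≤ 4 * u y1 ^ (p - 1)) ∧ K0 * σ ≤ ‖y - a‖ := by
  have hρ := h.hρ
  have hp := h.p_pos
  have hp2 := h.hp
  set d := ‖y - a‖ with hd
  have hd0 : 0 ≤ d := norm_nonneg _
  have hsubG : closedBall y (d / 8) ⊆ ball a (7 / 4 * ρ) := closedBall_sub a y ρ (d / 8) d le_rfl (by linarith)
  have hcont : ContinuousOn (fun z => (d / 8 - ‖z - y‖) ^ 2 * u z ^ (p - 1)) (closedBall y (d / 8)) := by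
    refine ContinuousOn.mul (by fun_prop) ((h.cont.mono hsubG).rpow_const fun _ _ => Or.inr (by linarith))
  obtain ⟨y1, hy1, hmax⟩ := (isCompact_closedBall y (d / 8)).exists_isMaxOn ⟨y, mem_closedBall_self (by positivity)⟩ hcont
  have hK1 : 0 < u y1 := h.pos y1 (hsubG hy1)
  set k := p * u y1 ^ (p - 1) with hk
  have hk0 : 0 < k := by positivity
  set σ := (Real.sqrt k)⁻¹ with hσ
  have hsq : 0 < Real.sqrt k := Real.sqrt_pos.2 hk0
  have hσ0 : 0 < σ := by positivity
  have hσk : σ ^ 2 * k = 1 := by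
    rw [hσ, inv_pow, Real.sq_sqrt hk0.le, inv_mul_cancel₀ hk0.ne']
  set d1 := d / 8 - ‖y1 - y‖ with hd1
  have hy1' : ‖y1 - y‖ ≤ d / 8 := by rwa [mem_closedBall, dist_eq_norm] at hy1
  have hd10 : 0 ≤ d1 := by linarith
  have hmy : (d / 8) ^ 2 * u y ^ (p - 1) ≤ d1 ^ 2 * u y1 ^ (p - 1) := by
    have := hmax (mem_closedBall_self (x := y) (by positivity : 0 ≤ d / 8))
    simpa using this
  have hd1k : (K0 / 8) ^ 2 < d1 ^ 2 * k := by
    have := mul_le_mul_of_nonneg_left hmy hp.le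
    rw [hk]; nlinarith
  have hd1σ : K0 / 8 * σ < d1 := by
    have h1 : (K0 / 8 * σ) ^ 2 < d1 ^ 2 := by
      have := mul_lt_mul_of_pos_left hd1k (show 0 < σ ^ 2 by positivity)
      have e : σ ^ 2 * (d1 ^ 2 * k) = d1 ^ 2 := by
        calc _ = d1 ^ 2 * (σ ^ 2 * k) := by ring
          _ = _ := by rw [hσk, mul_one]
      rw [e] at this
      calc _ = σ ^ 2 * (K0 / 8) ^ 2 := by ring
        _ < _ := this
    exact lt_of_pow_lt_pow_left₀ 2 hd10 h1
  have hR : R0 * σ ≤ d1 / 2 := by nlinarith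
  have hdd : d1 ≤ d / 8 := by linarith [norm_nonneg (y1 - y)]
  have hsub : closedBall y1 (R0 * σ) ⊆ closedBall y (d / 8) := by
    intro z hz
    rw [mem_closedBall, dist_eq_norm] at hz ⊢
    have : z - y = (z - y1) + (y1 - y) := by abel
    rw [this]
    linarith [norm_add_le (z - y1) (y1 - y)]
  refine ⟨y1, σ, hσ0, hσk, hsub, fun z hz => ?_, by linarith⟩
  have hmz : (d / 8 - ‖z - y‖) ^ 2 * u z ^ (p - 1) ≤ d1 ^ 2 * u y1 ^ (p - 1) := hmax (hsub hz)
  have hz1 : d1 / 2 ≤ d / 8 - ‖z - y‖ := by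
    rw [mem_closedBall, dist_eq_norm] at hz
    have : z - y = (z - y1) + (y1 - y) := by abel
    rw [this]
    linarith [norm_add_le (z - y1) (y1 - y)]
  have hd1p : 0 < d1 := by
    have : 0 < K0 / 8 * σ := by
      have : 0 < K0 := by linarith
      positivity
    linarith
  have hz2 : (d1 / 2) ^ 2 ≤ (d / 8 - ‖z - y‖) ^ 2 := pow_le_pow_left₀ (by positivity) hz1 2
  have huz : 0 ≤ u z ^ (p - 1) := by have := h.pos z (hsubG (hsub hz)); positivity
  have h3 : (d1 / 2) ^ 2 * u z ^ (p - 1) ≤ d1 ^ 2 * u y1 ^ (p - 1) := (mul_le_mul_of_nonneg_right hz2 huz).trans hmz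
  have h4 : d1 ^ 2 * u z ^ (p - 1) ≤ d1 ^ 2 * (4 * u y1 ^ (p - 1)) := by nlinarith
  exact le_of_mul_le_mul_left h4 (by positivity)

/-- comparing heights through scales -/
lemma height (h : Bub u p a ρ ε C0) (K1 σ d : ℝ) (hK1 : 0 < K1) (hσ : 0 < σ) (hsc : σ ^ 2 * (p * K1 ^ (p - 1)) = 1)
    (hσd : σ ≤ d) : u a * (1 - 2 * Real.log (d / ε) / (p - 1)) ≤ K1 := by
  have hp := h.p_pos
  have hp2 := h.hp
  have hM := h.M_pos
  have hε := h.hε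
  have hd : 0 < d := by linarith
  have h1 := congrArg Real.log hsc
  have h2 := congrArg Real.log h.scale
  rw [Real.log_mul (by positivity) (by positivity), Real.log_mul (by positivity) (by positivity), Real.log_pow,
      Real.log_rpow (by positivity), Real.log_one] at h1 h2
  push_cast at h1 h2
  have h3 := Real.log_le_log hσ hσd
  have hp1 : 0 < p - 1 := by linarith
  have h4 : -(2 * Real.log (d / ε) / (p - 1)) ≤ Real.log (K1 / u a) := by
    rw [Real.log_div hd.ne' hε.ne', Real.log_div hK1.ne' hM.ne', ← neg_div, div_le_iff₀ hp1]
    nlinarith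
  have h5 : 1 - 2 * Real.log (d / ε) / (p - 1) ≤ K1 / u a := by
    have := Real.exp_le_exp.2 h4
    rw [Real.exp_log (by positivity)] at this
    linarith [Real.add_one_le_exp (-(2 * Real.log (d / ε) / (p - 1)))]
  rw [le_div_iff₀ hM] at h5
  linarith

lemma eps_le_sigma (h : Bub u p a ρ ε C0) (y1 : E2) (σ : ℝ) (hy1 : y1 ∈ ball a (7 / 4 * ρ)) (hσ : 0 < σ)
    (hsc : σ ^ 2 * (p * u y1 ^ (p - 1)) = 1) : ε ≤ σ := by
  have h1 := h.scale
  have hp := h.p_pos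
  have hp2 := h.hp
  have hle : u y1 ^ (p - 1) ≤ u a ^ (p - 1) := Real.rpow_le_rpow (h.pos y1 hy1).le (h.le y1 hy1) (by linarith)
  have hpos : 0 < u y1 ^ (p - 1) := by have := h.pos y1 hy1; positivity
  by_contra hc
  push Not at hc
  have h2 : σ ^ 2 < ε ^ 2 := pow_lt_pow_left₀ hc hσ.le (by norm_num)
  have h3 : σ ^ 2 * (p * u y1 ^ (p - 1)) < ε ^ 2 * (p * u a ^ (p - 1)) := by
    calc _ < ε ^ 2 * (p * u y1 ^ (p - 1)) := mul_lt_mul_of_pos_right h2 (by positivity)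
      _ ≤ _ := mul_le_mul_of_nonneg_left (mul_le_mul_of_nonneg_left hle hp.le) (by positivity)
  linarith

end Bub

lemma pow_excess (x θ p : ℝ) (hx : 0 < x) (hθ : 0 < θ) (hp : 0 < p) : θ * (x ^ p - θ ^ p) ≤ x ^ (p + 1) := by
  rw [Real.rpow_add_one hx.ne']
  have h1 : 0 < x ^ p := by positivity
  have h2 : 0 < θ ^ p := by positivity
  rcases le_total θ x with h | h
  · nlinarith
  · have : x ^ p ≤ θ ^ p := Real.rpow_le_rpow hx.le h hp.le
    nlinarith

namespace Bub
variable {u : E2 → ℝ} {p : ℝ} {a : E2} {ρ ε C0 : ℝ}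

lemma spot_energy (h : Bub u p a ρ ε C0) (y1 : E2) (r K1 η c : ℝ) (hK : 0 < K1) (hη : η < 1)
    (hsub : ball y1 r ⊆ ball a (7 / 4 * ρ))
    (hex : K1 * (4 * π + c / 2) ≤ p * ∫ y in ball y1 r, (u y ^ p - (K1 * (1 - η)) ^ p)) :
    K1 ^ 2 * (1 - η) * (4 * π + c / 2) ≤ p * ∫ y in ball y1 r, u y ^ (p + 1) := by
  have hp := h.p_pos
  have hθ : 0 < K1 * (1 - η) := mul_pos hK (by linarith)
  have h1 : ∫ y in ball y1 r, (K1 * (1 - η)) * (u y ^ p - (K1 * (1 - η)) ^ p) ≤ ∫ y in ball y1 r, u y ^ (p + 1) := by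
    refine setIntegral_mono_on ?_ ((h.int_pow (p + 1) (by linarith)).mono_set hsub) measurableSet_ball ?_
    · exact (((h.int_pow p hp.le).mono_set hsub).sub (integrableOn_const measure_ball_lt_top.ne)).const_mul _
    · intro y hy
      exact pow_excess _ _ _ (h.pos y (hsub hy)) hθ hp
  rw [integral_const_mul] at h1
  have h2 := mul_le_mul_of_nonneg_left h1 hp.le
  have h3 := mul_le_mul_of_nonneg_left hex hθ.le
  nlinarith

lemma spot_def (h : Bub u p a ρ ε C0) (s : ℝ) (hs1 : ρ ≤ s) (hs2 : s ≤ 3 / 2 * ρ) (hεs : ε < s)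
    (y1 : E2) (r K1 η c t : ℝ) (hK : 0 < K1) (hη : η < 1) (ht : 0 ≤ t)
    (hsub : ball y1 r ⊆ ball a s)
    (hex : K1 * (4 * π + c / 2) ≤ p * ∫ y in ball y1 r, (u y ^ p - (K1 * (1 - η)) ^ p))
    (hg : ∀ x ∈ ball y1 r, K1 * (1 - η) ≤ u x → t ≤ u x / u a - bt a s ε x / Real.log (s / ε) + (4 * C0 + 1) / p) :
    t * (K1 * (4 * π + c / 2)) ≤ Def u p a ε C0 s := by
  have hp := h.p_pos
  have hθ : 0 < K1 * (1 - η) := mul_pos hK (by linarith)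
  have hsubG : ball y1 r ⊆ ball a (7 / 4 * ρ) := hsub.trans (h.ball_sub s hs2)
  have h1 : ∫ y in ball y1 r, t * (u y ^ p - (K1 * (1 - η)) ^ p) ≤
      ∫ x in ball y1 r, (u x / u a - bt a s ε x / Real.log (s / ε) + (4 * C0 + 1) / p) * u x ^ p := by
    refine setIntegral_mono_on ?_ ((h.Def_int s hs1 hs2).mono_set hsub) measurableSet_ball ?_
    · exact (((h.int_pow p hp.le).mono_set hsubG).sub (integrableOn_const measure_ball_lt_top.ne)).const_mul _
    · intro y hy
      have hu := h.pos y (hsubG hy)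
      have hb := h.barrier s hs1 hs2 hεs y (hsub hy)
      have e1 : 0 < u y ^ p := by positivity
      have e2 : 0 < (K1 * (1 - η)) ^ p := by positivity
      rcases le_total (K1 * (1 - η)) (u y) with hc | hc
      · have := hg y hy hc
        nlinarith
      · have e3 : u y ^ p ≤ (K1 * (1 - η)) ^ p := Real.rpow_le_rpow hu.le hc hp.le
        have e4 := mul_nonneg hb e1.le
        nlinarith
  have h2 : ∫ x in ball y1 r, (u x / u a - bt a s ε x / Real.log (s / ε) + (4 * C0 + 1) / p) * u x ^ p ≤
     ∫ x in ball a s, (u x / u a - bt a s ε x / Real.log (s / ε) + (4 * C0 + 1) / p) * u x ^ p := by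
    refine setIntegral_mono_set (h.Def_int s hs1 hs2) ?_ (Eventually.of_forall hsub)
    refine (ae_restrict_iff' measurableSet_ball).2 (Eventually.of_forall fun y hy => ?_)
    have hu := h.pos y (h.ball_sub s hs2 hy)
    exact mul_nonneg (h.barrier s hs1 hs2 hεs y hy) (by positivity)
  rw [integral_const_mul] at h1
  unfold Def
  have h3 := mul_le_mul_of_nonneg_left (h1.trans h2) hp.le
  have h4 := mul_le_mul_of_nonneg_left hex ht
  nlinarith

end Bub

lemma ns_arith (M K1 η c e τ E : ℝ) (hM : 0 < M) (hη : 0 < η) (hη1 : η ≤ 1 / 100) (hc : 0 < c)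
    (he : 2 ≤ e) (hM2 : e * (1 - η) ≤ M ^ 2) (hηc : 20 * (8 * π + c) * η ≤ c)
    (hτ : τ ≤ 3 * η) (hK : M * (1 - 5 / 2 * τ) ≤ K1)
    (hE : K1 ^ 2 * (1 - η) * (4 * π + c / 2) + M ^ 2 * (1 - η) * (4 * π + c / 2) ≤ E) :
    8 * π * e + η < E := by
  have hpi := Real.pi_gt_three
  have h1 : M * (1 - 8 * η) ≤ K1 := by nlinarith
  have h2 : (M * (1 - 8 * η)) ^ 2 ≤ K1 ^ 2 := pow_le_pow_left₀ (mul_nonneg hM.le (by linarith)) h1 2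
  have h3 : M ^ 2 * (1 - 16 * η) ≤ K1 ^ 2 := by nlinarith [sq_nonneg (M * η)]
  have h4 : M ^ 2 * (1 - 17 * η) ≤ K1 ^ 2 * (1 - η) := by
    have := mul_le_mul_of_nonneg_right h3 (by linarith : 0 ≤ 1 - η)
    nlinarith [sq_nonneg (M * η)]
  have h5 : M ^ 2 * (1 - 17 * η) ≤ M ^ 2 * (1 - η) := by nlinarith [sq_nonneg M]
  have h6 : e * (1 - 18 * η) ≤ M ^ 2 * (1 - 17 * η) := by
    have := mul_le_mul_of_nonneg_right hM2 (by linarith : 0 ≤ 1 - 17 * η)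
    nlinarith [sq_nonneg η]
  have hq : 0 < 4 * π + c / 2 := by positivity
  have h7 : e * (1 - 18 * η) * (4 * π + c / 2) ≤ K1 ^ 2 * (1 - η) * (4 * π + c / 2) :=
    mul_le_mul_of_nonneg_right (h6.trans h4) hq.le
  have h8 : e * (1 - 18 * η) * (4 * π + c / 2) ≤ M ^ 2 * (1 - η) * (4 * π + c / 2) :=
    mul_le_mul_of_nonneg_right (h6.trans h5) hq.le
  have h9 : e * (1 - 18 * η) * (8 * π + c) ≤ E := by nlinarith
  have h10 : 18 * η * (8 * π + c) ≤ 9 / 10 * c := by linarith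
  have h11 : e * (18 * η * (8 * π + c)) ≤ e * (9 / 10 * c) := mul_le_mul_of_nonneg_left h10 (by linarith)
  have h12 : 480 * η ≤ c := by nlinarith [mul_pos hη hc]
  nlinarith

lemma ns_log (s d ε : ℝ) (hs : 0 < s) (hd : 0 < d) (hε : 0 < ε) :
    Real.log (s / ε) - Real.log (d / ε) + Real.log 2 = Real.log (2 * s / d) := by
  rw [Real.log_div hs.ne' hε.ne', Real.log_div hd.ne' hε.ne', Real.log_div (by positivity) hd.ne',
    Real.log_mul (by norm_num) hs.ne']
  ring

lemma ns_bt (p η τ T L : ℝ) (hη : 0 < η) (hp : 0 < p) (hpη : 3 ≤ p * η) (hL1 : 24 / 100 * p ≤ L)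
    (hL2 : L ≤ 26 / 100 * p) (hT : T = τ * p) (hτ0 : 0 ≤ τ) :
    L - T + Real.log 2 ≤ (1 - 7 / 2 * τ + η) * L := by
  have hlog2 := Real.log_two_lt_d9
  have e3 : Real.log 2 ≤ η * L := by
    have := mul_le_mul_of_nonneg_left hL1 hη.le
    linarith
  have e4 : 7 / 2 * (τ * L) ≤ T := by
    have := mul_le_mul_of_nonneg_left hL2 hτ0
    have := mul_nonneg hτ0 hp.le
    rw [hT]; linarith
  linarith

set_option maxHeartbeats 1000000 in
lemma Bub.no_second (c R0 P0 : ℝ) (hBM : BM c R0 P0) (ρ C0 : ℝ) : ∃ κ > 0, ∀ᶠ p : ℝ in atTop,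
    ∀ (u : E2 → ℝ) (a : E2) (ε : ℝ), Bub u p a ρ ε C0 → ε < ρ → |2 * Real.log (u a) - 1| ≤ κ →
      |Real.log (3 / 2 * ρ / ε) / p - 1 / 4| ≤ κ → Def u p a ε C0 (3 / 2 * ρ) ≤ κ →
      p * ∫ y in ball a (3 / 2 * ρ), u y ^ (p + 1) ≤ 8 * π * Real.exp 1 + κ →
      ∀ y, ‖y - a‖ ≤ 5 / 4 * ρ → p * u y ^ (p - 1) * ‖y - a‖ ^ 2 ≤ (16 * R0) ^ 2 := by
  obtain ⟨hc, hR0, hP0, hbm⟩ := hBM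
  have hpi := Real.pi_gt_three
  set η := min (1 / 100) (c / (20 * (8 * π + c))) with hηd
  have hη : 0 < η := by positivity
  have hη1 : η ≤ 1 / 100 := min_le_left _ _
  have hηc : 20 * (8 * π + c) * η ≤ c := by
    have := min_le_right (1 / 100) (c / (20 * (8 * π + c)))
    rw [← hηd, le_div_iff₀ (by positivity)] at this
    linarith
  refine ⟨η, hη, ?_⟩
  have hlim : Tendsto (fun p : ℝ => π * R0 ^ 2 * (1 - η) ^ p) atTop (𝓝 (π * R0 ^ 2 * 0)) :=
    (tendsto_rpow_atTop_of_base_lt_one (1 - η) (by linarith) (by linarith)).const_mul _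
  rw [mul_zero] at hlim
  filter_upwards [eventually_ge_atTop P0, eventually_ge_atTop 5, eventually_ge_atTop (3 / η),
    hlim.eventually (ge_mem_nhds (show 0 < c / 2 by positivity))] with p hpP hp5 hpη hpsm
  intro u a ε h hερ hMlog hLlog hDef hE y hy
  by_contra hbig
  push Not at hbig
  have hρ := h.hρ
  have hp := h.p_pos
  have hM := h.M_pos
  have hε := h.hε
  set d := ‖y - a‖ with hd
  have hd0 : 0 < d := by
    rcases (norm_nonneg (y - a)).eq_or_lt with h0 | h0
    · rw [hd, ← h0] at hbig
      nlinarith [sq_nonneg (16 * R0)]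
    · exact h0
  obtain ⟨y1, σ, hσ, hsc, hsub, h4, hKσ⟩ := h.select R0 (16 * R0) hR0 le_rfl y hy hbig
  set s := 3 / 2 * ρ with hs
  have hds : d < s := by linarith
  have hεs : ε < s := by linarith
  have hR0σ : 0 < R0 * σ := by positivity
  have hnear : ∀ z ∈ closedBall y (d / 8), 7 / 8 * d ≤ ‖z - a‖ ∧ ‖z - a‖ ≤ 9 / 8 * d := by
    intro z hz
    rw [mem_closedBall, dist_eq_norm] at hz
    have e1 : z - a = (z - y) + (y - a) := by abel
    have e2 : y - a = (z - a) - (z - y) := by abel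
    constructor
    · have := norm_sub_le (z - a) (z - y)
      rw [← e2] at this
      linarith
    · rw [e1]; linarith [norm_add_le (z - y) (y - a)]
  have hsubs : closedBall y1 (R0 * σ) ⊆ ball a s := by
    intro z hz
    have := (hnear z (hsub hz)).2
    rw [mem_ball, dist_eq_norm]; linarith
  have hsubG : closedBall y1 (R0 * σ) ⊆ ball a (7 / 4 * ρ) := hsubs.trans (h.ball_sub s le_rfl)
  have hy1m : y1 ∈ closedBall y1 (R0 * σ) := mem_closedBall_self hR0σ.le
  have hy1G := hsubG hy1m
  have hK1 : 0 < u y1 := h.pos y1 hy1G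
  have hεσ := h.eps_le_sigma y1 σ hy1G hσ hsc
  have hσd : σ ≤ d := by nlinarith
  have hεd : ε ≤ d := hεσ.trans hσd
  have hR0ε : R0 * ε ≤ d / 16 := by nlinarith
  -- masses
  have hex1 : u y1 * (4 * π + c / 2) ≤ p * ∫ z in ball y1 (R0 * σ), (u z ^ p - (u y1 * (1 - η)) ^ p) := by
    refine excess u y1 R0 σ p c η hσ hR0 hp ((h.int_pow p hp.le).mono_set (ball_subset_closedBall.trans hsubG)) hK1 ?_ hsc
      (by linarith) hpsm
    exact hbm p hpP u _ y1 σ isOpen_ball h.smooth hsubG hσ (fun z hz => h.pos z (hsubG hz)) (fun z hz => h.eqn z (hsubG hz))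
      h4 hsc
  have hsuba : closedBall a (R0 * ε) ⊆ ball a (7 / 4 * ρ) := closedBall_subset_ball (by linarith)
  have hex0 : u a * (4 * π + c / 2) ≤ p * ∫ z in ball a (R0 * ε), (u z ^ p - (u a * (1 - η)) ^ p) := by
    refine excess u a R0 ε p c η hε hR0 hp ((h.int_pow p hp.le).mono_set (ball_subset_closedBall.trans hsuba)) hM ?_ h.scale
      (by linarith) hpsm
    refine hbm p hpP u _ a ε isOpen_ball h.smooth hsuba hε (fun z hz => h.pos z (hsuba hz)) (fun z hz => h.eqn z (hsuba hz))
      ?_ h.scale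
    intro z hz
    have e1 := Real.rpow_le_rpow (h.pos z (hsuba hz)).le (h.le z (hsuba hz)) (by linarith : 0 ≤ p - 1)
    have e2 : 0 < u a ^ (p - 1) := by positivity
    linarith
  -- quantities
  set L := Real.log (s / ε) with hL
  set T := Real.log (d / ε) with hT
  set τ := T / p with hτ
  have hLb := abs_le.1 hLlog
  have hL1 : 24 / 100 * p ≤ L := by
    have : 24 / 100 ≤ L / p := by linarith
    rwa [le_div_iff₀ hp] at this
  have hL2 : L ≤ 26 / 100 * p := by
    have : L / p ≤ 26 / 100 := by linarith
    rwa [div_le_iff₀ hp] at this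
  have hLp : 0 < L := by nlinarith
  have hT0 : 0 ≤ T := Real.log_nonneg (by rw [le_div_iff₀ hε]; linarith)
  have hTL : T ≤ L := Real.log_le_log (by positivity) (by gcongr)
  have hTp : T = τ * p := by rw [hτ]; field_simp
  have hτ0 : 0 ≤ τ := by positivity
  have hτ1 : τ ≤ 26 / 100 := by
    rw [hτ, div_le_iff₀ hp]; linarith
  have hK1M : u a * (1 - 5 / 2 * τ) ≤ u y1 := by
    refine le_trans ?_ (h.height (u y1) σ d hK1 hσ hsc hσd)
    refine mul_le_mul_of_nonneg_left ?_ hM.le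
    have : 2 * T / (p - 1) ≤ 5 / 2 * τ := by
      rw [div_le_iff₀ (by linarith), hTp]; nlinarith
    linarith
  have hhalf := h.half
  have hK1b : 17 / 100 ≤ u y1 := by
    have := mul_le_mul hhalf (by linarith : 35 / 100 ≤ 1 - 5 / 2 * τ) (by norm_num) hM.le
    linarith
  -- tau small
  have hτη : τ ≤ 3 * η := by
    by_contra hcon
    push Not at hcon
    have hd1 : (τ - 2 * η) * (u y1 * (4 * π + c / 2)) ≤ Def u p a ε C0 s := by
      refine h.spot_def s (by linarith) le_rfl hεs y1 (R0 * σ) (u y1) η c (τ - 2 * η) hK1 (by linarith) (by linarith)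
        (ball_subset_closedBall.trans hsubs) hex1 ?_
      intro z hz huz
      have hzn := hnear z (hsub (ball_subset_closedBall hz))
      have hza : 0 < ‖z - a‖ := by linarith
      have hbt : bt a s ε z ≤ L - T + Real.log 2 := by
        refine (bt_le_kern a s ε z).trans ?_
        have e1 : L - T + Real.log 2 = Real.log (2 * s / d) := ns_log s d ε (by linarith) hd0 hε
        rw [e1]
        unfold kern
        refine max_le (Real.log_le_log (by positivity) ?_) (Real.log_nonneg ?_)
        · rw [div_le_div_iff₀ hza hd0]; nlinarith
        · rw [le_div_iff₀ hd0]; linarith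
      have hb2 : bt a s ε z / L ≤ 1 - 7 / 2 * τ + η := by
        rw [div_le_iff₀ hLp]
        have hpη' : 3 ≤ p * η := (div_le_iff₀ hη).1 hpη
        exact hbt.trans (ns_bt p η τ T L hη hp hpη' hL1 hL2 hTp hτ0)
      have hu1 : 1 - 5 / 2 * τ - η ≤ u z / u a := by
        rw [le_div_iff₀ hM]
        have e5 := mul_le_mul_of_nonneg_right hK1M (by linarith : 0 ≤ 1 - η)
        have e6 := mul_nonneg (mul_nonneg hM.le hτ0) hη.le
        linarith
      have hC : 0 ≤ (4 * C0 + 1) / p := by have := h.C0_nonneg; positivity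
      linarith
    have e7 : (17 / 100 : ℝ) * 12 ≤ u y1 * (4 * π + c / 2) :=
      mul_le_mul hK1b (by linarith) (by norm_num) hK1.le
    have e8 := mul_le_mul_of_nonneg_left e7 (by linarith : 0 ≤ τ - 2 * η)
    linarith
  -- conclusion
  have hM2 : Real.exp 1 * (1 - η) ≤ u a ^ 2 := by
    have e1 : u a ^ 2 = Real.exp (2 * Real.log (u a)) := by
      rw [mul_comm, Real.exp_mul, Real.exp_log hM]; norm_num
    rw [e1]
    have e2 := (abs_le.1 hMlog).1
    have e3 : Real.exp (1 - η) ≤ Real.exp (2 * Real.log (u a)) := Real.exp_le_exp.2 (by linarith)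
    rw [sub_eq_add_neg, Real.exp_add] at e3
    have e4 := Real.add_one_le_exp (-η)
    have e5 : Real.exp 1 * (1 - η) ≤ Real.exp 1 * Real.exp (-η) := mul_le_mul_of_nonneg_left (by linarith) (Real.exp_pos _).le
    linarith
  have hE1 := h.spot_energy y1 (R0 * σ) (u y1) η c hK1 (by linarith) (ball_subset_closedBall.trans hsubG) hex1
  have hE0 := h.spot_energy a (R0 * ε) (u a) η c hM (by linarith) (ball_subset_closedBall.trans hsuba) hex0
  have hdisj : Disjoint (ball y1 (R0 * σ)) (ball a (R0 * ε)) := by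
    rw [Set.disjoint_left]
    intro z hz1 hz2
    have := (hnear z (hsub (ball_subset_closedBall hz1))).1
    rw [mem_ball, dist_eq_norm] at hz2
    linarith
  have hIs := (h.int_pow (p + 1) (by linarith)).mono_set (h.ball_sub s le_rfl)
  have hunion : ball y1 (R0 * σ) ∪ ball a (R0 * ε) ⊆ ball a s :=
    Set.union_subset (ball_subset_closedBall.trans hsubs) (ball_subset_ball (by linarith))
  have hsum : (∫ z in ball y1 (R0 * σ), u z ^ (p + 1)) + ∫ z in ball a (R0 * ε), u z ^ (p + 1) ≤
      ∫ z in ball a s, u z ^ (p + 1) := by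
    rw [← setIntegral_union hdisj measurableSet_ball (hIs.mono_set (Set.subset_union_left.trans hunion))
      (hIs.mono_set (Set.subset_union_right.trans hunion))]
    refine setIntegral_mono_set hIs ?_ (Eventually.of_forall hunion)
    refine (ae_restrict_iff' measurableSet_ball).2 (Eventually.of_forall fun z hz => ?_)
    have hu := h.pos z (h.ball_sub s le_rfl hz)
    simp only [Pi.zero_apply]
    positivity
  have hfin := ns_arith (u a) (u y1) η c (Real.exp 1) τ (p * ∫ z in ball a s, u z ^ (p + 1)) hM hη hη1 hc
    (by linarith [Real.add_one_le_exp 1]) hM2 hηc hτη hK1M (by linarith [mul_le_mul_of_nonneg_left hsum hp.le])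
  linarith

/-- kernel comparison near the origin of the bubble -/
lemma kdiff_near (a z y : E2) (ρ : ℝ) (hρ : 0 < ρ) (hd : 0 < ‖z - a‖) (hdρ : ‖z - a‖ ≤ ρ) (hya : y ≠ a)
    (h1 : ‖y - a‖ ≤ ‖z - a‖ / 2) :
    kern z (ρ / 8) y - kern a (3 / 2 * ρ) y ≤ Real.log (2 * ‖y - a‖ / ‖z - a‖) := by
  set d := ‖z - a‖
  have hy : 0 < ‖y - a‖ := norm_pos_iff.2 (sub_ne_zero.2 hya)
  have hyz : d / 2 ≤ ‖y - z‖ := by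
    have e : z - a = (y - a) - (y - z) := by abel
    have := norm_sub_le (y - a) (y - z)
    rw [← e] at this
    linarith
  have hyz0 : 0 < ‖y - z‖ := by linarith
  have hk : Real.log (3 / 2 * ρ / ‖y - a‖) ≤ kern a (3 / 2 * ρ) y := le_max_left _ _
  have e0 : Real.log (2 * ‖y - a‖ / d) + Real.log (3 / 2 * ρ / ‖y - a‖) = Real.log (3 * ρ / d) := by
    rw [← Real.log_mul (by positivity) (by positivity)]
    congr 1; field_simp
  have h2 : kern z (ρ / 8) y ≤ Real.log (3 * ρ / d) := by
    refine max_le (Real.log_le_log (by positivity) ?_) (Real.log_nonneg ?_)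
    · rw [div_le_div_iff₀ hyz0 hd]; nlinarith
    · rw [le_div_iff₀ hd]; linarith
  linarith

lemma kdiff_far (a z y : E2) (ρ : ℝ) (hρ : 0 < ρ) (hd : 0 < ‖z - a‖) (hyz : y ≠ z)
    (h1 : ‖z - a‖ / 2 < ‖y - a‖) (h2 : ‖z - a‖ / 4 ≤ ‖y - z‖) :
    kern z (ρ / 8) y - kern a (3 / 2 * ρ) y ≤ 0 := by
  set d := ‖z - a‖
  have hy : 0 < ‖y - a‖ := by linarith
  have hyz0 : 0 < ‖y - z‖ := by linarith
  have h3 : ‖y - a‖ ≤ 5 * ‖y - z‖ := by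
    have e : y - a = (y - z) + (z - a) := by abel
    rw [e]; linarith [norm_add_le (y - z) (z - a)]
  have hk : Real.log (3 / 2 * ρ / ‖y - a‖) ≤ kern a (3 / 2 * ρ) y := le_max_left _ _
  have h0 := kern_nonneg a (3 / 2 * ρ) y
  have h4 : kern z (ρ / 8) y ≤ kern a (3 / 2 * ρ) y := by
    refine max_le (le_trans (Real.log_le_log (by positivity) ?_) hk) h0
    rw [div_le_div_iff₀ hyz0 hy]; nlinarith
  linarith

lemma kdiff_mid (a z y : E2) (ρ : ℝ) (hρ : 0 < ρ) (hd : 0 < ‖z - a‖) (hyz : y ≠ z)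
    (h1 : ‖z - a‖ / 2 < ‖y - a‖) (h2 : ‖y - z‖ < ‖z - a‖ / 4) :
    kern z (ρ / 8) y - kern a (3 / 2 * ρ) y ≤ kern z ‖z - a‖ y := by
  set d := ‖z - a‖
  have hy : 0 < ‖y - a‖ := by linarith
  have hyz0 : 0 < ‖y - z‖ := norm_pos_iff.2 (sub_ne_zero.2 hyz)
  have h3 : ‖y - a‖ ≤ 5 / 4 * d := by
    have e : y - a = (y - z) + (z - a) := by abel
    rw [e]; linarith [norm_add_le (y - z) (z - a)]
  have hk : Real.log (3 / 2 * ρ / ‖y - a‖) ≤ kern a (3 / 2 * ρ) y := le_max_left _ _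
  have h0 := kern_nonneg a (3 / 2 * ρ) y
  have h0' := kern_nonneg z d y
  have hk2 : Real.log (d / ‖y - z‖) ≤ kern z d y := le_max_left _ _
  have h4 : kern z (ρ / 8) y ≤ kern a (3 / 2 * ρ) y + kern z d y := by
    refine max_le (le_trans ?_ (add_le_add hk hk2)) (by positivity)
    rw [← Real.log_mul (by positivity) (by positivity)]
    refine Real.log_le_log (by positivity) ?_
    rw [div_mul_div_comm, div_le_div_iff₀ hyz0 (by positivity)]
    have : ρ * ‖y - z‖ * ‖y - a‖ ≤ ρ * ‖y - z‖ * (5 / 4 * d) := mul_le_mul_of_nonneg_left h3 (by positivity)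
    have : 0 ≤ ρ * ‖y - z‖ * d := by positivity
    nlinarith
  linarith

namespace Bub
variable {u : E2 → ℝ} {p : ℝ} {a : E2} {ρ ε C0 : ℝ}

lemma kdiff_pt (h : Bub u p a ρ ε C0) (K : ℝ)
    (hQ : ∀ y, ‖y - a‖ ≤ 5 / 4 * ρ → p * u y ^ (p - 1) * ‖y - a‖ ^ 2 ≤ K ^ 2)
    (z : E2) (hd : 0 < ‖z - a‖) (hdρ : ‖z - a‖ ≤ ρ) (t : ℝ) (ht : 0 < t) (htd : 2 * t ≤ ‖z - a‖)
    (y : E2) (hy : y ∈ ball a (7 / 4 * ρ)) (hya : y ≠ a) (hyz : y ≠ z) :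
    (kern z (ρ / 8) y - kern a (3 / 2 * ρ) y) * u y ^ p ≤
      2 * u a * K ^ 2 / (p * ‖z - a‖ ^ 2) * kern z ‖z - a‖ y
        - (ball a t).indicator (fun y => Real.log (‖z - a‖ / (2 * t)) * u y ^ p) y := by
  have hρ := h.hρ
  have hp := h.p_pos
  have hM := h.M_pos
  have hu := h.pos y hy
  have hup : 0 < u y ^ p := by positivity
  have hkd := kern_nonneg z ‖z - a‖ y
  have hB : 0 ≤ 2 * u a * K ^ 2 / (p * ‖z - a‖ ^ 2) := by positivity
  have hBk := mul_nonneg hB hkd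
  rcases le_or_gt ‖y - a‖ (‖z - a‖ / 2) with h1 | h1
  · have hk := kdiff_near a z y ρ hρ hd hdρ hya h1
    have hy0 : 0 < ‖y - a‖ := norm_pos_iff.2 (sub_ne_zero.2 hya)
    by_cases hyt : y ∈ ball a t
    · rw [Set.indicator_of_mem hyt]
      rw [mem_ball, dist_eq_norm] at hyt
      have e1 : Real.log (2 * ‖y - a‖ / ‖z - a‖) ≤ -Real.log (‖z - a‖ / (2 * t)) := by
        rw [← Real.log_inv]
        refine Real.log_le_log (by positivity) ?_
        rw [inv_div]; gcongr
      have := mul_le_mul_of_nonneg_right (hk.trans e1) hup.le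
      linarith
    · rw [Set.indicator_of_notMem hyt]
      have e1 : Real.log (2 * ‖y - a‖ / ‖z - a‖) ≤ 0 := by
        refine Real.log_nonpos (by positivity) ?_
        rw [div_le_one hd]; linarith
      have := mul_nonneg (sub_nonneg.2 (hk.trans e1)) hup.le
      linarith
  · have hyt : y ∉ ball a t := by
      rw [mem_ball, dist_eq_norm]; linarith
    rw [Set.indicator_of_notMem hyt, sub_zero]
    rcases le_or_gt (‖z - a‖ / 4) ‖y - z‖ with h2 | h2
    · have := mul_nonneg (sub_nonneg.2 (kdiff_far a z y ρ hρ hd hyz h1 h2)) hup.le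
      linarith
    · have hk := kdiff_mid a z y ρ hρ hd hyz h1 h2
      have h3 : ‖y - a‖ ≤ 5 / 4 * ‖z - a‖ := by
        have e : y - a = (y - z) + (z - a) := by abel
        rw [e]; linarith [norm_add_le (y - z) (z - a)]
      have h4 : 3 / 4 * ‖z - a‖ ≤ ‖y - a‖ := by
        have e : z - a = (y - a) - (y - z) := by abel
        have := norm_sub_le (y - a) (y - z)
        rw [← e] at this
        linarith
      have hq := hQ y (by linarith)
      have hle := h.le y hy
      have e2 : u y ^ p = u y ^ (p - 1) * u y := by rw [Real.rpow_sub_one hu.ne']; field_simp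
      have hup1 : 0 < u y ^ (p - 1) := by positivity
      have e3 : u y ^ p ≤ 2 * u a * K ^ 2 / (p * ‖z - a‖ ^ 2) := by
        rw [le_div_iff₀ (by positivity), e2]
        have e4 : ‖z - a‖ ^ 2 ≤ 2 * ‖y - a‖ ^ 2 := by
          have := pow_le_pow_left₀ (by positivity) h4 2
          nlinarith [sq_nonneg ‖z - a‖]
        calc u y ^ (p - 1) * u y * (p * ‖z - a‖ ^ 2) ≤ u y ^ (p - 1) * u y * (p * (2 * ‖y - a‖ ^ 2)) := by gcongr
          _ = 2 * (p * u y ^ (p - 1) * ‖y - a‖ ^ 2) * u y := by ring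
          _ ≤ 2 * K ^ 2 * u a := by gcongr
          _ = _ := by ring
      calc _ ≤ kern z ‖z - a‖ y * u y ^ p := mul_le_mul_of_nonneg_right hk hup.le
        _ ≤ kern z ‖z - a‖ y * (2 * u a * K ^ 2 / (p * ‖z - a‖ ^ 2)) := mul_le_mul_of_nonneg_left e3 hkd
        _ = _ := by ring

lemma v_le (h : Bub u p a ρ ε C0) (K : ℝ)
    (hQ : ∀ y, ‖y - a‖ ≤ 5 / 4 * ρ → p * u y ^ (p - 1) * ‖y - a‖ ^ 2 ≤ K ^ 2)
    (z : E2) (hd : 0 < ‖z - a‖) (hdρ : ‖z - a‖ ≤ ρ) (t : ℝ) (ht : 0 < t) (htd : 2 * t ≤ ‖z - a‖) :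
    p / u a * (u z - u a) ≤ 2 * C0 + K ^ 2 / 2
      - (2 * π)⁻¹ * (p / u a * ∫ y in ball a t, u y ^ p) * Real.log (‖z - a‖ / (2 * t)) := by
  have hρ := h.hρ
  have hp := h.p_pos
  have hM := h.M_pos
  have hsubt : ball a t ⊆ ball a (7 / 4 * ρ) := ball_subset_ball (by linarith)
  have hz := h.rep_upper z (ρ / 8) le_rfl (closedBall_sub a z ρ (ρ / 8) ρ hdρ (by linarith))
  have ha := h.rep_lower a (3 / 2 * ρ) (by linarith) (closedBall_sub a a ρ (3 / 2 * ρ) 0 (by simp) (by linarith))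
  have hi1 := h.int_kern z (ρ / 8) (by linarith)
  have hi2 := h.int_kern a (3 / 2 * ρ) (by linarith)
  have hik : IntegrableOn (fun y => 2 * u a * K ^ 2 / (p * ‖z - a‖ ^ 2) * kern z ‖z - a‖ y) (ball a (7 / 4 * ρ)) :=
    ((kern_integrable z ‖z - a‖ hd).integrableOn).const_mul _
  have hii : IntegrableOn ((ball a t).indicator (fun y => Real.log (‖z - a‖ / (2 * t)) * u y ^ p)) (ball a (7 / 4 * ρ)) :=
    ((h.int_pow p hp.le).const_mul _).indicator measurableSet_ball
  have hmain : ∫ y in ball a (7 / 4 * ρ), (kern z (ρ / 8) y * u y ^ p - kern a (3 / 2 * ρ) y * u y ^ p) ≤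
      ∫ y in ball a (7 / 4 * ρ), (2 * u a * K ^ 2 / (p * ‖z - a‖ ^ 2) * kern z ‖z - a‖ y
        - (ball a t).indicator (fun y => Real.log (‖z - a‖ / (2 * t)) * u y ^ p) y) := by
    refine integral_mono_ae (hi1.sub hi2) (hik.sub hii) ?_
    filter_upwards [ae_ne_restrict a _, ae_ne_restrict z _, ae_restrict_mem measurableSet_ball] with y h1 h2 h3
    have := h.kdiff_pt K hQ z hd hdρ t ht htd y h3 h1 h2
    rw [sub_mul] at this
    exact this
  rw [integral_sub hi1 hi2, integral_sub hik hii, integral_const_mul, setIntegral_indicator measurableSet_ball,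
    Set.inter_eq_self_of_subset_right hsubt, integral_const_mul] at hmain
  have hkle : ∫ y in ball a (7 / 4 * ρ), kern z ‖z - a‖ y ≤ π * ‖z - a‖ ^ 2 / 2 := by
    rw [← kern_integral z ‖z - a‖ hd]
    exact setIntegral_le_integral (kern_integrable z _ hd) (Eventually.of_forall fun y => kern_nonneg z _ y)
  have hkB := mul_le_mul_of_nonneg_left hkle (show 0 ≤ 2 * u a * K ^ 2 / (p * ‖z - a‖ ^ 2) by positivity)
  have e1 : 2 * u a * K ^ 2 / (p * ‖z - a‖ ^ 2) * (π * ‖z - a‖ ^ 2 / 2) = π * u a * K ^ 2 / p := by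
    field_simp
  rw [e1] at hkB
  set I := ∫ y in ball a t, u y ^ p
  set J1 := ∫ y in ball a (7 / 4 * ρ), kern z (ρ / 8) y * u y ^ p
  set J2 := ∫ y in ball a (7 / 4 * ρ), kern a (3 / 2 * ρ) y * u y ^ p
  set Λ := Real.log (‖z - a‖ / (2 * t))
  have h5 : J1 - J2 ≤ π * u a * K ^ 2 / p - Λ * I := by linarith
  have h6 : u z - u a ≤ C0 / p + (2 * π)⁻¹ * (π * u a * K ^ 2 / p - Λ * I) := by
    have := mul_le_mul_of_nonneg_left h5 (show 0 ≤ (2 * π)⁻¹ by positivity)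
    linarith
  have h7 := mul_le_mul_of_nonneg_left h6 (show 0 ≤ p / u a by positivity)
  refine h7.trans ?_
  have e2 : p / u a * (C0 / p + (2 * π)⁻¹ * (π * u a * K ^ 2 / p - Λ * I)) =
      C0 / u a + K ^ 2 / 2 - (2 * π)⁻¹ * (p / u a * I) * Λ := by
    field_simp
    field_simp
    ring
  have e3 : C0 / u a ≤ 2 * C0 := by
    rw [div_le_iff₀ hM]; nlinarith [h.half, h.C0_nonneg]
  linarith

end Bub

lemma radial_tail (a : E2) (t ρ γ : ℝ) (ht : 0 < t) (htρ : t ≤ ρ) (hγ : 0 < γ) :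
    IntegrableOn (fun y => (max ‖y - a‖ t) ^ (-2 - γ)) (ball a ρ) ∧
    ∫ y in ball a ρ, (max ‖y - a‖ t) ^ (-2 - γ) ≤ 2 * π * ((1 + 1 / γ) * t ^ (-γ)) := by
  have hρ : 0 < ρ := by linarith
  have hcm : Continuous (fun r : ℝ => (max r t) ^ (-2 - γ)) :=
    (by fun_prop : Continuous fun r : ℝ => max r t).rpow_const fun r => Or.inl (by positivity)
  have hcm1 : Continuous (fun r : ℝ => (max r t) ^ (-1 - γ)) :=
    (by fun_prop : Continuous fun r : ℝ => max r t).rpow_const fun r => Or.inl (by positivity)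
  constructor
  · have : Continuous (fun y : E2 => (max ‖y - a‖ t) ^ (-2 - γ)) := hcm.comp (by fun_prop : Continuous fun y : E2 => ‖y - a‖)
    exact ((this.continuousOn).integrableOn_compact (isCompact_closedBall a ρ)).mono_set ball_subset_closedBall
  · have h1 := polar_ball_radial_mul (fun r => (max r t) ^ (-2 - γ)) (fun _ => 1) a ρ hρ.le
      (by fun_prop) continuousOn_const
    simp only [mul_one] at h1
    rw [h1]
    simp only [intervalIntegral.integral_const, smul_eq_mul, mul_one]
    rw [intervalIntegral.integral_mul_const]
    have h2 : ∫ r in (0:ℝ)..ρ, r * (max r t) ^ (-2 - γ) ≤ ∫ r in (0:ℝ)..ρ, (max r t) ^ (-1 - γ) := by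
      refine intervalIntegral.integral_mono_on hρ.le ((continuous_id.mul hcm).intervalIntegrable _ _)
        (hcm1.intervalIntegrable _ _) fun r hr => ?_
      have hm : 0 < max r t := lt_max_of_lt_right ht
      have e : (max r t) ^ (-1 - γ) = max r t * (max r t) ^ (-2 - γ) := by
        rw [show -1 - γ = (-2 - γ) + 1 by ring, Real.rpow_add_one hm.ne']; ring
      rw [e]
      exact mul_le_mul_of_nonneg_right (le_max_left _ _) (by positivity)
    have h3 : ∫ r in (0:ℝ)..ρ, (max r t) ^ (-1 - γ) = (∫ r in (0:ℝ)..t, (max r t) ^ (-1 - γ)) + ∫ r in t..ρ, (max r t) ^ (-1 - γ) :=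
      (intervalIntegral.integral_add_adjacent_intervals (hcm1.intervalIntegrable _ _) (hcm1.intervalIntegrable _ _)).symm
    have h4 : ∫ r in (0:ℝ)..t, (max r t) ^ (-1 - γ) = t ^ (-γ) := by
      have : ∫ r in (0:ℝ)..t, (max r t) ^ (-1 - γ) = ∫ r in (0:ℝ)..t, t ^ (-1 - γ) := by
        refine intervalIntegral.integral_congr fun r hr => ?_
        rw [Set.uIcc_of_le ht.le] at hr
        simp only [max_eq_right hr.2]
      rw [this, intervalIntegral.integral_const, smul_eq_mul, sub_zero, show -γ = (-1 - γ) + 1 by ring,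
        Real.rpow_add_one ht.ne']
      ring_nf
    have h5 : ∫ r in t..ρ, (max r t) ^ (-1 - γ) ≤ 1 / γ * t ^ (-γ) := by
      have : ∫ r in t..ρ, (max r t) ^ (-1 - γ) = ∫ r in t..ρ, r ^ (-1 - γ) := by
        refine intervalIntegral.integral_congr fun r hr => ?_
        rw [Set.uIcc_of_le htρ] at hr
        simp only [max_eq_left hr.1]
      rw [this, integral_rpow (Or.inr ⟨by linarith, by rw [Set.uIcc_of_le htρ]; intro h; linarith [h.1]⟩)]
      rw [show -1 - γ + 1 = -γ by ring]
      have : 0 < ρ ^ (-γ) := by positivity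
      rw [div_neg, ← neg_div, neg_sub, div_mul_eq_mul_div, one_mul]
      gcongr
      linarith
    have : (1 + 1 / γ) * t ^ (-γ) = t ^ (-γ) + 1 / γ * t ^ (-γ) := by ring
    rw [this]
    have hpi := pi_pos
    nlinarith

namespace Bub
variable {u : E2 → ℝ} {p : ℝ} {a : E2} {ρ ε C0 : ℝ}

lemma decay (h : Bub u p a ρ ε C0) (y : E2) (hy : y ∈ ball a (7 / 4 * ρ)) (V : ℝ)
    (hV : p / u a * (u y - u a) ≤ V) : u y ^ p ≤ u a ^ p * Real.exp V := by
  have hp := h.p_pos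
  have hM := h.M_pos
  have hu := h.pos y hy
  have h1 : u y / u a ≤ Real.exp (V / p) := by
    have e : u y / u a = 1 + (p / u a * (u y - u a)) / p := by field_simp; ring
    rw [e]
    have : (p / u a * (u y - u a)) / p ≤ V / p := by gcongr
    linarith [Real.add_one_le_exp (V / p)]
  have h2 := Real.rpow_le_rpow (by positivity) h1 hp.le
  rw [Real.div_rpow hu.le hM.le, ← Real.exp_mul, div_mul_cancel₀ _ hp.ne', div_le_iff₀ (by positivity)] at h2
  linarith

lemma tail (h : Bub u p a ρ ε C0) (C3 γ R0 R : ℝ) (hγ : 0 < γ) (hR0 : 1 ≤ R0) (hR : 2 * R0 ≤ R) (hRρ : R * ε ≤ ρ)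
    (hv : ∀ y, 2 * (R0 * ε) ≤ ‖y - a‖ → ‖y - a‖ ≤ ρ →
      p / u a * (u y - u a) ≤ C3 - (2 + γ) * Real.log (‖y - a‖ / (2 * (R0 * ε)))) :
    p / u a * ∫ y in ball a ρ, u y ^ p ≤ p / u a * (∫ y in ball a (R * ε), u y ^ p) +
      Real.exp C3 * (2 * R0) ^ (2 + γ) * (2 * π * (1 + 1 / γ)) * R ^ (-γ) := by
  have hρ := h.hρ
  have hp := h.p_pos
  have hM := h.M_pos
  have hε := h.hε
  have hR0' : 0 < R := by linarith
  have ht : 0 < R * ε := by positivity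
  obtain ⟨hti, htb⟩ := radial_tail a (R * ε) ρ γ ht hRρ hγ
  set A := u a ^ p * (Real.exp C3 * (2 * (R0 * ε)) ^ (2 + γ)) with hA
  have hA0 : 0 < A := by positivity
  have hsub : ball a ρ ⊆ ball a (7 / 4 * ρ) := ball_subset_ball (by linarith)
  have hip := (h.int_pow p hp.le).mono_set hsub
  have h1 : ∫ y in ball a ρ, u y ^ p ≤ ∫ y in ball a ρ, ((ball a (R * ε)).indicator (fun y => u y ^ p) y
      + A * (max ‖y - a‖ (R * ε)) ^ (-2 - γ)) := by
    refine setIntegral_mono_on hip ((hip.indicator measurableSet_ball).add (hti.const_mul A)) measurableSet_ball ?_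
    intro y hy
    have hmp : 0 < A * (max ‖y - a‖ (R * ε)) ^ (-2 - γ) := by
      have : 0 < max ‖y - a‖ (R * ε) := lt_max_of_lt_right ht
      positivity
    by_cases hyt : y ∈ ball a (R * ε)
    · rw [Set.indicator_of_mem hyt]; linarith
    · rw [Set.indicator_of_notMem hyt, zero_add]
      have hyt' : R * ε ≤ ‖y - a‖ := by rwa [mem_ball, dist_eq_norm, not_lt] at hyt
      have hyρ : ‖y - a‖ < ρ := by rwa [mem_ball, dist_eq_norm] at hy
      have hy0 : 0 < ‖y - a‖ := by linarith
      rw [max_eq_left hyt']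
      have hd := h.decay y (hsub hy) _ (hv y (by nlinarith) hyρ.le)
      refine hd.trans (le_of_eq ?_)
      rw [hA, mul_assoc]
      congr 1
      rw [sub_eq_add_neg, Real.exp_add, mul_assoc]
      congr 1
      rw [show -2 - γ = -(2 + γ) by ring, Real.rpow_neg hy0.le, ← div_eq_mul_inv, ← Real.div_rpow (by positivity) hy0.le,
        Real.rpow_def_of_pos (by positivity), ← inv_div (2 * (R0 * ε)), Real.log_inv]
      congr 1; ring
  rw [integral_add (hip.indicator measurableSet_ball) (hti.const_mul A), setIntegral_indicator measurableSet_ball,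
    Set.inter_eq_self_of_subset_right (ball_subset_ball hRρ), integral_const_mul] at h1
  have h2 := h1.trans (add_le_add le_rfl (mul_le_mul_of_nonneg_left htb hA0.le))
  have h3 := mul_le_mul_of_nonneg_left h2 (show 0 ≤ p / u a by positivity)
  refine h3.trans (le_of_eq ?_)
  rw [mul_add]
  congr 1
  rw [hA, h.Mpow]
  have e1 : (2 * (R0 * ε)) ^ (2 + γ) = (2 * R0) ^ (2 + γ) * (ε ^ 2 * ε ^ γ) := by
    rw [← mul_assoc, Real.mul_rpow (by positivity) hε.le, Real.rpow_add hε]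
    norm_num
  have e2 : (R * ε) ^ (-γ) = R ^ (-γ) * (ε ^ γ)⁻¹ := by
    rw [Real.mul_rpow hR0'.le hε.le, Real.rpow_neg hε.le]
  rw [e1, e2]
  have : 0 < ε ^ γ := by positivity
  field_simp

end Bub

lemma final_arith (κ δ M m τ e : ℝ) (hδ : 0 < δ) (hδ1 : δ < 1) (hκ : 0 < κ) (hκδ : κ ≤ δ / 40) (he1 : 2 ≤ e)
    (hM0 : 0 < M) (hM : M ^ 2 ≤ e * (1 + 2 * κ)) (hτ : τ ≤ π * δ)
    (hE : 8 * π * e - κ ≤ M ^ 2 * (m + τ)) : 2 * π * (4 - δ) ≤ m := by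
  have hpi := Real.pi_gt_three
  by_contra hc
  push Not at hc
  have h1 : m + τ ≤ 8 * π - π * δ := by linarith
  have h2 : 0 < 8 * π - π * δ := by nlinarith
  have h3 : M ^ 2 * (m + τ) ≤ M ^ 2 * (8 * π - π * δ) := mul_le_mul_of_nonneg_left h1 (sq_nonneg M)
  have h4 : M ^ 2 * (8 * π - π * δ) ≤ e * (1 + 2 * κ) * (8 * π - π * δ) := mul_le_mul_of_nonneg_right hM h2.le
  have h5 : m + τ < 8 * π - π * δ := by linarith
  have h6 : e * π * δ ≤ κ + 16 * (e * π * κ) := by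
    have : 0 < e * κ * (π * δ) := by positivity
    nlinarith
  have h7 : e * π * κ ≤ e * π * (δ / 40) := mul_le_mul_of_nonneg_left hκδ (by positivity)
  have h8 : 6 * δ ≤ e * π * δ := by
    have : 6 ≤ e * π := by nlinarith
    nlinarith
  linarith

set_option maxHeartbeats 1000000 in
lemma Bub.final (ρ C0 δ : ℝ) (hρ : 0 < ρ) (hδ : 0 < δ) (hδ1 : δ < 1) : ∃ η > 0, ∃ R > (1:ℝ), ∃ C > (0:ℝ),
    ∀ᶠ p : ℝ in atTop, ∀ (u : E2 → ℝ) (a : E2) (ε : ℝ), Bub u p a ρ ε C0 →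
      p * ∫ y in ball a (3 / 2 * ρ), u y ^ (p + 1) ≤ 8 * π * Real.exp 1 + η →
      ∀ z : E2, R ≤ ‖z‖ → ‖z‖ ≤ ρ / ε → p / u a * (u (a + ε • z) - u a) ≤ (4 - δ) * Real.log (1 / ‖z‖) + C := by
  obtain ⟨c, R0, P0, hBM⟩ := exists_BM
  obtain ⟨κ1, hκ1, hns⟩ := Bub.no_second c R0 P0 hBM ρ C0
  obtain ⟨hc, hR0, hP0, hbm⟩ := hBM
  set κ := min κ1 (δ / 40) with hκd
  have hκ : 0 < κ := by positivity
  have hκ1' : κ ≤ κ1 := min_le_left _ _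
  have hκδ : κ ≤ δ / 40 := min_le_right _ _
  obtain ⟨η1, hη1, hgood⟩ := Bub.good ρ C0 κ hρ hκ
  set γ := c / (2 * π) with hγd
  have hγ : 0 < γ := by positivity
  set K := 16 * R0 with hK
  set C3 := 2 * C0 + K ^ 2 / 2 with hC3
  have hlim : Tendsto (fun R : ℝ => Real.exp C3 * (2 * R0) ^ (2 + γ) * (2 * π * (1 + 1 / γ)) * R ^ (-γ)) atTop
      (𝓝 (Real.exp C3 * (2 * R0) ^ (2 + γ) * (2 * π * (1 + 1 / γ)) * 0)) :=
    (tendsto_rpow_neg_atTop hγ).const_mul _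
  rw [mul_zero] at hlim
  obtain ⟨R, hR2, hRt⟩ := ((eventually_ge_atTop (2 * R0)).and
    (hlim.eventually (ge_mem_nhds (show 0 < π * δ by positivity)))).exists
  refine ⟨min η1 κ, by positivity, 2 * R, by linarith, |C3| + 4 * Real.log (2 * R) + 1, ?_, ?_⟩
  · have := Real.log_nonneg (by linarith : 1 ≤ 2 * R)
    positivity
  filter_upwards [hns, hgood, eventually_ge_atTop P0] with p hns hgood hpP
  intro u a ε h hE z hz1 hz2
  obtain ⟨-, hερ, hMl, hLl, hDef, hEl⟩ := hgood u a ε h (hE.trans (by linarith [min_le_left η1 κ]))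
  have hQ := hns u a ε h hερ (hMl.trans hκ1') (hLl.trans hκ1') (hDef.trans hκ1')
    (hE.trans (by linarith [min_le_right η1 κ]))
  have hp := h.p_pos
  have hM := h.M_pos
  have hε := h.hε
  have hzn : ‖z‖ * ε ≤ ρ := by rwa [le_div_iff₀ hε] at hz2
  have hRρ : 2 * (R * ε) ≤ ρ := by nlinarith
  have hRε : 0 < R * ε := mul_pos (by linarith) hε
  have hR0ε : 0 < R0 * ε := mul_pos (by linarith) hε
  have hR0R : R0 * ε ≤ R * ε := mul_le_mul_of_nonneg_right (by linarith) hε.le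
  -- mass at a
  have hsuba : closedBall a (R0 * ε) ⊆ ball a (7 / 4 * ρ) := closedBall_subset_ball (by linarith)
  have hmass0 : 4 * π + c ≤ p / u a * ∫ y in ball a (R0 * ε), u y ^ p := by
    refine hbm p hpP u _ a ε isOpen_ball h.smooth hsuba hε (fun z hz => h.pos z (hsuba hz)) (fun z hz => h.eqn z (hsuba hz))
      ?_ h.scale
    intro z hz
    have e1 := Real.rpow_le_rpow (h.pos z (hsuba hz)).le (h.le z (hsuba hz)) (by linarith [h.hp] : 0 ≤ p - 1)
    have e2 : 0 < u a ^ (p - 1) := by positivity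
    linarith
  have hv0 : ∀ y, 2 * (R0 * ε) ≤ ‖y - a‖ → ‖y - a‖ ≤ ρ →
      p / u a * (u y - u a) ≤ C3 - (2 + γ) * Real.log (‖y - a‖ / (2 * (R0 * ε))) := by
    intro y h1 h2
    refine (h.v_le K hQ y (by linarith) h2 (R0 * ε) hR0ε h1).trans ?_
    have hl : 0 ≤ Real.log (‖y - a‖ / (2 * (R0 * ε))) := Real.log_nonneg (by rw [le_div_iff₀ (by positivity)]; linarith)
    have e1 : 2 + γ ≤ (2 * π)⁻¹ * (p / u a * ∫ y in ball a (R0 * ε), u y ^ p) := by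
      have e2 : 2 + γ = (2 * π)⁻¹ * (4 * π + c) := by rw [hγd]; field_simp; ring
      rw [e2]; exact mul_le_mul_of_nonneg_left hmass0 (by positivity)
    have := mul_le_mul_of_nonneg_right e1 hl
    linarith
  have htail := h.tail C3 γ R0 R hγ hR0 hR2 (by linarith) hv0
  set m := p / u a * (∫ y in ball a (R * ε), u y ^ p) with hm
  -- energy
  have hsub : ball a ρ ⊆ ball a (7 / 4 * ρ) := ball_subset_ball (by linarith)
  have hEM : p * ∫ y in ball a ρ, u y ^ (p + 1) ≤ u a ^ 2 * (p / u a * ∫ y in ball a ρ, u y ^ p) := by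
    have e1 : ∫ y in ball a ρ, u y ^ (p + 1) ≤ ∫ y in ball a ρ, u a * u y ^ p := by
      refine setIntegral_mono_on ((h.int_pow (p + 1) (by linarith)).mono_set hsub)
        (((h.int_pow p hp.le).mono_set hsub).const_mul _) measurableSet_ball fun y hy => ?_
      have hu := h.pos y (hsub hy)
      rw [Real.rpow_add_one hu.ne', mul_comm]
      exact mul_le_mul_of_nonneg_right (h.le y (hsub hy)) (by positivity)
    rw [integral_const_mul] at e1
    have e2 := mul_le_mul_of_nonneg_left e1 hp.le
    refine e2.trans (le_of_eq ?_)
    field_simp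
  have hE2 : 8 * π * Real.exp 1 - κ ≤ u a ^ 2 * (m + Real.exp C3 * (2 * R0) ^ (2 + γ) * (2 * π * (1 + 1 / γ)) * R ^ (-γ)) :=
    hEl.trans (hEM.trans (mul_le_mul_of_nonneg_left htail (sq_nonneg _)))
  have hM2 : u a ^ 2 ≤ Real.exp 1 * (1 + 2 * κ) := by
    have e1 : u a ^ 2 = Real.exp (2 * Real.log (u a)) := by
      rw [mul_comm, Real.exp_mul, Real.exp_log hM]; norm_num
    have e2 := (abs_le.1 hMl).2
    have e3 : Real.exp (2 * Real.log (u a)) ≤ Real.exp (1 + κ) := Real.exp_le_exp.2 (by linarith)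
    rw [e1]
    refine e3.trans ?_
    rw [Real.exp_add]
    refine mul_le_mul_of_nonneg_left ?_ (Real.exp_pos _).le
    have e4 := Real.abs_exp_sub_one_sub_id_le (x := κ) (by rw [abs_of_pos hκ]; linarith)
    have e5 := (abs_le.1 e4).2
    nlinarith
  have hmm := final_arith κ δ (u a) m _ (Real.exp 1) hδ hδ1 hκ hκδ (by linarith [Real.add_one_le_exp 1]) hM hM2 hRt hE2
  have hzn0 : 0 < ‖z‖ := by linarith
  have hnorm : ‖a + ε • z - a‖ = ε * ‖z‖ := by
    rw [add_sub_cancel_left, norm_smul, Real.norm_eq_abs, abs_of_pos hε]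
  have hfin := h.v_le K hQ (a + ε • z) (by rw [hnorm]; positivity) (by rw [hnorm]; linarith) (R * ε) hRε
    (by rw [hnorm]; nlinarith)
  rw [hnorm, ← hm] at hfin
  have e1 : ε * ‖z‖ / (2 * (R * ε)) = ‖z‖ / (2 * R) := by field_simp
  rw [e1] at hfin
  have hl : 0 ≤ Real.log (‖z‖ / (2 * R)) := Real.log_nonneg (by rw [le_div_iff₀ (by linarith)]; linarith)
  have e2 : 4 - δ ≤ (2 * π)⁻¹ * m := by
    have := mul_le_mul_of_nonneg_left hmm (show 0 ≤ (2 * π)⁻¹ by positivity)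
    have e3 : (2 * π)⁻¹ * (2 * π * (4 - δ)) = 4 - δ := by field_simp
    linarith
  have e4 := mul_le_mul_of_nonneg_right e2 hl
  have e5 : Real.log (‖z‖ / (2 * R)) = -Real.log (1 / ‖z‖) - Real.log (2 * R) := by
    rw [Real.log_div hzn0.ne' (by linarith), one_div, Real.log_inv]; ring
  have e6 := Real.log_nonneg (by linarith : 1 ≤ 2 * R)
  have e7 := le_abs_self C3
  have e8 : δ * Real.log (2 * R) ≥ 0 := by positivity
  rw [e5] at e4 hfin
  linarith

lemma pow_le_energy (x p : ℝ) (hp : 1 ≤ p) : p * (max x 0) ^ p ≤ 2 * (p * |x| ^ (p + 1)) + 1 := by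
  have hp0 : 0 < p := by linarith
  have h0 : (max x 0) ^ p ≤ |x| ^ p := Real.rpow_le_rpow (le_max_right _ _) (max_le (le_abs_self x) (abs_nonneg x)) hp0.le
  have h3 : 0 ≤ |x| ^ (p + 1) := by positivity
  rcases le_or_gt (1 / 2) |x| with h | h
  · have h1 : |x| ^ p ≤ 2 * |x| ^ (p + 1) := by
      rw [Real.rpow_add_one (by linarith)]
      have : 0 ≤ |x| ^ p := by positivity
      nlinarith
    have := mul_le_mul_of_nonneg_left (h0.trans h1) hp0.le
    linarith
  · have h1 : |x| ^ p ≤ (1 / 2) ^ p := Real.rpow_le_rpow (abs_nonneg x) h.le hp0.le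
    have h2 : p * (1 / 2 : ℝ) ^ p ≤ 1 := by
      have := one_add_mul_self_le_rpow_one_add (s := 1) (by norm_num) hp
      rw [one_div, Real.inv_rpow (by norm_num), ← div_eq_mul_inv, div_le_one (by positivity)]
      norm_num at this
      linarith
    have := mul_le_mul_of_nonneg_left (h0.trans h1) hp0.le
    nlinarith

lemma abs_pow_integrableOn (Ω : Set E2) (hΩb : IsBounded Ω) (p : ℝ) (u : E2 → ℝ) (hs : IsSolution Ω p u)
    (q : ℝ) (hq : 0 < q) : IntegrableOn (fun y => |u y| ^ q) Ω := by
  have hc : ContinuousOn (fun y => |u y| ^ q) (closure Ω) :=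
    (hs.2.1.abs).rpow_const fun x _ => Or.inr hq.le
  exact (hc.integrableOn_compact hΩb.isCompact_closure).mono_set subset_closure

lemma mass_total (Ω : Set E2) (hΩo : IsOpen Ω) (hΩb : IsBounded Ω) (p : ℝ) (hp : 1 ≤ p)
    (u : E2 → ℝ) (hs : IsSolution Ω p u) :
    p * ∫ y in Ω, (max (u y) 0) ^ p ≤ 2 * (p * ∫ y in Ω, |u y| ^ (p + 1)) + (volume Ω).toReal := by
  have h1 := posPart_pow_integrableOn Ω hΩo hΩb p (by linarith) u hs
  have h2 := abs_pow_integrableOn Ω hΩb p u hs (p + 1) (by linarith)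
  have h3 : IntegrableOn (fun _ : E2 => (1:ℝ)) Ω := integrableOn_const hΩb.measure_lt_top.ne
  have : ∫ y in Ω, p * (max (u y) 0) ^ p ≤ ∫ y in Ω, (2 * (p * |u y| ^ (p + 1)) + 1) :=
    integral_mono (h1.const_mul p) (((h2.const_mul p).const_mul 2).add h3) fun y => pow_le_energy (u y) p hp
  rw [integral_const_mul, integral_add ((h2.const_mul p).const_mul 2) h3, integral_const_mul, integral_const_mul,
    setIntegral_const, smul_eq_mul, mul_one] at this
  exact this

lemma radius_lt (z : E2) (r D : ℝ) (hr : 0 ≤ r) (h : closedBall z r ⊆ ball z D) : r < D := by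
  have hm : z + r • circDir 0 ∈ closedBall z r := by
    simp [norm_smul, norm_circDir, abs_of_nonneg hr]
  have := h hm
  simpa [norm_smul, norm_circDir, abs_of_nonneg hr] using this

lemma mk_bub (Ω : Set E2) (hΩo : IsOpen Ω) (hΩb : IsBounded Ω) (ρ E0 : ℝ) (hρ : 0 < ρ) :
    ∃ C0, ∀ᶠ p : ℝ in atTop, ∀ (u : E2 → ℝ) (a : E2) (ε : ℝ), IsSolution Ω p u →
      ball a (7 / 4 * ρ) ⊆ Ω → (∀ y ∈ ball a (7 / 4 * ρ), 0 < u y) → (∀ y ∈ Ω, u y ≤ u a) →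
      0 < ε → ε ^ 2 * (p * |u a| ^ (p - 1)) = 1 → p * (∫ y in Ω, |u y| ^ (p + 1)) ≤ E0 → Bub u p a ρ ε C0 := by
  obtain ⟨D, hDb⟩ : ∃ D, ∀ z ∈ Ω, Ω ⊆ ball z D := by
    obtain ⟨D, hD⟩ := Metric.isBounded_iff.1 hΩb
    refine ⟨D + 1, fun z hz y hy => ?_⟩
    rw [mem_ball]
    linarith [hD hy hz]
  set V := (volume Ω).toReal with hV
  have hV0 : 0 ≤ V := ENNReal.toReal_nonneg
  set A := 2 * |E0| + V with hA
  have hA0 : 0 ≤ A := by positivity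
  set B := ρ ^ 2 / 4 + (2 * π)⁻¹ * (|Real.log (D / ρ)| * V) with hB
  have hB0 : 0 < B := by positivity
  refine ⟨A + (2 * π)⁻¹ * (|Real.log (8 * D / ρ)| * A) + B, ?_⟩
  have hAB : 0 ≤ (2 * π)⁻¹ * (|Real.log (8 * D / ρ)| * A) := by positivity
  have hlim : Tendsto (fun p : ℝ => (1 / 2 : ℝ) ^ (p - 1) * B) atTop (𝓝 (0 * B)) := by
    refine Tendsto.mul_const B ?_
    exact (tendsto_rpow_atTop_of_base_lt_one (1 / 2) (by norm_num) (by norm_num)).comp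
      (tendsto_atTop_add_const_right _ _ tendsto_id)
  rw [zero_mul] at hlim
  filter_upwards [eventually_ge_atTop 2, hlim.eventually (gt_mem_nhds (show (0:ℝ) < 1 by norm_num))] with p hp2 hpB
  intro u a ε hs hsub hpos hle hε hsc hE
  have hp : 0 < p := by linarith
  have haG : a ∈ ball a (7 / 4 * ρ) := mem_ball_self (by linarith)
  have haΩ := hsub haG
  have hM := hpos a haG
  rw [abs_of_pos hM] at hsc
  have hmass := mass_total Ω hΩo hΩb p (by linarith) u hs
  have hmassA : p * ∫ y in Ω, (max (u y) 0) ^ p ≤ A := by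
    rw [hA]; linarith [le_abs_self E0]
  have hpi := posPart_pow_integrableOn Ω hΩo hΩb p hp u hs
  have hMp : ∫ y in Ω, (max (u y) 0) ^ p ≤ u a ^ p * V := by
    have e : ∫ y in Ω, (max (u y) 0) ^ p ≤ ∫ y in Ω, u a ^ p := by
      refine setIntegral_mono_on hpi (integrableOn_const hΩb.measure_lt_top.ne) hΩo.measurableSet fun y hy => ?_
      exact Real.rpow_le_rpow (le_max_right _ _) (max_le (hle y hy) hM.le) hp.le
    rw [setIntegral_const, smul_eq_mul, Measure.real] at e
    linarith
  have heqn : ∀ y ∈ ball a (7 / 4 * ρ), -lap u y = u y ^ p := fun y hy => by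
    have hy0 := hpos y hy
    rw [hs.2.2.1 y (hsub hy), abs_of_pos hy0, Real.rpow_sub_one hy0.ne']
    field_simp
  have hsm : ContDiffOn ℝ 2 u (ball a (7 / 4 * ρ)) := hs.1.mono hsub
  -- lower bound for the maximum
  have hsubρ : closedBall a ρ ⊆ ball a (7 / 4 * ρ) := closedBall_subset_ball (by linarith)
  have hrep := rep_local u _ isOpen_ball hsm a ρ hρ hsubρ
  have hρD : ρ < D := radius_lt a ρ D hρ.le ((hsubρ.trans hsub).trans (hDb a haΩ))
  have hc1 := cavg_sol_le Ω hΩo hΩb p hp u hs a ρ D hρ hρD.le (hDb a haΩ) (hsubρ.trans hsub)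
  have hlD : 0 ≤ Real.log (D / ρ) := Real.log_nonneg (by rw [le_div_iff₀ hρ]; linarith)
  have hMp0 : 0 < u a ^ p := by positivity
  have hI : ∫ y in ball a ρ, Real.log (ρ / ‖y - a‖) * (-lap u y) ≤ u a ^ p * (π * ρ ^ 2 / 2) := by
    rw [← integral_log_ball a ρ hρ, ← integral_const_mul]
    have hIntg := (integrableOn_log_ball a ρ hρ).const_mul (u a ^ p)
    refine integral_mono_of_nonneg ?_ hIntg ?_
    · filter_upwards [ae_restrict_mem measurableSet_ball, ae_ne_restrict a _] with y hy hya
      have hyn : 0 < ‖y - a‖ := norm_pos_iff.2 (sub_ne_zero.2 hya)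
      rw [mem_ball, dist_eq_norm] at hy
      have hyG := hsubρ (ball_subset_closedBall (by rwa [mem_ball, dist_eq_norm] : y ∈ ball a ρ))
      rw [heqn y hyG]
      have := hpos y hyG
      exact mul_nonneg (Real.log_nonneg (by rw [le_div_iff₀ hyn]; linarith)) (by positivity)
    · filter_upwards [ae_restrict_mem measurableSet_ball, ae_ne_restrict a _] with y hy hya
      have hyn : 0 < ‖y - a‖ := norm_pos_iff.2 (sub_ne_zero.2 hya)
      have hyG := hsubρ (ball_subset_closedBall hy)
      rw [mem_ball, dist_eq_norm] at hy
      rw [heqn y hyG, mul_comm]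
      exact mul_le_mul_of_nonneg_right (Real.rpow_le_rpow (hpos y hyG).le (hle y (hsub hyG)) hp.le)
        (Real.log_nonneg (by rw [le_div_iff₀ hyn]; linarith))
  have hMB : u a ≤ u a ^ p * B := by
    have e1 := mul_le_mul_of_nonneg_left hI (show 0 ≤ (2 * π)⁻¹ by positivity)
    have e2 := mul_le_mul_of_nonneg_left (mul_le_mul_of_nonneg_left hMp hlD) (show 0 ≤ (2 * π)⁻¹ by positivity)
    have e3 : (2 * π)⁻¹ * (u a ^ p * (π * ρ ^ 2 / 2)) = u a ^ p * (ρ ^ 2 / 4) := by field_simp; ring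
    rw [hB, abs_of_nonneg hlD]
    linarith
  have hMB1 : 1 ≤ u a ^ (p - 1) * B := by
    rw [Real.rpow_sub_one hM.ne']
    have : u a ^ p / u a * B = u a ^ p * B / u a := by ring
    rw [this, le_div_iff₀ hM]; linarith
  have hεB : ε ^ 2 * p ≤ B := by
    have e1 := mul_le_mul_of_nonneg_left hMB1 (show 0 ≤ ε ^ 2 * p by positivity)
    have e2 : ε ^ 2 * p * (u a ^ (p - 1) * B) = B * (ε ^ 2 * (p * u a ^ (p - 1))) := by ring
    rw [e2, hsc] at e1
    linarith
  refine ⟨hρ, hε, hp2, hsm, hpos, heqn, fun y hy => hle y (hsub hy), ?_, ?_, ?_, hsc, by linarith⟩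
  · have e1 : ∫ y in ball a (7 / 4 * ρ), u y ^ p ≤ ∫ y in Ω, (max (u y) 0) ^ p := by
      have e2 : ∫ y in ball a (7 / 4 * ρ), u y ^ p = ∫ y in ball a (7 / 4 * ρ), (max (u y) 0) ^ p :=
        setIntegral_congr_fun measurableSet_ball fun y hy => by simp only [max_eq_left (hpos y hy).le]
      rw [e2]
      exact setIntegral_mono_set hpi (Eventually.of_forall fun y => Real.rpow_nonneg (le_max_right _ _) _)
        (Eventually.of_forall hsub)
    have e3 := mul_le_mul_of_nonneg_left e1 hp.le
    linarith
  · intro z r hr hzr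
    have hr0 : 0 < r := by linarith
    have hzΩ : z ∈ Ω := hsub (hzr (mem_closedBall_self hr0.le))
    have hrD := radius_lt z r D hr0.le ((hzr.trans hsub).trans (hDb z hzΩ))
    have e1 := cavg_sol_le Ω hΩo hΩb p hp u hs z r D hr0 hrD.le (hDb z hzΩ) (hzr.trans hsub)
    have e2 := mul_le_mul_of_nonneg_left e1 hp.le
    have e3 : Real.log (D / r) ≤ |Real.log (8 * D / ρ)| := by
      refine le_trans (Real.log_le_log (div_pos (by linarith) hr0) ?_) (le_abs_self _)
      rw [div_le_div_iff₀ hr0 hρ]; nlinarith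
    have e4 : Real.log (D / r) * (p * ∫ y in Ω, (max (u y) 0) ^ p) ≤ |Real.log (8 * D / ρ)| * A :=
      mul_le_mul e3 hmassA (mul_nonneg hp.le (integral_nonneg fun y => Real.rpow_nonneg (le_max_right _ _) _)) (abs_nonneg _)
    have e5 := mul_le_mul_of_nonneg_left e4 (show 0 ≤ (2 * π)⁻¹ by positivity)
    linarith
  · by_contra hc
    push Not at hc
    have e1 : u a ^ (p - 1) ≤ (1 / 2) ^ (p - 1) := Real.rpow_le_rpow hM.le hc.le (by linarith)
    have := mul_le_mul_of_nonneg_right e1 hB0.le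
    linarith

lemma lap_neg' (u : E2 → ℝ) (x : E2) : lap (fun y => - u y) x = - lap u x := by
  unfold lap
  rw [← Finset.sum_neg_distrib]
  refine Finset.sum_congr rfl fun i _ => ?_
  have : (fun y => fderiv ℝ (fun y => - u y) y (EuclideanSpace.single i 1)) =
      fun y => - (fderiv ℝ u y (EuclideanSpace.single i 1)) := by
    funext y
    rw [fderiv_fun_neg]; rfl
  rw [this, fderiv_fun_neg]; rfl

lemma IsSolution.neg {Ω : Set E2} {p : ℝ} {u : E2 → ℝ} (h : IsSolution Ω p u) : IsSolution Ω p (fun y => - u y) := by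
  obtain ⟨h1, h2, h3, h4⟩ := h
  refine ⟨h1.neg, h2.neg, fun x hx => ?_, fun x hx => by simp [h4 x hx]⟩
  rw [lap_neg', h3 x hx |> neg_eq_iff_eq_neg.1, abs_neg]
  ring

/-- sign-normalised solutions -/
def sgnd (u : ℕ → E2 → ℝ) (i : Fin 2) (n : ℕ) (y : E2) : ℝ := if i = 0 then u n y else - u n y

lemma sgnd_zero (u : ℕ → E2 → ℝ) (n : ℕ) : sgnd u 0 n = u n := by funext y; simp [sgnd]
lemma sgnd_one (u : ℕ → E2 → ℝ) (n : ℕ) : sgnd u 1 n = fun y => - u n y := by funext y; simp [sgnd]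
lemma sgnd_abs (u : ℕ → E2 → ℝ) (i : Fin 2) (n : ℕ) (y : E2) : |sgnd u i n y| = |u n y| := by
  unfold sgnd; split_ifs <;> simp

lemma ball_in_domain (Ω : Set E2) (hΩo : IsOpen Ω) (p : ℝ) (w : E2 → ℝ) (hs : IsSolution Ω p w) (x : E2) (r : ℝ)
    (hr : 0 < r) (hx : x ∈ Ω) (hpos : ∀ y ∈ ball x r, 0 < w y) : ball x r ⊆ Ω := by
  intro y hy
  by_contra hyΩ
  have hpre : IsPreconnected (ball x r) := (convex_ball x r).isPreconnected
  have hfr : ∀ z ∈ ball x r, z ∉ Ω → z ∉ closure Ω := by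
    intro z hz hzΩ hzc
    have h1 := hpos z hz
    have h2 : z ∈ frontier Ω := by
      rw [hΩo.frontier_eq]; exact ⟨hzc, hzΩ⟩
    rw [hs.2.2.2 z h2] at h1
    exact lt_irrefl _ h1
  obtain ⟨z, _, hz1, hz2⟩ := hpre Ω (closure Ω)ᶜ hΩo isClosed_closure.isOpen_compl
    (fun z hz => by
      by_cases h : z ∈ Ω
      · exact Or.inl h
      · exact Or.inr (hfr z hz h))
    ⟨x, mem_ball_self hr, hx⟩ ⟨y, hy, hfr y hy hyΩ⟩
  exact hz2 (subset_closure hz1)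

/-- Lemma 3.3: logarithmic upper bound for the rescaled solutions
`v_{i,p}` in the annulus `R_δ ≤ |z| ≤ ϱ₀/ε_{i,p}`. -/
theorem rescaled_log_upper_bound
    (Ω : Set E2) (hΩo : IsOpen Ω) (hΩb : IsBounded Ω) (hΩne : Ω.Nonempty)
    (p : ℕ → ℝ) (hp1 : ∀ n, 1 < p n) (hptop : Tendsto p atTop atTop)
    (u : ℕ → E2 → ℝ)
    (hsol : ∀ n, IsSolution Ω (p n) (u n))
    (hnod : ∀ n, IsNodal Ω (u n))
    (hlow : Tendsto (fun n => p n * ∫ x in Ω, |u n x| ^ (p n + 1)) atTop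
      (𝓝 (16 * π * Real.exp 1)))
    (xl : Fin 2 → ℕ → E2)
    (hmax : ∀ n, xl 0 n ∈ Ω ∧ ∀ y ∈ closure Ω, u n y ≤ u n (xl 0 n))
    (hmin : ∀ n, xl 1 n ∈ Ω ∧ ∀ y ∈ closure Ω, u n (xl 1 n) ≤ u n y)
    (x : Fin 2 → E2) (hx : ∀ i, x i ∈ Ω) (hxne : x 0 ≠ x 1)
    (hxconv : ∀ i, Tendsto (fun n => xl i n) atTop (𝓝 (x i)))
    (ε : Fin 2 → ℕ → ℝ) (hεpos : ∀ i n, 0 < ε i n)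
    (hεdef : ∀ i n, (ε i n) ^ 2 * (p n * |u n (xl i n)| ^ (p n - 1)) = 1)
    (v : Fin 2 → ℕ → E2 → ℝ)
    (hv : ∀ i n z, v i n z =
      (p n / u n (xl i n)) * (u n (xl i n + ε i n • z) - u n (xl i n)))
    (r0 : ℝ) (hr0 : 0 < r0)
    (hdisj : Disjoint (ball (x 0) (2 * r0)) (ball (x 1) (2 * r0)))
    (ϱ0 : ℝ) (hϱ0 : ϱ0 ∈ Set.Ioo (0:ℝ) (r0 / 2)) (N0 : ℕ)
    (hsign : ∀ n ≥ N0,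
      (∀ y ∈ ball (x 0) (2 * ϱ0), 1 / p n ≤ u n y) ∧
      (∀ y ∈ ball (x 1) (2 * ϱ0), u n y ≤ -(1 / p n)))
    :
    ∀ δ ∈ Set.Ioo (0:ℝ) 1, ∃ N ≥ N0, ∃ R > (1:ℝ), ∃ C > (0:ℝ),
      ∀ n ≥ N, ∀ i : Fin 2, ∀ z : E2,
        R ≤ ‖z‖ → ‖z‖ ≤ ϱ0 / ε i n →
          v i n z ≤ (4 - δ) * Real.log (1 / ‖z‖) + C := by
  intro δ hδ
  obtain ⟨hρ, hρr⟩ := hϱ0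
  have hsolw : ∀ i n, IsSolution Ω (p n) (sgnd u i n) := by
    intro i n
    fin_cases i
    · exact (sgnd_zero u n) ▸ hsol n
    · exact (sgnd_one u n) ▸ (hsol n).neg
  have hmaxw : ∀ i n, ∀ y ∈ closure Ω, sgnd u i n y ≤ sgnd u i n (xl i n) := by
    intro i n y hy
    fin_cases i
    · simpa [sgnd] using (hmax n).2 y hy
    · simpa [sgnd] using (hmin n).2 y hy
  have hposw : ∀ i, ∀ n ≥ N0, ∀ y ∈ ball (x i) (2 * ϱ0), 0 < sgnd u i n y := by
    intro i n hn y hy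
    have hpn : 0 < 1 / p n := by have := hp1 n; positivity
    fin_cases i
    · have := (hsign n hn).1 y hy
      simp only [sgnd]; simp; linarith
    · have := (hsign n hn).2 y hy
      simp only [sgnd]; simp; linarith
  have hvw : ∀ i n z, v i n z =
      (p n / sgnd u i n (xl i n)) * (sgnd u i n (xl i n + ε i n • z) - sgnd u i n (xl i n)) := by
    intro i n z
    rw [hv]
    fin_cases i
    · simp [sgnd]
    · simp [sgnd, div_neg]; ring
  have hballΩ : ∀ i, ball (x i) (2 * ϱ0) ⊆ Ω := fun i =>
    ball_in_domain Ω hΩo (p N0) (sgnd u i N0) (hsolw i N0) (x i) (2 * ϱ0) (by linarith) (hx i) (hposw i N0 le_rfl)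
  obtain ⟨C0, hmk⟩ := mk_bub Ω hΩo hΩb ϱ0 (16 * π * Real.exp 1 + 1) hρ
  obtain ⟨η, hη, R, hR, C, hC, hfin⟩ := Bub.final ϱ0 C0 δ hρ hδ.1 hδ.2
  have hlower := Bub.lower ϱ0 C0 (16 * π * Real.exp 1 + 1) (η / 2) hρ (by positivity)
  have hconv : ∀ i, ∀ᶠ n in atTop, dist (xl i n) (x i) < ϱ0 / 4 := fun i =>
    (hxconv i).eventually (ball_mem_nhds (x i) (by positivity))
  have hev : ∀ᶠ n in atTop, ∀ i : Fin 2, ∀ z : E2,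
        R ≤ ‖z‖ → ‖z‖ ≤ ϱ0 / ε i n → v i n z ≤ (4 - δ) * Real.log (1 / ‖z‖) + C := by
    filter_upwards [eventually_ge_atTop N0, hconv 0, hconv 1, hptop.eventually hmk, hptop.eventually hfin,
      hptop.eventually hlower,
      hlow.eventually (gt_mem_nhds (show 16 * π * Real.exp 1 < 16 * π * Real.exp 1 + 1 by linarith)),
      hlow.eventually (gt_mem_nhds (show 16 * π * Real.exp 1 < 16 * π * Real.exp 1 + η / 2 by linarith))]
      with n hn hc0 hc1 hmk hfin hlower hE1 hEη
    have hc : ∀ i, dist (xl i n) (x i) < ϱ0 / 4 := by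
      intro i; fin_cases i
      · exact hc0
      · exact hc1
    have hsub : ∀ i r, r ≤ 7 / 4 * ϱ0 → ball (xl i n) r ⊆ ball (x i) (2 * ϱ0) := fun i r hr =>
      ball_subset_ball' (by linarith [hc i])
    have habs : ∀ i, ∫ y in Ω, |sgnd u i n y| ^ (p n + 1) = ∫ y in Ω, |u n y| ^ (p n + 1) := fun i => by
      simp only [sgnd_abs]
    have hp0 : 0 < p n := by linarith [hp1 n]
    have hB : ∀ i, Bub (sgnd u i n) (p n) (xl i n) ϱ0 (ε i n) C0 := by
      intro i
      refine hmk _ _ _ (hsolw i n) ((hsub i _ le_rfl).trans (hballΩ i)) (fun y hy => hposw i n hn y (hsub i _ le_rfl hy))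
        (fun y hy => hmaxw i n y (subset_closure hy)) (hεpos i n) ?_ ?_
      · rw [sgnd_abs]; exact hεdef i n
      · rw [habs i]; exact hE1.le
    have hIntg := abs_pow_integrableOn Ω hΩb (p n) (u n) (hsol n) (p n + 1) (by linarith)
    have hb32 : ∀ i, ball (xl i n) (3 / 2 * ϱ0) ⊆ ball (x i) (2 * ϱ0) := fun i => hsub i _ (by linarith)
    have heq : ∀ i, ∫ y in ball (xl i n) (3 / 2 * ϱ0), sgnd u i n y ^ (p n + 1) =
        ∫ y in ball (xl i n) (3 / 2 * ϱ0), |u n y| ^ (p n + 1) := by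
      intro i
      refine setIntegral_congr_fun measurableSet_ball fun y hy => ?_
      simp only [← sgnd_abs u i n y, abs_of_pos (hposw i n hn y (hb32 i hy))]
    have hdis : Disjoint (ball (xl 0 n) (3 / 2 * ϱ0)) (ball (xl 1 n) (3 / 2 * ϱ0)) :=
      hdisj.mono ((hb32 0).trans (ball_subset_ball (by linarith))) ((hb32 1).trans (ball_subset_ball (by linarith)))
    have hun : ball (xl 0 n) (3 / 2 * ϱ0) ∪ ball (xl 1 n) (3 / 2 * ϱ0) ⊆ Ω :=
      Set.union_subset ((hb32 0).trans (hballΩ 0)) ((hb32 1).trans (hballΩ 1))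
    have hsum : (∫ y in ball (xl 0 n) (3 / 2 * ϱ0), |u n y| ^ (p n + 1)) +
        ∫ y in ball (xl 1 n) (3 / 2 * ϱ0), |u n y| ^ (p n + 1) ≤ ∫ y in Ω, |u n y| ^ (p n + 1) := by
      rw [← setIntegral_union hdis measurableSet_ball (hIntg.mono_set (Set.subset_union_left.trans hun))
        (hIntg.mono_set (Set.subset_union_right.trans hun))]
      exact setIntegral_mono_set hIntg (Eventually.of_forall fun y => by simp only [Pi.zero_apply]; positivity)
        (Eventually.of_forall hun)
    have hsum' := mul_le_mul_of_nonneg_left hsum hp0.le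
    rw [mul_add] at hsum'
    have hnn : ∀ i, 0 ≤ p n * ∫ y in ball (xl i n) (3 / 2 * ϱ0), |u n y| ^ (p n + 1) := fun i =>
      mul_nonneg hp0.le (integral_nonneg fun y => by simp only [Pi.zero_apply]; positivity)
    have hn0 := hnn 0
    have hn1 := hnn 1
    have hlow' : ∀ i, p n * (∫ y in ball (xl i n) (3 / 2 * ϱ0), |u n y| ^ (p n + 1)) ≤ 16 * π * Real.exp 1 + 1 →
        8 * π * Real.exp 1 - η / 2 ≤ p n * ∫ y in ball (xl i n) (3 / 2 * ϱ0), |u n y| ^ (p n + 1) := by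
      intro i hi
      rw [← heq i] at hi ⊢
      exact hlower _ _ _ (hB i) (3 / 2 * ϱ0) (by linarith) le_rfl hi
    have hl0 := hlow' 0 (by linarith)
    have hl1 := hlow' 1 (by linarith)
    have hup : ∀ i, p n * ∫ y in ball (xl i n) (3 / 2 * ϱ0), |u n y| ^ (p n + 1) ≤ 8 * π * Real.exp 1 + η := by
      intro i; fin_cases i
      · simp only [Fin.zero_eta, Fin.isValue]; linarith
      · simp only [Fin.mk_one, Fin.isValue]; linarith
    intro i z hz1 hz2
    rw [hvw]
    refine hfin _ _ _ (hB i) ?_ z hz1 hz2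
    rw [heq i]; exact hup i
  obtain ⟨N, hN⟩ := eventually_atTop.1 hev
  exact ⟨max N N0, le_max_right _ _, R, hR, C, hC, fun n hn i z h1 h2 => hN n ((le_max_left _ _).trans hn) i z h1 h2⟩

end
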